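/- For every integer k with 1 ≤ k ≤ 8, every double-critical k-chromatic finite simple graph contains K_k as a minor. -/

import Mathlib

open SimpleGraph

/-- `H` is a minor of `G`: there is a family of nonempty, pairwise disjoint,
connected branch sets in `G`, one for each vertex of `H`, with an edge of `G`
between the branch sets corresponding to each edge of `H`. -/
def SimpleGraph.MinorOf {W V : Type} (H : SimpleGraph W) (G : SimpleGraph V) : Prop :=
  ∃ f : W → Set V,
    (∀ w, (f w).Nonempty) ∧
    (∀ w, (G.induce (f w)).Connected) ∧
    (∀ w₁ w₂, w₁ ≠ w₂ → Disjoint (f w₁) (f w₂)) ∧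
    (∀ w₁ w₂, H.Adj w₁ w₂ → ∃ v₁ ∈ f w₁, ∃ v₂ ∈ f w₂, G.Adj v₁ v₂)

namespace SimpleGraph

theorem induce_connected_iff {V : Type} {G : SimpleGraph V} {s : Set V} :
    (G.induce s).Connected ↔ s.Nonempty ∧ ∀ u ∈ s, ∀ v ∈ s,
      Relation.ReflTransGen (fun a b => G.Adj a b ∧ a ∈ s ∧ b ∈ s) u v := by
  constructor
  · intro h
    refine ⟨Set.nonempty_coe_sort.mp h.nonempty, fun u hu v hv => ?_⟩
    have := (reachable_iff_reflTransGen _ _).1 (h.preconnected ⟨u, hu⟩ ⟨v, hv⟩)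
    exact this.lift (fun x : s => (x : V)) (fun a b hab => ⟨hab, a.2, b.2⟩)
  · rintro ⟨hne, h⟩
    have : Nonempty s := hne.to_subtype
    refine ⟨fun u v => ?_⟩
    have key : ∀ w, Relation.ReflTransGen (fun a b => G.Adj a b ∧ a ∈ s ∧ b ∈ s) u.1 w →
        ∃ hw : w ∈ s, (G.induce s).Reachable u ⟨w, hw⟩ := by
      intro w hw
      induction hw with
      | refl => exact ⟨u.2, Reachable.refl _⟩
      | tail _ hbc ih =>
        obtain ⟨hb, hr⟩ := ih
        exact ⟨hbc.2.2, hr.trans (Adj.reachable (by simpa using hbc.1))⟩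
    exact (key v.1 (h u.1 u.2 v.1 v.2)).2

theorem induce_singleton_connected {V : Type} (G : SimpleGraph V) (v : V) :
    (G.induce ({v} : Set V)).Connected := by
  refine induce_connected_iff.2 ⟨⟨v, rfl⟩, ?_⟩
  rintro a rfl b rfl
  exact .refl

/-- A connected family of connected sets has connected union. -/
theorem induce_biUnion_connected {W V : Type} {H : SimpleGraph W} {G : SimpleGraph V}
    {f : W → Set V} {T : Set W} (hf : ∀ w ∈ T, (G.induce (f w)).Connected)
    (hT : (H.induce T).Connected)
    (hadj : ∀ w₁ w₂, H.Adj w₁ w₂ → ∃ v₁ ∈ f w₁, ∃ v₂ ∈ f w₂, G.Adj v₁ v₂) :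
    (G.induce (⋃ w ∈ T, f w)).Connected := by
  obtain ⟨⟨t, ht⟩, hT⟩ := induce_connected_iff.1 hT
  obtain ⟨⟨v, hv⟩, -⟩ := induce_connected_iff.1 (hf t ht)
  refine induce_connected_iff.2 ⟨⟨v, by simp only [Set.mem_iUnion]; exact ⟨t, ht, hv⟩⟩, ?_⟩
  intro a ha b hb
  simp only [Set.mem_iUnion] at ha hb
  obtain ⟨i, hi, ha⟩ := ha
  obtain ⟨j, hj, hb⟩ := hb
  have inner : ∀ w ∈ T, ∀ c ∈ f w, ∀ d ∈ f w, Relation.ReflTransGen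
      (fun a b => G.Adj a b ∧ a ∈ (⋃ w ∈ T, f w) ∧ b ∈ (⋃ w ∈ T, f w)) c d := by
    intro w hw c hc d hd
    refine Relation.ReflTransGen.mono ?_ _ _ ((induce_connected_iff.1 (hf w hw)).2 c hc d hd)
    rintro x y ⟨h1, h2, h3⟩
    exact ⟨h1, Set.mem_biUnion hw h2, Set.mem_biUnion hw h3⟩
  have key : ∀ w, Relation.ReflTransGen (fun a b => H.Adj a b ∧ a ∈ T ∧ b ∈ T) i w →
      w ∈ T ∧ ∀ d ∈ f w, Relation.ReflTransGen
      (fun a b => G.Adj a b ∧ a ∈ (⋃ w ∈ T, f w) ∧ b ∈ (⋃ w ∈ T, f w)) a d := by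
    intro w hw
    induction hw with
    | refl => exact ⟨hi, fun d hd => inner i hi a ha d hd⟩
    | tail _ hbc ih =>
      obtain ⟨x, hx, y, hy, hxy⟩ := hadj _ _ hbc.1
      refine ⟨hbc.2.2, fun d hd => ?_⟩
      exact ((ih.2 x hx).tail ⟨hxy, Set.mem_biUnion hbc.2.1 hx,
        Set.mem_biUnion hbc.2.2 hy⟩).trans (inner _ hbc.2.2 y hy d hd)
  exact (key j (hT i hi j hj)).2 b hb

theorem induce_union_connected_of_adj {V : Type} {G : SimpleGraph V} {s t : Set V}
    (hs : (G.induce s).Connected) (ht : (G.induce t).Connected)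
    {a b : V} (ha : a ∈ s) (hb : b ∈ t) (hab : G.Adj a b) :
    (G.induce (s ∪ t)).Connected := by
  have h : (⋃ w ∈ (Set.univ : Set Bool), (if w then s else t)) = s ∪ t := by
    ext x; simp [or_comm]
  rw [← h]
  refine induce_biUnion_connected (H := (⊤ : SimpleGraph Bool)) ?_ ?_ ?_
  · rintro (_ | _) - <;> simpa
  · refine induce_connected_iff.2 ⟨⟨true, trivial⟩, fun u _ v _ => ?_⟩
    by_cases huv : u = v
    · subst huv; exact .refl
    · exact .single ⟨huv, trivial, trivial⟩
  · rintro (_ | _) (_ | _) h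
    · exact absurd rfl h.ne
    · exact ⟨b, by simpa, a, by simpa, hab.symm⟩
    · exact ⟨a, by simpa, b, by simpa, hab⟩
    · exact absurd rfl h.ne

theorem MinorOf.trans {W₁ W₂ V : Type} {H₁ : SimpleGraph W₁} {H₂ : SimpleGraph W₂}
    {G : SimpleGraph V} (h₁ : H₁.MinorOf H₂) (h₂ : H₂.MinorOf G) : H₁.MinorOf G := by
  obtain ⟨f, f1, f2, f3, f4⟩ := h₁
  obtain ⟨g, g1, g2, g3, g4⟩ := h₂
  refine ⟨fun i => ⋃ w ∈ f i, g w, fun i => ?_, fun i => ?_, fun i j hij => ?_, fun i j hij => ?_⟩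
  · obtain ⟨w, hw⟩ := f1 i
    obtain ⟨v, hv⟩ := g1 w
    exact ⟨v, Set.mem_biUnion hw hv⟩
  · exact induce_biUnion_connected (fun w _ => g2 w) (f2 i) g4
  · rw [Set.disjoint_left]
    intro v hv hv'
    simp only [Set.mem_iUnion] at hv hv'
    obtain ⟨a, ha, hva⟩ := hv
    obtain ⟨b, hb, hvb⟩ := hv'
    have hab : a ≠ b := by
      rintro rfl
      exact Set.disjoint_left.1 (f3 i j hij) ha hb
    exact Set.disjoint_left.1 (g3 a b hab) hva hvb
  · obtain ⟨a, ha, b, hb, hab⟩ := f4 i j hij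
    obtain ⟨x, hx, y, hy, hxy⟩ := g4 a b hab
    exact ⟨x, Set.mem_biUnion ha hx, y, Set.mem_biUnion hb hy, hxy⟩

/-- Disjoint vertices chosen by an injective homomorphism form branch sets. -/
theorem MinorOf.of_injective_hom {W V : Type} {H : SimpleGraph W} {G : SimpleGraph V}
    (φ : W → V) (hφ : Function.Injective φ) (h : ∀ a b, H.Adj a b → G.Adj (φ a) (φ b)) :
    H.MinorOf G :=
  ⟨fun w => {φ w}, fun w => ⟨_, rfl⟩, fun w => induce_singleton_connected G _,
    fun a b hab => by simpa using fun h => hab (hφ h.symm).symm,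
    fun a b hab => ⟨_, rfl, _, rfl, h a b hab⟩⟩

/-- The star with centre `w` and leaf set `T \ {w}`. -/
def starAt {V : Type} (w : V) (T : Set V) : SimpleGraph V :=
  fromRel fun a b => a = w ∧ b ∈ T

/-- Branch sets `{φ i} ∪ D i`, where `D i` is empty or connected and attached to `φ i`. -/
theorem rooted_branchSets {W V : Type} {H : SimpleGraph W} {G : SimpleGraph V} (φ : W → V)
    (hφ : Function.Injective φ) (D : W → Set V)
    (hD : ∀ i, D i = ∅ ∨ ((G.induce (D i)).Connected ∧ ∃ d ∈ D i, G.Adj (φ i) d))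
    (hDφ : ∀ i j, φ i ∉ D j) (hDD : ∀ i j, i ≠ j → Disjoint (D i) (D j))
    (hH : ∀ i j, H.Adj i j →
      G.Adj (φ i) (φ j) ∨ (∃ d ∈ D i, G.Adj d (φ j)) ∨ (∃ d ∈ D j, G.Adj d (φ i))) :
    (∀ i, (G.induce ({φ i} ∪ D i)).Connected) ∧
    (∀ i j, i ≠ j → Disjoint ({φ i} ∪ D i) ({φ j} ∪ D j)) ∧
    (∀ i j, H.Adj i j → ∃ v₁ ∈ {φ i} ∪ D i, ∃ v₂ ∈ {φ j} ∪ D j, G.Adj v₁ v₂) := by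
  refine ⟨fun i => ?_, fun i j hij => ?_, fun i j hij => ?_⟩
  · rcases hD i with h | ⟨h, d, hd, hid⟩
    · rw [h, Set.union_empty]
      exact induce_singleton_connected G _
    · exact induce_union_connected_of_adj (induce_singleton_connected G _) h rfl hd hid
  · rw [Set.disjoint_left]
    rintro x (rfl | hx) (h | hx')
    · exact hij (hφ h)
    · exact hDφ _ _ hx'
    · exact hDφ j i ((show x = φ j from h) ▸ hx)
    · exact Set.disjoint_left.1 (hDD i j hij) hx hx'
  · rcases hH i j hij with h | ⟨d, hd, h⟩ | ⟨d, hd, h⟩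
    · exact ⟨_, .inl rfl, _, .inl rfl, h⟩
    · exact ⟨d, .inr hd, _, .inl rfl, h⟩
    · exact ⟨_, .inl rfl, d, .inr hd, h.symm⟩

/-- Contracting a connected set `D` into a neighbour `w` joins `w` to all neighbours of `D`. -/
theorem minorOf_contract {V : Type} {G : SimpleGraph V} {A D : Set V} (hAD : Disjoint A D)
    (hD : (G.induce D).Connected) {w d : V} (hd : d ∈ D) (hwd : G.Adj w d) :
    ((G ⊔ starAt w {v | ∃ d ∈ D, G.Adj d v}).induce A).MinorOf G := by
  classical
  have key := rooted_branchSets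
    (H := (G ⊔ starAt w {v | ∃ d ∈ D, G.Adj d v}).induce A) (G := G)
    (fun a : A => (a : V)) Subtype.val_injective (fun a => if (a : V) = w then D else ∅)
    (fun a => by
      by_cases h : (a : V) = w
      · rw [if_pos h]
        exact .inr ⟨hD, d, hd, h ▸ hwd⟩
      · exact .inl (if_neg h))
    (fun a b => by
      split_ifs
      · exact Set.disjoint_left.1 hAD a.2
      · exact id)
    (fun a b hab => by
      split_ifs with h h'
      · exact absurd (Subtype.ext (h.trans h'.symm)) hab
      all_goals simp)
    (fun a b hab => by
      simp only [comap_adj, Function.Embedding.subtype_apply, sup_adj, starAt, fromRel_adj,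
        Set.mem_ofPred_eq] at hab
      rcases hab with h | ⟨-, ⟨h, d, hd, hdb⟩ | ⟨h, d, hd, hda⟩⟩
      · exact .inl h
      · exact .inr (.inl ⟨d, by simp [h, hd], hdb⟩)
      · exact .inr (.inr ⟨d, by simp [h, hd], hda⟩))
  exact ⟨_, fun a => ⟨_, .inl rfl⟩, key.1, key.2.1, key.2.2⟩

/-- `G` with a new vertex `none` joined to everything. -/
def cone {V : Type} (G : SimpleGraph V) : SimpleGraph (Option V) where
  Adj
    | none, none => False
    | none, some _ => True
    | some _, none => True
    | some a, some b => G.Adj a b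
  symm := ⟨by rintro (_ | a) (_ | b) h <;> first | trivial | exact h | exact SimpleGraph.Adj.symm h⟩
  loopless := ⟨by rintro (_ | a) h <;> first | exact h | exact G.loopless.irrefl _ h⟩

@[simp] theorem cone_adj_none_some {V : Type} (G : SimpleGraph V) (a : V) :
    G.cone.Adj none (some a) := trivial

/-- Branch sets which all meet the neighbourhood of a further vertex `x`. -/
theorem cone_minorOf {W V : Type} {H : SimpleGraph W} {G : SimpleGraph V} (x : V)
    (f : W → Set V) (hx : ∀ w, x ∉ f w) (hN : ∀ w, ∃ v ∈ f w, G.Adj x v)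
    (hc : ∀ w, (G.induce (f w)).Connected)
    (hd : ∀ w₁ w₂, w₁ ≠ w₂ → Disjoint (f w₁) (f w₂))
    (ha : ∀ w₁ w₂, H.Adj w₁ w₂ → ∃ v₁ ∈ f w₁, ∃ v₂ ∈ f w₂, G.Adj v₁ v₂) :
    H.cone.MinorOf G := by
  refine ⟨fun o => o.elim {x} f, ?_, ?_, ?_, ?_⟩
  · rintro (_ | w)
    · exact ⟨x, rfl⟩
    · obtain ⟨v, hv, -⟩ := hN w
      exact ⟨v, hv⟩
  · rintro (_ | w)
    · exact induce_singleton_connected G x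
    · exact hc w
  · rintro (_ | a) (_ | b) hab
    · exact absurd rfl hab
    · simpa using hx b
    · simpa using hx a
    · exact hd a b (fun h => hab (congrArg some h))
  · rintro (_ | a) (_ | b) hab
    · exact absurd rfl hab.ne
    · obtain ⟨v, hv, h⟩ := hN b
      exact ⟨x, rfl, v, hv, h⟩
    · obtain ⟨v, hv, h⟩ := hN a
      exact ⟨v, hv, x, rfl, h.symm⟩
    · exact ha a b hab

/-- A minor with branch sets rooted at neighbours of `x`, together with `x` itself. -/
theorem cone_minorOf_rooted {W V : Type} {H : SimpleGraph W} {G : SimpleGraph V} (x : V)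
    (φ : W → V) (hφ : Function.Injective φ) (hx : ∀ i, G.Adj x (φ i)) (D : W → Set V)
    (hxD : ∀ i, x ∉ D i)
    (hD : ∀ i, D i = ∅ ∨ ((G.induce (D i)).Connected ∧ ∃ d ∈ D i, G.Adj (φ i) d))
    (hDφ : ∀ i j, φ i ∉ D j) (hDD : ∀ i j, i ≠ j → Disjoint (D i) (D j))
    (hH : ∀ i j, H.Adj i j →
      G.Adj (φ i) (φ j) ∨ (∃ d ∈ D i, G.Adj d (φ j)) ∨ (∃ d ∈ D j, G.Adj d (φ i))) :
    H.cone.MinorOf G := by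
  obtain ⟨h1, h2, h3⟩ := rooted_branchSets φ hφ D hD hDφ hDD hH
  refine cone_minorOf x _ (fun i => ?_) (fun i => ⟨_, .inl rfl, hx i⟩) h1 h2 h3
  rintro (h | h)
  · exact (hx i).ne h
  · exact hxD i h

theorem MinorOf.cone {W V : Type} {H : SimpleGraph W} {G : SimpleGraph V} (h : H.MinorOf G) :
    H.cone.MinorOf G.cone := by
  obtain ⟨f, f1, f2, f3, f4⟩ := h
  refine cone_minorOf none (fun w => some '' f w) (by simp) (fun w => ?_) (fun w => ?_)
    (fun a b hab => ?_) (fun a b hab => ?_)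
  · obtain ⟨v, hv⟩ := f1 w
    exact ⟨some v, ⟨v, hv, rfl⟩, trivial⟩
  · obtain ⟨hne, h⟩ := induce_connected_iff.1 (f2 w)
    refine induce_connected_iff.2 ⟨hne.image _, ?_⟩
    rintro _ ⟨a, ha, rfl⟩ _ ⟨b, hb, rfl⟩
    exact (h a ha b hb).lift some fun x y hxy =>
      ⟨hxy.1, Set.mem_image_of_mem _ hxy.2.1, Set.mem_image_of_mem _ hxy.2.2⟩
  · exact (Set.disjoint_image_iff (Option.some_injective V)).2 (f3 a b hab)
  · obtain ⟨x, hx, y, hy, hxy⟩ := f4 a b hab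
    exact ⟨some x, ⟨x, hx, rfl⟩, some y, ⟨y, hy, rfl⟩, hxy⟩

theorem top_succ_minorOf {k : ℕ} {V : Type} {G : SimpleGraph V}
    (h : ((⊤ : SimpleGraph (Fin k)).cone).MinorOf G) :
    (⊤ : SimpleGraph (Fin (k + 1))).MinorOf G := by
  refine MinorOf.trans (MinorOf.of_injective_hom (finSuccEquiv k) (finSuccEquiv k).injective ?_) h
  intro a b hab
  have : finSuccEquiv k a ≠ finSuccEquiv k b := fun h => hab ((finSuccEquiv k).injective h)
  generalize finSuccEquiv k a = a' at *
  generalize finSuccEquiv k b = b' at *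
  rcases a' with _ | a' <;> rcases b' with _ | b'
  · exact absurd rfl this
  · trivial
  · trivial
  · exact fun h => this (congrArg some h)

/-- `K` is (the vertex set of) a connected component of the subgraph induced by `s`. -/
def IsComp {V : Type} (G : SimpleGraph V) (s K : Set V) : Prop :=
  K ⊆ s ∧ (G.induce K).Connected ∧ ∀ a ∈ K, ∀ b ∈ s, G.Adj a b → b ∈ K

theorem exists_isComp {V : Type} (G : SimpleGraph V) {s : Set V} {v : V} (hv : v ∈ s) :
    ∃ K, G.IsComp s K ∧ v ∈ K := by
  let r : V → V → Prop := fun a b => G.Adj a b ∧ a ∈ s ∧ b ∈ s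
  have hs : ∀ w, Relation.ReflTransGen r v w → w ∈ s := by
    intro w hw
    induction hw with
    | refl => exact hv
    | tail _ h _ => exact h.2.2
  refine ⟨{w | Relation.ReflTransGen r v w}, ⟨fun w hw => hs w hw, ?_, ?_⟩, .refl⟩
  · refine induce_connected_iff.2 ⟨⟨v, .refl⟩, ?_⟩
    have key : ∀ w, Relation.ReflTransGen r v w → Relation.ReflTransGen (fun a b => G.Adj a b ∧
        a ∈ {w | Relation.ReflTransGen r v w} ∧ b ∈ {w | Relation.ReflTransGen r v w}) v w := by
      intro w hw
      induction hw with
      | refl => exact .refl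
      | tail h1 h2 ih => exact ih.tail ⟨h2.1, h1, h1.tail h2⟩
    intro a ha b hb
    have : Std.Symm (fun a b => G.Adj a b ∧ a ∈ {w | Relation.ReflTransGen r v w} ∧
        b ∈ {w | Relation.ReflTransGen r v w}) := ⟨fun _ _ h => ⟨h.1.symm, h.2.2, h.2.1⟩⟩
    exact (Relation.ReflTransGen.stdSymm.symm _ _ (key a ha)).trans (key b hb)
  · intro a ha b hb hab
    exact Relation.ReflTransGen.tail ha ⟨hab, hs a ha, hb⟩

theorem IsComp.subset_of_connected {V : Type} {G : SimpleGraph V} {s K D : Set V}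
    (hK : G.IsComp s K) (hD : (G.induce D).Connected) (hDs : D ⊆ s) {v : V} (hvD : v ∈ D)
    (hvK : v ∈ K) : D ⊆ K := by
  intro w hw
  have h := (induce_connected_iff.1 hD).2 v hvD w hw
  clear hw
  induction h with
  | refl => exact hvK
  | tail _ h ih => exact hK.2.2 _ ih _ (hDs h.2.2) h.1

section Counting
open scoped Classical
open Finset

/-- The number of neighbours of `a` in `B`. -/
noncomputable def degIn {V : Type} (G : SimpleGraph V) (B : Finset V) (a : V) : ℕ :=
  #{b ∈ B | G.Adj a b}

/-- The number of pairs `(a, b) ∈ A × B` which are adjacent in `G`. -/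
noncomputable def dcount {V : Type} (G : SimpleGraph V) (A B : Finset V) : ℕ :=
  ∑ a ∈ A, G.degIn B a

theorem dcount_comm {V : Type} (G : SimpleGraph V) (A B : Finset V) :
    G.dcount A B = G.dcount B A := by
  unfold dcount degIn
  have := sum_card_bipartiteAbove_eq_sum_card_bipartiteBelow (s := A) (t := B) G.Adj
  simpa [bipartiteAbove, bipartiteBelow, adj_comm] using this

theorem dcount_union_left {V : Type} (G : SimpleGraph V) {A B : Finset V} (h : Disjoint A B)
    (C : Finset V) : G.dcount (A ∪ B) C = G.dcount A C + G.dcount B C :=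
  sum_union h

theorem dcount_union_right {V : Type} (G : SimpleGraph V) {A B : Finset V} (h : Disjoint A B)
    (C : Finset V) : G.dcount C (A ∪ B) = G.dcount C A + G.dcount C B := by
  rw [dcount_comm, dcount_union_left G h, dcount_comm, dcount_comm G B]

theorem dcount_union_self {V : Type} (G : SimpleGraph V) {A B : Finset V} (h : Disjoint A B) :
    G.dcount (A ∪ B) (A ∪ B) = G.dcount A A + 2 * G.dcount A B + G.dcount B B := by
  rw [dcount_union_left G h, dcount_union_right G h, dcount_union_right G h, dcount_comm G B A]
  ring

theorem dcount_singleton {V : Type} (G : SimpleGraph V) (v : V) (B : Finset V) :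
    G.dcount {v} B = G.degIn B v := by
  simp [dcount]

theorem dcount_congr_right {V : Type} (G : SimpleGraph V) {A B C : Finset V} (hCB : C ⊆ B)
    (h : ∀ a ∈ A, ∀ b ∈ B, G.Adj a b → b ∈ C) : G.dcount A B = G.dcount A C := by
  refine sum_congr rfl fun a ha => congrArg card ?_
  ext b
  simp only [mem_filter]
  exact ⟨fun hb => ⟨h a ha b hb.1 hb.2, hb.2⟩, fun hb => ⟨hCB hb.1, hb.2⟩⟩

theorem le_dcount {V : Type} (G : SimpleGraph V) {A B : Finset V} {m : ℕ}
    (h : ∀ a ∈ A, m ≤ G.degIn B a) : m * #A ≤ G.dcount A B := by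
  have := card_nsmul_le_sum A (G.degIn B) m h
  simpa [dcount, mul_comm] using this

theorem dcount_le {V : Type} (G : SimpleGraph V) {A B : Finset V} {m : ℕ}
    (h : ∀ a ∈ A, G.degIn B a ≤ m) : G.dcount A B ≤ m * #A := by
  have := sum_le_card_nsmul A (G.degIn B) m h
  simpa [dcount, mul_comm] using this

/-- Adding a star at `w` with new leaves `P`. -/
theorem dcount_add_star {V : Type} (G : SimpleGraph V) {A P : Finset V} {w : V} {T : Set V}
    (hw : w ∈ A) (hPA : P ⊆ A) (hwP : w ∉ P) (hPT : ∀ p ∈ P, p ∈ T) (hP : ∀ p ∈ P, ¬ G.Adj w p) :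
    G.dcount A A + 2 * #P ≤ (G ⊔ starAt w T).dcount A A := by
  have key : ∀ a ∈ A, G.degIn A a + ((if a ∈ P then 1 else 0) + if a = w then #P else 0)
      ≤ (G ⊔ starAt w T).degIn A a := by
    intro a ha
    by_cases haw : a = w
    · subst haw
      unfold degIn
      rw [if_neg hwP, if_pos rfl, zero_add, ← card_union_of_disjoint]
      · refine card_le_card fun b hb => ?_
        simp only [mem_union, mem_filter] at hb ⊢
        rcases hb with hb | hb
        · exact ⟨hb.1, .inl hb.2⟩
        · refine ⟨hPA hb, .inr ⟨?_, .inl ⟨rfl, hPT b hb⟩⟩⟩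
          rintro rfl
          exact hwP hb
      · rw [Finset.disjoint_left]
        intro b hb hbP
        exact hP b hbP (mem_filter.1 hb).2
    · unfold degIn
      rw [if_neg haw, add_zero]
      split_ifs with haP
      · rw [← card_singleton w, ← card_union_of_disjoint]
        · refine card_le_card fun b hb => ?_
          simp only [mem_union, mem_filter, mem_singleton] at hb ⊢
          rcases hb with hb | rfl
          · exact ⟨hb.1, .inl hb.2⟩
          · exact ⟨hw, .inr ⟨haw, .inr ⟨rfl, hPT a haP⟩⟩⟩
        · rw [Finset.disjoint_singleton_right]
          intro hb
          exact hP a haP (mem_filter.1 hb).2.symm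
      · rw [add_zero]
        refine card_le_card fun b hb => ?_
        simp only [mem_filter] at hb ⊢
        exact ⟨hb.1, .inl hb.2⟩
  have h := sum_le_sum key
  rw [sum_add_distrib, sum_add_distrib, sum_ite_mem, inter_eq_right.2 hPA,
    sum_ite_eq_of_mem' _ _ _ hw]
    at h
  simp only [sum_const, smul_eq_mul, mul_one] at h
  unfold dcount
  omega

theorem degIn_le_card {V : Type} (G : SimpleGraph V) (A : Finset V) (v : V) :
    G.degIn A v ≤ #A :=
  card_filter_le _ _

theorem degIn_union {V : Type} (G : SimpleGraph V) {A B : Finset V} (h : Disjoint A B) (v : V) :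
    G.degIn (A ∪ B) v = G.degIn A v + G.degIn B v := by
  unfold degIn
  rw [filter_union, card_union_of_disjoint (disjoint_filter_filter h)]

theorem dcount_map {W V : Type} {H : SimpleGraph W} {G : SimpleGraph V} (φ : W ↪ V)
    (h : ∀ a b, H.Adj a b ↔ G.Adj (φ a) (φ b)) (A B : Finset W) :
    H.dcount A B = G.dcount (A.map φ) (B.map φ) := by
  unfold dcount degIn
  rw [sum_map]
  refine sum_congr rfl fun a _ => ?_
  rw [filter_map, card_map]
  exact congrArg card (filter_congr fun b _ => h a b)

/-- The density bound for graphs on `m` vertices without a `K₈` minor. -/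
def EdgeBound (m : ℕ) : Prop :=
  ∀ (W : Type) [Fintype W] (H : SimpleGraph W), Fintype.card W = m →
    ¬ (⊤ : SimpleGraph (Fin 8)).MinorOf H → H.dcount univ univ + 40 ≤ 12 * m

/-- The properties of a hypothetical counterexample used in the main argument. -/
structure Critical {V : Type} [Fintype V] (G : SimpleGraph V) : Prop where
  noMinor : ¬ (⊤ : SimpleGraph (Fin 8)).MinorOf G
  bound : ∀ A : Finset V, A ≠ univ → 5 ≤ #A → ∀ H : SimpleGraph V,
    (H.induce (A : Set V)).MinorOf G → H.dcount A A + 40 ≤ 12 * #A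
  edges : G.dcount univ univ + 38 ≤ 12 * Fintype.card V
  tri : ∀ u v, G.Adj u v → 6 ≤ #{w | G.Adj u w ∧ G.Adj v w}
  deg : ∀ v, 7 ≤ G.degIn univ v
  sep : ∀ (x w : V) (D Q : Set V), (G.induce D).Connected → (∀ d ∈ D, d ≠ x ∧ ¬ G.Adj x d) →
    G.IsClique Q → Q.ncard ≤ 4 → w ∉ D →
    (∀ d ∈ D, ∀ v, v ∉ D → G.Adj d v → v ∈ Q ∨ v = w) → False
  exc : ¬ (Fintype.card V = 10 ∧ (∀ v, G.degIn univ v ≤ 8) ∧ G.Colorable 5)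

theorem bound_of_edgeBound {V : Type} [Fintype V] {G : SimpleGraph V}
    (hG : ¬ (⊤ : SimpleGraph (Fin 8)).MinorOf G)
    (h : ∀ m, 5 ≤ m → m < Fintype.card V → EdgeBound m) (A : Finset V) (hA : A ≠ univ)
    (hA5 : 5 ≤ #A) (H : SimpleGraph V) (hH : (H.induce (A : Set V)).MinorOf G) :
    H.dcount A A + 40 ≤ 12 * #A := by
  have h1 := h #A hA5 ((card_lt_iff_ne_univ A).2 hA) (A : Set V) (H.induce (A : Set V)) (by simp)
    (fun h' => hG (h'.trans hH))
  rw [dcount_map (G := H) (Function.Embedding.subtype _) (fun a b => Iff.rfl)] at h1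
  have h2 : (univ : Finset (A : Set V)).map (Function.Embedding.subtype _) = A := by
    ext v; simp
  rwa [h2] at h1

theorem induce_minorOf {V : Type} (G : SimpleGraph V) (A : Set V) : (G.induce A).MinorOf G :=
  MinorOf.of_injective_hom _ Subtype.val_injective fun _ _ h => h

theorem dcount_univ_eq {V : Type} [Fintype V] (G : SimpleGraph V) (v : V) :
    G.dcount univ univ = G.dcount (univ.erase v) (univ.erase v) + 2 * G.degIn univ v := by
  have hd : Disjoint (univ.erase v) ({v} : Finset V) := by simp
  have hu : univ.erase v ∪ {v} = univ := by ext; simp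
  have h := dcount_union_self G hd
  rw [hu, dcount_comm G _ {v}, dcount_singleton, dcount_singleton] at h
  have h2 := degIn_union G hd v
  rw [hu] at h2
  have h3 : G.degIn {v} v = 0 := by simp [degIn]
  omega

theorem degIn_lt_card {V : Type} [Fintype V] (G : SimpleGraph V) (v : V) :
    G.degIn univ v + 1 ≤ Fintype.card V := by
  have hd : Disjoint (univ.erase v) ({v} : Finset V) := by simp
  have hu : univ.erase v ∪ {v} = univ := by ext; simp
  have h2 := degIn_union G hd v
  rw [hu] at h2
  have h3 : G.degIn {v} v = 0 := by simp [degIn]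
  have h4 := degIn_le_card G (univ.erase v) v
  rw [card_erase_of_mem (mem_univ v), card_univ] at h4
  have := Fintype.card_pos_iff.2 ⟨v⟩
  omega

/-- In an edge-extremal graph a small separator is not a clique plus a vertex. -/
theorem sep_of_extremal {V : Type} [Fintype V] {G : SimpleGraph V}
    (bound : ∀ A : Finset V, A ≠ univ → 5 ≤ #A → ∀ H : SimpleGraph V,
      (H.induce (A : Set V)).MinorOf G → H.dcount A A + 40 ≤ 12 * #A)
    (edges : G.dcount univ univ + 38 = 12 * Fintype.card V)
    (deg : ∀ v, 7 ≤ G.degIn univ v)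
    (x w : V) (D Q : Set V) (hD : (G.induce D).Connected) (hx : ∀ d ∈ D, d ≠ x ∧ ¬ G.Adj x d)
    (hQ : G.IsClique Q) (hQ4 : Q.ncard ≤ 4) (hw : w ∉ D)
    (hN : ∀ d ∈ D, ∀ v, v ∉ D → G.Adj d v → v ∈ Q ∨ v = w) : False := by
  set D' : Finset V := D.toFinset with hD'
  set S : Finset V := {v | v ∉ D ∧ ∃ d ∈ D, G.Adj d v} with hS
  have hDS : Disjoint D' S := by
    rw [Finset.disjoint_left]; intro v hv hvS
    exact (mem_filter.1 hvS).2.1 (Set.mem_toFinset.1 hv)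
  have hxD : x ∉ D := fun h => (hx x h).1 rfl
  have hxS : x ∉ S := fun h => by
    obtain ⟨d, hd, hdx⟩ := (mem_filter.1 h).2.2
    exact (hx d hd).2 hdx.symm
  have hNx : ∀ v, G.Adj x v → v ∉ D' := fun v hv h => (hx v (Set.mem_toFinset.1 h)).2 hv
  have hSQ : ∀ v ∈ S, v ∈ Q ∨ v = w := fun v hv => by
    obtain ⟨h1, d, hd, h2⟩ := (mem_filter.1 hv).2
    exact hN d hd v h1 h2
  have hS5 : #S ≤ 5 := by
    have h1 : S ⊆ insert w Q.toFinset := fun v hv => by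
      rcases hSQ v hv with h | h <;> simp [h]
    have h2 := card_le_card h1
    have h3 := card_insert_le w Q.toFinset
    rw [← Set.ncard_eq_toFinset_card'] at h3
    omega
  obtain ⟨d₀, hd₀⟩ := (induce_connected_iff.1 hD).1
  -- the side containing `D`
  have b1 := bound (D' ∪ S) (fun h => by
      have : x ∈ D' ∪ S := h ▸ mem_univ x
      rw [mem_union] at this
      rcases this with h | h
      · exact hxD (Set.mem_toFinset.1 h)
      · exact hxS h)
    (by
      have h1 := deg d₀
      have h2 : G.degIn univ d₀ ≤ G.degIn (D' ∪ S) d₀ := by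
        refine card_le_card fun v hv => ?_
        have hv := (mem_filter.1 hv).2
        refine mem_filter.2 ⟨?_, hv⟩
        rw [mem_union]
        by_cases hvD : v ∈ D
        · exact .inl (Set.mem_toFinset.2 hvD)
        · exact .inr (mem_filter.2 ⟨mem_univ _, hvD, d₀, hd₀, hv⟩)
      have h3 := degIn_le_card G (D' ∪ S) d₀
      omega) G (induce_minorOf G _)
  -- the other side
  have hne : D'ᶜ ≠ univ := fun h => by
    have : d₀ ∈ D'ᶜ := h ▸ mem_univ d₀
    exact (mem_compl.1 this) (Set.mem_toFinset.2 hd₀)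
  have h5 : 5 ≤ #D'ᶜ := by
    have h1 := deg x
    have h2 : G.degIn univ x ≤ G.degIn D'ᶜ x := by
      refine card_le_card fun v hv => ?_
      have hv := (mem_filter.1 hv).2
      exact mem_filter.2 ⟨mem_compl.2 (hNx v hv), hv⟩
    have h3 := degIn_le_card G D'ᶜ x
    omega
  have hSD : S ⊆ D'ᶜ := fun v hv => mem_compl.2 fun h => Finset.disjoint_left.1 hDS h hv
  obtain ⟨p, b2, b3⟩ : ∃ p, G.dcount D'ᶜ D'ᶜ + 2 * p + 40 ≤ 12 * #D'ᶜ ∧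
      #S * #S ≤ G.dcount S S + 2 * p + #S := by
    by_cases hwS : w ∈ S
    · set P : Finset V := {v ∈ S | v ≠ w ∧ ¬ G.Adj w v} with hP
      obtain ⟨-, d, hd, hdw⟩ := (mem_filter.1 hwS).2
      have hm := minorOf_contract (G := G) (A := ((D'ᶜ : Finset V) : Set V)) (D := D)
        (by rw [Set.disjoint_left]; intro v hv; simpa [hD'] using hv) hD hd hdw.symm
      have hbd := bound D'ᶜ hne h5 _ hm
      have hc := dcount_add_star G (A := D'ᶜ) (P := P) (w := w) (T := {v | ∃ d ∈ D, G.Adj d v})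
        (hSD hwS) ((filter_subset _ _).trans hSD) (by simp [hP])
        (fun v hv => by
          exact (mem_filter.1 (mem_filter.1 hv).1).2.2) (fun v hv => (mem_filter.1 hv).2.2)
      refine ⟨#P, by omega, ?_⟩
      -- `S` becomes a clique after adding the star
      have hdeg : ∀ v ∈ S, v ≠ w → #S ≤ G.degIn S v + 1 + if v ∈ P then 1 else 0 := by
        intro v hv hvw
        have hvQ : v ∈ Q := (hSQ v hv).resolve_right hvw
        have : S ⊆ {b ∈ S | G.Adj v b} ∪ {v} ∪ if v ∈ P then {w} else ∅ := by
          intro b hb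
          simp only [mem_union, mem_filter, mem_singleton]
          by_cases hbv : b = v
          · exact .inl (.inr hbv)
          by_cases hbw : b = w
          · subst hbw
            by_cases hvb : G.Adj v b
            · exact .inl (.inl ⟨hb, hvb⟩)
            · right
              rw [if_pos (mem_filter.2 ⟨hv, hvw, fun h => hvb h.symm⟩)]
              simp
          · exact .inl (.inl ⟨hb, hQ hvQ ((hSQ b hb).resolve_right hbw) (Ne.symm hbv)⟩)
        have h1 := card_le_card this
        have h2 := card_union_le ({b ∈ S | G.Adj v b} ∪ {v}) (if v ∈ P then {w} else ∅)
        have h3 := card_union_le {b ∈ S | G.Adj v b} {v}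
        rw [card_singleton] at h3
        unfold degIn
        split_ifs at h1 h2 ⊢ with hvP <;> simp only [card_singleton, card_empty] at h2 <;> omega
      have hdegw : #S ≤ G.degIn S w + 1 + #P := by
        have : S ⊆ {b ∈ S | G.Adj w b} ∪ {w} ∪ P := by
          intro b hb
          simp only [mem_union, mem_filter, mem_singleton, hP]
          by_cases hbw : b = w
          · exact .inl (.inr hbw)
          by_cases h : G.Adj w b
          · exact .inl (.inl ⟨hb, h⟩)
          · exact .inr ⟨hb, hbw, h⟩
        have h1 := card_le_card this
        have h2 := card_union_le ({b ∈ S | G.Adj w b} ∪ {w}) P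
        have h3 := card_union_le {b ∈ S | G.Adj w b} {w}
        rw [card_singleton] at h3
        unfold degIn
        omega
      have hsum : ∑ v ∈ S, #S ≤ ∑ v ∈ S, (G.degIn S v + 1 + ((if v ∈ P then 1 else 0) +
          if v = w then #P else 0)) := by
        refine sum_le_sum fun v hv => ?_
        by_cases hvw : v = w
        · subst hvw
          rw [if_neg (by simp [hP]), if_pos rfl]
          omega
        · rw [if_neg hvw, add_zero]
          exact hdeg v hv hvw
      rw [sum_add_distrib, sum_add_distrib, sum_add_distrib, sum_ite_mem,
        inter_eq_right.2 (show P ⊆ S from filter_subset _ _), sum_ite_eq_of_mem' _ _ _ hwS] at hsum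
      simp only [sum_const, smul_eq_mul, mul_one] at hsum
      unfold dcount
      omega
    · refine ⟨0, ?_, ?_⟩
      · have := bound D'ᶜ hne h5 G (induce_minorOf G _)
        omega
      · have hdeg : ∀ v ∈ S, #S ≤ G.degIn S v + 1 := by
          intro v hv
          have hcl : ∀ v ∈ S, v ∈ Q := fun v hv =>
            (hSQ v hv).resolve_right fun h => hwS (h ▸ hv)
          have : S ⊆ {b ∈ S | G.Adj v b} ∪ {v} := by
            intro b hb
            simp only [mem_union, mem_filter, mem_singleton]
            by_cases hbv : b = v
            · exact .inr hbv
            · exact .inl ⟨hb, hQ (hcl v hv) (hcl b hb) (Ne.symm hbv)⟩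
          have h1 := card_le_card this
          have h3 := card_union_le {b ∈ S | G.Adj v b} {v}
          rw [card_singleton] at h3
          unfold degIn
          omega
        have hsum := sum_le_sum hdeg
        rw [sum_add_distrib] at hsum
        simp only [sum_const, smul_eq_mul, mul_one] at hsum
        unfold dcount
        omega
  have e1 := dcount_union_self G hDS
  have e2 := dcount_union_self G (disjoint_compl_right (a := D'))
  rw [Finset.union_compl] at e2
  have e3 : G.dcount D' D'ᶜ = G.dcount D' S := by
    refine dcount_congr_right G hSD fun a ha b hb hab => ?_
    exact mem_filter.2 ⟨mem_univ _, fun h => (mem_compl.1 hb) (Set.mem_toFinset.2 h), a,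
      Set.mem_toFinset.1 ha, hab⟩
  have e4 := card_union_of_disjoint hDS
  have e5 := card_add_card_compl D'
  generalize #S = s at *
  interval_cases s <;> omega

theorem critical_of_extremal {V : Type} [Fintype V] {G : SimpleGraph V}
    (hG : ¬ (⊤ : SimpleGraph (Fin 8)).MinorOf G) (hcard : 6 ≤ Fintype.card V)
    (h : ∀ m, 5 ≤ m → m < Fintype.card V → EdgeBound m)
    (edges : G.dcount univ univ + 38 = 12 * Fintype.card V) : G.Critical := by
  have bound := bound_of_edgeBound hG h
  have herase : ∀ v : V, #(univ.erase v) + 1 = Fintype.card V := fun v => by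
    rw [card_erase_add_one (mem_univ v), card_univ]
  have hne : ∀ v : V, univ.erase v ≠ univ := fun v h => by
    have := mem_univ v
    rw [← h] at this
    simp at this
  have deg : ∀ v, 7 ≤ G.degIn univ v := by
    intro v
    have h1 := dcount_univ_eq G v
    have h2 := herase v
    have h3 := bound (univ.erase v) (hne v) (by omega) G (induce_minorOf G _)
    omega
  refine ⟨hG, bound, edges.le, fun u v huv => ?_, deg,
    sep_of_extremal bound edges deg, ?_⟩
  · set P : Finset V := {w | G.Adj v w ∧ w ≠ u ∧ ¬ G.Adj u w} with hP
    have hm := minorOf_contract (G := G) (A := ((univ.erase v : Finset V) : Set V)) (D := {v})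
      (by simp) (induce_singleton_connected G v) (w := u) rfl huv
    have h2 := herase v
    have hb := bound (univ.erase v) (hne v) (by omega) _ hm
    have hc := dcount_add_star G (A := univ.erase v) (P := P) (w := u)
      (T := {w | ∃ d ∈ ({v} : Set V), G.Adj d w}) (by simpa using huv.ne)
      (fun w hw => by
        have := (mem_filter.1 hw).2.1.ne'
        simpa using this) (by simp [hP])
      (fun w hw => ⟨v, rfl, (mem_filter.1 hw).2.1⟩) (fun w hw => (mem_filter.1 hw).2.2.2)
    have h1 := dcount_univ_eq G v
    have hdeg : G.degIn univ v ≤ #{w | G.Adj u w ∧ G.Adj v w} + 1 + #P := by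
      have : ({b ∈ univ | G.Adj v b} : Finset V) ⊆
          ({w | G.Adj u w ∧ G.Adj v w} : Finset V) ∪ {u} ∪ P := by
        intro b hb
        simp only [mem_union, mem_filter, mem_singleton, hP, mem_univ, true_and] at hb ⊢
        tauto
      have h1 := card_le_card this
      have h2 := card_union_le (({w | G.Adj u w ∧ G.Adj v w} : Finset V) ∪ {u}) P
      have h3 := card_union_le ({w | G.Adj u w ∧ G.Adj v w} : Finset V) {u}
      rw [card_singleton] at h3
      unfold degIn
      omega
    omega
  · rintro ⟨h10, h8, -⟩
    have := dcount_le G (A := univ) (B := univ) fun v _ => h8 v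
    rw [card_univ] at this
    omega

/-- The edge bound for graphs without a `K₈` minor, granted that critical graphs do not exist. -/
theorem edgeBound_of_not_critical
    (hU : ∀ (V : Type) [Fintype V] (G : SimpleGraph V), ¬ G.Critical) (n : ℕ) (hn : 5 ≤ n) :
    EdgeBound n := by
  induction n using Nat.strong_induction_on with
  | _ n ih =>
  intro V _ G hV hG
  by_contra hlt
  by_cases h5 : n = 5
  · have h1 := dcount_le G (A := univ) (B := univ) (m := 4) fun v _ => by
      have := degIn_lt_card G v
      omega
    rw [card_univ] at h1
    omega
  -- pass to a spanning subgraph with exactly the critical number of edges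
  obtain ⟨H, hHG, hH⟩ : ∃ H : SimpleGraph V, H ≤ G ∧ H.dcount univ univ + 38 = 12 * n := by
    have hev : ∀ H : SimpleGraph V, H.dcount univ univ = 2 * #H.edgeFinset := by
      intro H
      rw [← sum_degrees_eq_twice_card_edges]
      refine sum_congr rfl fun v _ => ?_
      rw [degIn, ← card_neighborFinset_eq_degree]
      congr 1
      ext; simp
    have h1 := hev G
    obtain ⟨s, hs, hsc⟩ := exists_subset_card_eq (s := G.edgeFinset) (n := 6 * n - 19) (by omega)
    refine ⟨fromEdgeSet (s : Set (Sym2 V)), ?_, ?_⟩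
    · intro a b hab
      have := hs (mem_coe.1 ((fromEdgeSet_adj _).1 hab).1)
      simpa using this
    · rw [hev]
      have h2 : (fromEdgeSet (s : Set (Sym2 V))).edgeFinset = s := by
        ext e
        rw [mem_edgeFinset, edgeSet_fromEdgeSet, Set.mem_sdiff, mem_coe]
        refine ⟨fun h => h.1, fun h => ⟨h, fun hd => ?_⟩⟩
        exact G.not_isDiag_of_mem_edgeFinset (hs h) hd
      rw [← h2] at hsc
      have h3 : ∀ (i j : Fintype (fromEdgeSet (s : Set (Sym2 V))).edgeSet),
          #(@edgeFinset _ _ i) = #(@edgeFinset _ _ j) := fun i j => by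
        congr!
      rw [h3, hsc]
      omega
  subst hV
  exact hU V H (critical_of_extremal
    (fun h => hG (h.trans (MinorOf.of_injective_hom id Function.injective_id fun _ _ h => hHG h)))
    (by omega) (fun m h1 h2 => ih m h2 h1) hH)

end Counting

namespace Cert

/-- The `i`-th digit in base `11`. -/
def dig (x i : ℕ) : ℕ := Nat.mod (Nat.div x (Nat.pow 11 i)) 11

/-- `f n`, with `n` evaluated before it is substituted. -/
def force {α : Type} (n : ℕ) (f : ℕ → α) : α := Nat.casesOn n (f 0) fun k => f (k + 1)

theorem force_eq {α : Type} (n : ℕ) (f : ℕ → α) : force n f = f n := by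
  cases n <;> rfl

theorem dig_lt (x i : ℕ) : dig x i < 16 :=
  (Nat.mod_lt _ (by norm_num : 11 > 0)).trans (by norm_num)

theorem not_beq_eq_true {a b : ℕ} : (!Nat.beq a b) = true ↔ a ≠ b := by
  rw [Bool.not_eq_true', ← Bool.not_eq_true, Nat.beq_eq]

/-- The list of pairs of digits coded by `x`. -/
def pairs : ℕ → ℕ → List (ℕ × ℕ)
  | 0, _ => []
  | k + 1, x => if x = 0 then [] else (x % 11, x / 11 % 11) :: force (x / 121) (pairs k)

theorem pairs_lt {k x : ℕ} {q : ℕ × ℕ} (h : q ∈ pairs k x) : q.1 < 16 ∧ q.2 < 16 := by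
  induction k generalizing x with
  | zero => simp [pairs] at h
  | succ k ih =>
    rw [pairs, force_eq] at h
    split at h
    · simp at h
    · rcases List.mem_cons.1 h with rfl | h
      · have h11 (y : ℕ) : y % 11 < 16 := (Nat.mod_lt y (by norm_num)).trans (by norm_num)
        exact ⟨h11 _, h11 _⟩
      · exact ih h

/-- The bit of the pair `(a, b)` in a mask coding a set of pairs. -/
def bit (m a b : ℕ) : Bool :=
  Nat.beq (Nat.land 1 (Nat.shiftRight m (Nat.add (Nat.mul 16 a) b))) 1

theorem bit_eq (m a b : ℕ) : bit m a b = m.testBit (16 * a + b) := by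
  rw [Nat.testBit_eq_decide_div_mod_eq, bit]
  change Nat.beq (1 &&& m >>> (16 * a + b)) 1 = _
  rw [Nat.and_comm, Nat.and_one_is_mod, Nat.shiftRight_eq_div_pow]
  exact Bool.eq_iff_iff.2 (by simp [Nat.beq_eq])

def addPair (m a b : ℕ) : ℕ := m ||| 1 <<< (16 * a + b) ||| 1 <<< (16 * b + a)

def maskOf : List (ℕ × ℕ) → ℕ → ℕ
  | [], m => m
  | q :: l, m => force (addPair m q.1 q.2) (maskOf l)

/-- All pairs in the mask satisfy `R`. -/
def Sound (m : ℕ) (R : ℕ → ℕ → Prop) : Prop := ∀ a b, a < 16 → b < 16 → bit m a b = true → R a b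

theorem sound_zero (R : ℕ → ℕ → Prop) : Sound 0 R := fun a b _ _ h => by simp [bit_eq] at h

theorem Sound.addPair {m : ℕ} {R : ℕ → ℕ → Prop} (h : Sound m R) {a b : ℕ} (ha : a < 16)
    (hb : b < 16) (h1 : R a b) (h2 : R b a) : Sound (addPair m a b) R := by
  intro c d hc hd hcd
  simp only [bit_eq, Cert.addPair, Nat.testBit_or, Bool.or_eq_true] at hcd
  have key : ∀ k l, (1 <<< k : ℕ).testBit l = true → l = k := by
    intro k l hkl
    rw [Nat.one_shiftLeft, Nat.testBit_two_pow] at hkl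
    exact (of_decide_eq_true hkl).symm
  rcases hcd with (hcd | hcd) | hcd
  · exact h c d hc hd ((bit_eq _ _ _).trans hcd)
  · have := key _ _ hcd
    obtain ⟨rfl, rfl⟩ : c = a ∧ d = b := by omega
    exact h1
  · have := key _ _ hcd
    obtain ⟨rfl, rfl⟩ : c = b ∧ d = a := by omega
    exact h2

theorem Sound.maskOf {l : List (ℕ × ℕ)} {m : ℕ} {R : ℕ → ℕ → Prop} (h : Sound m R)
    (hl : ∀ q ∈ l, (q.1 < 16 ∧ q.2 < 16) ∧ R q.1 q.2 ∧ R q.2 q.1) : Sound (maskOf l m) R := by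
  induction l generalizing m with
  | nil => exact h
  | cons q l ih =>
    rw [Cert.maskOf, force_eq]
    have hq := hl q (by simp)
    exact ih (h.addPair hq.1.1 hq.1.2 hq.2.1 hq.2.2) fun q hq => hl q (by simp [hq])

/-- The three (possibly repeated) vertices of the `i`-th bag of `M`, the first a centre. -/
def bag (M i : ℕ) : List ℕ :=
  force (dig M (3 * i)) fun a => force (dig M (3 * i + 1)) fun b =>
    force (dig M (3 * i + 2)) fun c => [a, b, c]

/-- The bags of `M` form a model of `K₇` with respect to `adj`. -/
def modelOk (n : ℕ) (adj : ℕ → ℕ → Bool) (M : ℕ) : Bool :=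
  (List.range 7).all fun i =>
    ((bag M i).all fun a => Nat.blt a n && (Nat.beq a (dig M (3 * i)) || adj (dig M (3 * i)) a)) &&
    (List.range i).all fun j =>
      ((bag M i).all fun a => (bag M j).all fun b => !Nat.beq a b) &&
      (bag M i).any fun a => (bag M j).any fun b => adj a b

theorem minorOf_of_modelOk {n : ℕ} [NeZero n] {adj : ℕ → ℕ → Bool} {M : ℕ}
    {H : SimpleGraph (Fin n)} (h : modelOk n adj M = true)
    (hadj : ∀ a b, a < n → b < n → a ≠ b → adj a b = true →
      H.Adj (Fin.ofNat n a) (Fin.ofNat n b)) :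
    (⊤ : SimpleGraph (Fin 7)).MinorOf H := by
  simp only [modelOk, List.all_eq_true, List.mem_range, Bool.and_eq_true, List.any_eq_true,
    Bool.or_eq_true, not_beq_eq_true, Nat.beq_eq, Nat.blt_eq] at h
  have hbag : ∀ i, dig M (3 * i) ∈ bag M i := fun i => by simp [bag, force_eq]
  have hinj : ∀ a b, a < n → b < n → Fin.ofNat n a = Fin.ofNat n b → a = b := by
    intro a b ha hb hab
    have := congrArg Fin.val hab
    simpa [Fin.ofNat, Nat.mod_eq_of_lt ha, Nat.mod_eq_of_lt hb] using this
  have hpair : ∀ i j : Fin 7, i ≠ j →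
      (∀ a ∈ bag M i, ∀ b ∈ bag M j, a ≠ b) ∧
        ∃ a ∈ bag M i, ∃ b ∈ bag M j, H.Adj (Fin.ofNat n a) (Fin.ofNat n b) := by
    intro i j hij
    rcases lt_or_gt_of_ne (Fin.val_ne_of_ne hij) with hlt | hlt
    · obtain ⟨h1, a, ha, b, hb, hab⟩ := (h j j.2).2 i hlt
      exact ⟨fun a ha b hb => (h1 b hb a ha).symm, b, hb, a, ha,
        (hadj _ _ ((h j j.2).1 a ha).1 ((h i i.2).1 b hb).1 (h1 a ha b hb) hab).symm⟩
    · obtain ⟨h1, a, ha, b, hb, hab⟩ := (h i i.2).2 j hlt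
      exact ⟨h1, a, ha, b, hb,
        hadj _ _ ((h i i.2).1 a ha).1 ((h j j.2).1 b hb).1 (h1 a ha b hb) hab⟩
  refine ⟨fun i => {v | ∃ a ∈ bag M i, Fin.ofNat n a = v}, fun i => ?_, fun i => ?_,
    fun i j hij => ?_, fun i j hij => ?_⟩
  · exact ⟨_, dig M (3 * i), hbag _, rfl⟩
  · have hc : dig M (3 * i) < n := ((h i i.2).1 _ (hbag _)).1
    have hstar : ∀ a ∈ bag M i, a = dig M (3 * i) ∨
        H.Adj (Fin.ofNat n (dig M (3 * i))) (Fin.ofNat n a) := by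
      intro a ha
      obtain ⟨h1, h2⟩ := (h i i.2).1 a ha
      by_cases hac : a = dig M (3 * i)
      · exact .inl hac
      · exact .inr (hadj _ _ hc h1 (Ne.symm hac) (h2.resolve_left hac))
    refine induce_connected_iff.2 ⟨⟨_, dig M (3 * i), hbag _, rfl⟩, ?_⟩
    have hcm : Fin.ofNat n (dig M (3 * i)) ∈ {v | ∃ a ∈ bag M i, Fin.ofNat n a = v} :=
      ⟨_, hbag _, rfl⟩
    rintro _ ⟨a, ha, rfl⟩ _ ⟨b, hb, rfl⟩
    refine Relation.ReflTransGen.trans (b := Fin.ofNat n (dig M (3 * i))) ?_ ?_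
    · rcases hstar a ha with h1 | h1
      · rw [h1]
      · exact .single ⟨h1.symm, ⟨a, ha, rfl⟩, hcm⟩
    · rcases hstar b hb with h1 | h1
      · rw [h1]
      · exact .single ⟨h1, hcm, ⟨b, hb, rfl⟩⟩
  · rw [Set.disjoint_left]
    rintro _ ⟨a, ha, rfl⟩ ⟨b, hb, hab⟩
    exact (hpair i j hij).1 a ha b hb
      (hinj _ _ ((h i i.2).1 a ha).1 ((h j j.2).1 b hb).1 hab.symm)
  · obtain ⟨-, a, ha, b, hb, hab⟩ := hpair i j hij.ne
    exact ⟨_, ⟨a, ha, rfl⟩, _, ⟨b, hb, rfl⟩, hab⟩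

/-- The data of a class of graphs on `Fin n`: every vertex has at most `cap` non-neighbours, the
pairs coded by `phi` are edges, and `exc` codes the non-edges of an exceptional graph (`0` if there
is none). If `r = 0`, then stars are attached to all vertices, otherwise to all vertices but `0`. -/
structure Params where
  n : ℕ
  cap : ℕ
  r : ℕ
  phi : ℕ
  exc : ℕ

variable (P : Params) [NeZero P.n]

def Params.starSet : Set (Fin P.n) := {b | P.r = 0 ∨ b ≠ 0}

structure Params.Hyp (N : SimpleGraph (Fin P.n)) : Prop where
  cap : ∀ v (S : Finset (Fin P.n)), (∀ w ∈ S, w ≠ v ∧ ¬ N.Adj v w) → S.card ≤ P.cap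
  phi : ∀ q ∈ pairs 60 P.phi, N.Adj (Fin.ofNat P.n q.1) (Fin.ofNat P.n q.2)

def Params.Good (N : SimpleGraph (Fin P.n)) : Prop :=
  ∃ p ∈ P.starSet, (⊤ : SimpleGraph (Fin 7)).MinorOf (N ⊔ starAt p P.starSet)

def Params.Exc (N : SimpleGraph (Fin P.n)) : Prop :=
  P.exc ≠ 0 ∧ ∃ σ : Fin P.n ≃ Fin P.n, ∀ q ∈ pairs 60 P.exc,
    ¬ N.Adj (σ (Fin.ofNat P.n q.1)) (σ (Fin.ofNat P.n q.2))

/-- Every graph of the class without the edges coded by `Z` is good or exceptional. -/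
def Params.Valid (Z : ℕ) : Prop :=
  ∀ N : SimpleGraph (Fin P.n), P.Hyp N →
    (∀ q ∈ pairs 60 Z, ¬ N.Adj (Fin.ofNat P.n q.1) (Fin.ofNat P.n q.2)) → P.Good N ∨ P.Exc N

def permMask (c : ℕ) : List ℕ → ℕ → ℕ
  | [], m => m
  | a :: l, m => force (m ||| 1 <<< dig c a) (permMask c l)

theorem permMask_testBit (c : ℕ) (l : List ℕ) (m b : ℕ) :
    (permMask c l m).testBit b = true ↔ m.testBit b = true ∨ ∃ a ∈ l, dig c a = b := by
  induction l generalizing m with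
  | nil => simp [permMask]
  | cons a l ih =>
    rw [permMask, force_eq, ih]
    simp [Nat.testBit_or, Nat.one_shiftLeft, Nat.testBit_two_pow, or_assoc]

def isPerm (n c : ℕ) : Bool := permMask c (List.range n) 0 == 2 ^ n - 1

theorem exists_equiv_of_isPerm {n c : ℕ} [NeZero n] (h : isPerm n c = true) :
    (∀ a < n, dig c a < n) ∧ ∃ σ : Fin n ≃ Fin n, ∀ a < n, σ (Fin.ofNat n a) =
      Fin.ofNat n (dig c a) := by
  have hbit : ∀ b, b < n ↔ ∃ a, a < n ∧ dig c a = b := by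
    intro b
    have := permMask_testBit c (List.range n) 0 b
    rw [isPerm, beq_iff_eq] at h
    rw [h, Nat.testBit_two_pow_sub_one] at this
    simpa using this
  have hlt : ∀ a < n, dig c a < n := fun a ha => (hbit _).2 ⟨a, ha, rfl⟩
  refine ⟨hlt, ?_⟩
  let f : Fin n → Fin n := fun a => Fin.ofNat n (dig c a)
  have hf : Function.Surjective f := by
    intro b
    obtain ⟨a, ha, hab⟩ := (hbit b).1 b.2
    refine ⟨⟨a, ha⟩, ?_⟩
    ext
    simp [f, hab, Fin.ofNat, Nat.mod_eq_of_lt b.2]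
  refine ⟨Equiv.ofBijective f (Finite.injective_iff_bijective.1
    (Finite.injective_iff_surjective.2 hf)), fun a ha => ?_⟩
  simp [f, Fin.ofNat, Nat.mod_eq_of_lt ha]

def cites : ℕ → ℕ → List ℕ
  | 0, _ => []
  | k + 1, x => if x = 0 then [] else
      force (x % 11 ^ 16) fun c => c :: force (x / 11 ^ 16) (cites k)

/-- A citation `c` of an earlier lemma, under the permutation given by the first digits of `c`,
shows that the pair given by the digits `11` and `12` of `c` is an edge. -/
def citeOk (get : ℕ → Option ℕ) (i Zm c : ℕ) : Bool :=
  Nat.blt (c / 11 ^ 13) i && isPerm P.n c && (Nat.beq P.r 0 || Nat.beq (dig c 0) 0) &&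
  (force (maskOf (pairs 60 P.phi) 0) fun m =>
    (pairs 60 P.phi).all fun q => Nat.blt q.1 P.n && Nat.blt q.2 P.n && bit m (dig c q.1) (dig c q.2)) &&
  match get (c / 11 ^ 13) with
  | none => false
  | some Z => force (addPair Zm (dig c 11) (dig c 12)) fun m =>
      (pairs 60 Z).all fun q => Nat.blt q.1 P.n && Nat.blt q.2 P.n && bit m (dig c q.1) (dig c q.2)

def saturated (Zm : ℕ) : List (ℕ × ℕ) :=
  (List.range P.n).flatMap fun a =>
    if P.cap ≤ (List.range P.n).countP fun b => !Nat.beq b a && bit Zm a b then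
      ((List.range P.n).filter fun b => !Nat.beq b a && !bit Zm a b).map fun b => (a, b)
    else []

def starAdj (r p a b : ℕ) : Bool :=
  (Nat.beq a p && (Nat.beq r 0 || !Nat.beq b 0)) ||
    (Nat.beq b p && (Nat.beq r 0 || !Nat.beq a 0))

/-- Check one lemma: the non-edges `Z`, the citations and the model. -/
def lemmaOk (get : ℕ → Option ℕ) (i : ℕ) (l : ℕ × ℕ × ℕ) : Bool :=
  (P.exc == l.1 && P.exc != 0) ||
  force (maskOf (pairs 60 l.1) 0) fun Zm =>
    ((cites 60 l.2.1).all fun c => citeOk P get i Zm c) &&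
    force (maskOf ((cites 60 l.2.1).map (fun c => (dig c 11, dig c 12)) ++ saturated P Zm ++
        pairs 60 P.phi) 0) fun m =>
      force (l.2.2 % 11) fun p => (Nat.blt p P.n && (Nat.beq P.r 0 || !Nat.beq p 0)) &&
      force (l.2.2 / 11) (modelOk P.n fun a b => bit m a b || starAdj P.r p a b)

variable {P}

theorem Params.Good.of_iso {N N' : SimpleGraph (Fin P.n)} (σ : Fin P.n ≃ Fin P.n)
    (hσ : ∀ a b, N.Adj a b → N'.Adj (σ a) (σ b)) (h0 : P.r = 0 ∨ σ 0 = 0) (h : P.Good N) :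
    P.Good N' := by
  obtain ⟨p, hp, hm⟩ := h
  have hs : ∀ b ∈ P.starSet, σ b ∈ P.starSet := by
    rintro b (hb | hb)
    · exact .inl hb
    · rcases h0 with h0 | h0
      · exact .inl h0
      · exact .inr fun h => hb (σ.injective (h.trans h0.symm))
  refine ⟨σ p, hs p hp, hm.trans (MinorOf.of_injective_hom σ σ.injective ?_)⟩
  rintro a b (hab | hab)
  · exact .inl (hσ a b hab)
  · refine .inr ?_
    simp only [starAt, fromRel_adj] at hab ⊢
    refine ⟨fun h => hab.1 (σ.injective h), ?_⟩
    rcases hab.2 with ⟨rfl, h⟩ | ⟨rfl, h⟩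
    · exact .inl ⟨rfl, hs _ h⟩
    · exact .inr ⟨rfl, hs _ h⟩

theorem Params.Hyp.comap {N : SimpleGraph (Fin P.n)} (h : P.Hyp N) (σ : Fin P.n ≃ Fin P.n)
    (hphi : ∀ q ∈ pairs 60 P.phi, N.Adj (σ (Fin.ofNat P.n q.1)) (σ (Fin.ofNat P.n q.2))) :
    P.Hyp (N.comap σ) := by
  refine ⟨fun v S hS => ?_, hphi⟩
  rw [← Finset.card_map σ.toEmbedding]
  refine h.cap (σ v) _ fun w hw => ?_
  obtain ⟨x, hx, rfl⟩ := Finset.mem_map.1 hw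
  exact ⟨fun h => (hS x hx).1 (σ.injective h), (hS x hx).2⟩

theorem valid_of_lemmaOk {get : ℕ → Option ℕ} {i : ℕ} {l : ℕ × ℕ × ℕ} (hn : P.n ≤ 16)
    (hprev : ∀ j < i, ∀ Z, get j = some Z → P.Valid Z) (h : lemmaOk P get i l = true) :
    P.Valid l.1 := by
  intro N hN hZ
  rw [lemmaOk, Bool.or_eq_true] at h
  rcases h with h | h
  · simp only [Bool.and_eq_true, beq_iff_eq, bne_iff_ne] at h
    exact .inr ⟨h.2, Equiv.refl _, h.1 ▸ hZ⟩
  by_contra hcon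
  simp only [force_eq, Bool.and_eq_true, List.all_eq_true] at h
  obtain ⟨hc, ⟨hp, hr⟩, hm⟩ := h
  have hs : Sound (maskOf (pairs 60 l.1) 0)
      fun a b => ¬ N.Adj (Fin.ofNat P.n a) (Fin.ofNat P.n b) :=
    (sound_zero _).maskOf fun q hq => ⟨pairs_lt hq, hZ q hq, fun h => hZ q hq h.symm⟩
  have hphi : Sound (maskOf (pairs 60 P.phi) 0)
      fun a b => N.Adj (Fin.ofNat P.n a) (Fin.ofNat P.n b) :=
    (sound_zero _).maskOf fun q hq => ⟨pairs_lt hq, hN.phi q hq, (hN.phi q hq).symm⟩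
  have hcite : ∀ c ∈ cites 60 l.2.1,
      N.Adj (Fin.ofNat P.n (dig c 11)) (Fin.ofNat P.n (dig c 12)) := by
    intro c hcm
    by_contra hab
    have hok := hc c hcm
    simp only [citeOk, force_eq, Bool.and_eq_true, List.all_eq_true, Nat.blt_eq,
      Bool.or_eq_true, Nat.beq_eq] at hok
    obtain ⟨⟨⟨⟨hi, hperm⟩, h0⟩, hph⟩, hget⟩ := hok
    obtain ⟨hlt, σ, hσ⟩ := exists_equiv_of_isPerm hperm
    split at hget
    · cases hget
    rename_i Z hZe
    simp only [List.all_eq_true, Bool.and_eq_true, Nat.blt_eq] at hget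
    have hs' := hs.addPair (dig_lt c 11) (dig_lt c 12) hab fun h => hab h.symm
    have hv := hprev _ hi Z hZe (N.comap σ) (hN.comap σ fun q hq => by
      obtain ⟨⟨h1, h2⟩, h3⟩ := hph q hq
      rw [hσ _ h1, hσ _ h2]
      exact hphi _ _ (dig_lt _ _) (dig_lt _ _) h3) fun q hq => by
        obtain ⟨⟨h1, h2⟩, h3⟩ := hget q hq
        rw [comap_adj, hσ _ h1, hσ _ h2]
        exact hs' _ _ (dig_lt _ _) (dig_lt _ _) h3
    rcases hv with h | ⟨he, τ, hτ⟩
    · refine hcon (.inl (h.of_iso σ (fun _ _ h => h) (h0.imp id fun h0 => ?_)))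
      have := hσ 0 (Nat.pos_of_ne_zero (NeZero.ne _))
      rw [h0] at this
      simpa using this
    · exact hcon (.inr ⟨he, τ.trans σ, hτ⟩)
  have hsat : ∀ q ∈ saturated P (maskOf (pairs 60 l.1) 0), (q.1 < 16 ∧ q.2 < 16) ∧
      N.Adj (Fin.ofNat P.n q.1) (Fin.ofNat P.n q.2) := by
    rintro ⟨a, b⟩ hq
    simp only [saturated, List.mem_flatMap, List.mem_range] at hq
    obtain ⟨c, hcn, hq⟩ := hq
    split at hq
    swap
    · simp at hq
    rename_i hcap
    simp only [List.mem_map, List.mem_filter, List.mem_range, Prod.mk.injEq, Bool.and_eq_true,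
      Bool.not_eq_true'] at hq
    obtain ⟨d, ⟨hdn, hdc, hbit⟩, rfl, rfl⟩ := hq
    replace hdc := Nat.ne_of_beq_eq_false hdc
    refine ⟨⟨by omega, by omega⟩, ?_⟩
    by_contra hab
    set m := maskOf (pairs 60 l.1) 0
    let S : Finset ℕ := ((List.range P.n).filter fun b => !Nat.beq b c && bit m c b).toFinset
    have hS : S.card = (List.range P.n).countP fun b => !Nat.beq b c && bit m c b := by
      rw [List.countP_eq_length_filter, List.toFinset_card_of_nodup (List.nodup_range.filter _)]
    have hmem : ∀ x, x ∈ S ↔ x < P.n ∧ x ≠ c ∧ bit m c x = true := by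
      simp [S, -Bool.not_eq_eq_eq_not, not_beq_eq_true]
    have hdS : d ∉ S := fun h => by
      have := ((hmem d).1 h).2.2
      rw [hbit] at this
      cases this
    have hinj : Set.InjOn (Fin.ofNat P.n) (insert d S : Finset ℕ) := by
      have hlt : ∀ x ∈ insert d S, x < P.n := by
        intro x hx
        rcases Finset.mem_insert.1 hx with rfl | hx
        · exact hdn
        · exact ((hmem x).1 hx).1
      intro x hx y hy hxy
      have := congrArg Fin.val hxy
      simpa [Fin.ofNat, Nat.mod_eq_of_lt (hlt x hx), Nat.mod_eq_of_lt (hlt y hy)] using this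
    have hne : ∀ x, x < P.n → x ≠ c → Fin.ofNat P.n x ≠ Fin.ofNat P.n c := by
      intro x hx hxc h
      have := congrArg Fin.val h
      simp [Fin.ofNat, Nat.mod_eq_of_lt hx, Nat.mod_eq_of_lt hcn] at this
      exact hxc this
    have := hN.cap (Fin.ofNat P.n c) ((insert d S).image (Fin.ofNat P.n)) (by
      intro w hw
      obtain ⟨x, hx, rfl⟩ := Finset.mem_image.1 hw
      rcases Finset.mem_insert.1 hx with rfl | hx
      · exact ⟨hne _ hdn hdc, hab⟩
      · obtain ⟨hx, hx'⟩ := (hmem x).1 hx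
        exact ⟨hne _ hx hx'.1, hs _ _ (by omega) (by omega) hx'.2⟩)
    rw [Finset.card_image_of_injOn hinj, Finset.card_insert_of_notMem hdS, hS] at this
    omega
  have hpres := (sound_zero fun a b => N.Adj (Fin.ofNat P.n a) (Fin.ofNat P.n b)).maskOf
    (l := (cites 60 l.2.1).map (fun c => (dig c 11, dig c 12)) ++
      saturated P (maskOf (pairs 60 l.1) 0) ++ pairs 60 P.phi) (by
    intro q hq
    simp only [List.mem_append, List.mem_map] at hq
    rcases hq with (⟨c, hcm, rfl⟩ | hq) | hq
    · exact ⟨⟨dig_lt _ _, dig_lt _ _⟩, hcite c hcm, (hcite c hcm).symm⟩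
    · exact ⟨(hsat q hq).1, (hsat q hq).2, (hsat q hq).2.symm⟩
    · exact ⟨pairs_lt hq, hN.phi q hq, (hN.phi q hq).symm⟩)
  simp only [Nat.blt_eq, Bool.or_eq_true, Nat.beq_eq, not_beq_eq_true] at hp hr
  have hstar : ∀ x, x < P.n → (P.r = 0 ∨ x ≠ 0) → Fin.ofNat P.n x ∈ P.starSet := by
    refine fun x hx h => h.imp id fun h h' => h ?_
    have := congrArg Fin.val h'
    simpa [Fin.ofNat, Nat.mod_eq_of_lt hx] using this
  refine hcon (.inl ⟨Fin.ofNat P.n (l.2.2 % 11), hstar _ hp hr, minorOf_of_modelOk hm ?_⟩)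
  intro a b ha hb hab h
  rw [Bool.or_eq_true] at h
  rcases h with h | h
  · exact .inl (hpres a b (by omega) (by omega) h)
  · refine .inr ?_
    simp only [starAdj, Bool.or_eq_true, Bool.and_eq_true, Nat.beq_eq, not_beq_eq_true] at h
    simp only [starAt, fromRel_adj]
    refine ⟨fun h => hab ?_, ?_⟩
    · have := congrArg Fin.val h
      simpa [Fin.ofNat, Nat.mod_eq_of_lt ha, Nat.mod_eq_of_lt hb] using this
    · rcases h with ⟨h1, h2⟩ | ⟨h1, h2⟩
      · exact .inl ⟨by rw [h1], hstar b hb h2⟩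
      · exact .inr ⟨by rw [h1], hstar a ha h2⟩

def nth {α : Type} : List α → ℕ → Option α
  | [], _ => none
  | x :: _, 0 => some x
  | _ :: l, k + 1 => nth l k

/-- Entry `i` of a list of lists of length `32`. -/
def entry {α : Type} (L : List (List α)) (i : ℕ) : Option α :=
  match nth L (i / 32) with
  | none => none
  | some l => nth l (i % 32)

theorem nth_eq_none {α : Type} : ∀ (l : List α) {i : ℕ}, l.length ≤ i → nth l i = none
  | [], i, _ => by cases i <;> rfl
  | _ :: l, 0, h => by simp at h
  | _ :: l, i + 1, h => nth_eq_none l (by simpa using h)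

/-- Check a list of lemmas. -/
def tableOk (P : Params) (L : List (List (ℕ × ℕ × ℕ))) : Bool :=
  (List.range (32 * L.length)).all fun i =>
    force i fun i =>
    match entry L i with
    | none => true
    | some l => lemmaOk P (fun j => match entry L j with
      | none => none
      | some l => some l.1) i l

theorem valid_of_tableOk {L : List (List (ℕ × ℕ × ℕ))} (hn : P.n ≤ 16)
    (h : tableOk P L = true) (i : ℕ) (l : ℕ × ℕ × ℕ) (hl : entry L i = some l) :
    P.Valid l.1 := by
  induction i using Nat.strong_induction_on generalizing l with
  | _ i ih =>
  have hi : i < 32 * L.length := by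
    by_contra hi
    rw [entry, nth_eq_none L (by omega)] at hl
    cases hl
  have := List.all_eq_true.1 h i (List.mem_range.2 hi)
  rw [force_eq, hl] at this
  refine valid_of_lemmaOk hn (fun j hj Z hZ => ?_) this
  split at hZ
  · cases hZ
  · rename_i l' hl'
    cases hZ
    exact ih j hj _ hl'

end Cert

/-- The properties of the three exceptional neighbourhoods that are used below. -/
structure Exceptional {W : Type} (N : SimpleGraph W) : Prop where
  clique : ∀ Q : Set W, N.IsClique Q → Q.ncard ≤ 4
  cover : ∀ Q : Fin 3 → Set W, (∀ i, N.IsClique (Q i)) →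
    ∃ a b, N.Adj a b ∧ ∀ i, ¬ (a ∈ Q i ∧ b ∈ Q i)
  link : ∀ A B : Set W, (∀ a b, N.Adj a b → (a ∈ A ∧ b ∈ A) ∨ (a ∈ B ∧ b ∈ B)) →
    ¬ N.IsClique A → ¬ N.IsClique B →
    ∃ p ∈ A, ∃ q ∈ B, p ≠ q ∧ (⊤ : SimpleGraph (Fin 7)).MinorOf (N ⊔ starAt p A ⊔ starAt q B)
  common_le : ∀ a b, N.Adj a b → {c | N.Adj a c ∧ N.Adj b c}.ncard ≤ 4
  nonadj : ∀ v, ∃ w, w ≠ v ∧ ¬ N.Adj v w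
  common : (∀ a b, N.Adj a b → {c | N.Adj a c ∧ N.Adj b c}.ncard ≤ 3) ∨
    (Nat.card W = 8 ∧ N.Colorable 4 ∧ ∀ v, {w | N.Adj v w}.ncard ≤ 6)

theorem starAt_map {W W' : Type} (e : W ≃ W') {p : W} {A : Set W'} {a b : W}
    (h : (starAt p (e ⁻¹' A)).Adj a b) : (starAt (e p) A).Adj (e a) (e b) := by
  simp only [starAt, fromRel_adj, Set.mem_preimage] at h ⊢
  obtain ⟨hne, hor⟩ := h
  refine ⟨fun h' => hne (e.injective h'), ?_⟩
  rcases hor with ⟨rfl, h⟩ | ⟨rfl, h⟩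
  · exact .inl ⟨rfl, h⟩
  · exact .inr ⟨rfl, h⟩

theorem Exceptional.of_iso {W W' : Type} {N : SimpleGraph W} {N' : SimpleGraph W'} (e : W ≃ W')
    (he : ∀ a b, N'.Adj (e a) (e b) ↔ N.Adj a b) (h : Exceptional N) : Exceptional N' := by
  have hpre : ∀ A : Set W', N'.IsClique A → N.IsClique (e ⁻¹' A) := fun A hA a ha b hb hab =>
    (he a b).1 (hA ha hb (e.injective.ne hab))
  have hpre' : ∀ A : Set W', N.IsClique (e ⁻¹' A) → N'.IsClique A := by
    intro A hA a ha b hb hab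
    obtain ⟨a, rfl⟩ := e.surjective a
    obtain ⟨b, rfl⟩ := e.surjective b
    exact (he a b).2 (hA ha hb fun h => hab (h ▸ rfl))
  have hcard : ∀ A : Set W', (e ⁻¹' A).ncard = A.ncard := fun A =>
    Set.ncard_preimage_of_injective_subset_range e.injective (by simp)
  have hcom : ∀ {k}, (∀ a b, N.Adj a b → {c | N.Adj a c ∧ N.Adj b c}.ncard ≤ k) →
      ∀ a b, N'.Adj a b → {c | N'.Adj a c ∧ N'.Adj b c}.ncard ≤ k := by
    intro k h a b hab
    obtain ⟨a, rfl⟩ := e.surjective a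
    obtain ⟨b, rfl⟩ := e.surjective b
    rw [← hcard]
    refine le_of_eq_of_le ?_ (h a b ((he a b).1 hab))
    congr 1
    ext c
    simp [he]
  refine ⟨fun Q hQ => hcard Q ▸ h.clique _ (hpre Q hQ), fun Q hQ => ?_, fun A B hAB hA hB => ?_,
    hcom h.common_le, fun v => ?_, h.common.imp hcom fun h => ?_⟩
  · obtain ⟨a, b, hab, hi⟩ := h.cover (fun i => e ⁻¹' Q i) fun i => hpre _ (hQ i)
    exact ⟨e a, e b, (he a b).2 hab, hi⟩
  · obtain ⟨p, hp, q, hq, hpq, hm⟩ := h.link (e ⁻¹' A) (e ⁻¹' B)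
      (fun a b hab => hAB _ _ ((he a b).2 hab)) (fun h => hA (hpre' A h)) fun h => hB (hpre' B h)
    refine ⟨e p, hp, e q, hq, e.injective.ne hpq, hm.trans (MinorOf.of_injective_hom e e.injective ?_)⟩
    rintro a b ((h | h) | h)
    · exact .inl (.inl ((he a b).2 h))
    · exact .inl (.inr (starAt_map e h))
    · exact .inr (starAt_map e h)
  · obtain ⟨v, rfl⟩ := e.surjective v
    obtain ⟨w, hw, hvw⟩ := h.nonadj v
    exact ⟨e w, e.injective.ne hw, fun h => hvw ((he v w).1 h)⟩
  · obtain ⟨h1, ⟨c⟩, h3⟩ := h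
    refine ⟨Nat.card_congr e ▸ h1, ⟨Coloring.mk (fun v => c (e.symm v)) ?_⟩, fun v => ?_⟩
    · intro a b hab
      obtain ⟨a, rfl⟩ := e.surjective a
      obtain ⟨b, rfl⟩ := e.surjective b
      simpa using c.valid ((he a b).1 hab)
    · obtain ⟨v, rfl⟩ := e.surjective v
      rw [← hcard]
      refine le_of_eq_of_le ?_ (h3 v)
      congr 1
      ext c
      simp [he]

namespace Cert

/-- The graph on `Fin n` whose non-edges are given by a mask. -/
def excGraph (n m : ℕ) : SimpleGraph (Fin n) where
  Adj a b := a ≠ b ∧ bit m a b = false ∧ bit m b a = false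
  symm := ⟨fun _ _ h => ⟨h.1.symm, h.2.2, h.2.1⟩⟩
  loopless := ⟨fun _ h => h.1 rfl⟩

instance (n m : ℕ) : DecidableRel (excGraph n m).Adj :=
  fun a b => inferInstanceAs (Decidable (a ≠ b ∧ bit m a b = false ∧ bit m b a = false))

def onStar (p : ℕ) (T : ℕ → Bool) (a b : ℕ) : Bool := (Nat.beq a p && T b) || (Nat.beq b p && T a)

/-- A model of `K₇` in `excGraph n m` together with two stars. -/
def starsOk (n m p q M : ℕ) (A B : ℕ → Bool) : Bool :=
  Nat.blt p n && Nat.blt q n && !Nat.beq p q && A p && B q &&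
  modelOk n (fun a b => (!bit m a b && !bit m b a) || onStar p A a b || onStar q B a b) M

theorem minorOf_of_starsOk {n m p q M : ℕ} [NeZero n] {A B : ℕ → Bool}
    (h : starsOk n m p q M A B = true) (S T : Set (Fin n)) (hS : ∀ a : Fin n, A a = true → a ∈ S)
    (hT : ∀ a : Fin n, B a = true → a ∈ T) :
    ∃ p ∈ S, ∃ q ∈ T, p ≠ q ∧ (⊤ : SimpleGraph (Fin 7)).MinorOf
      (excGraph n m ⊔ starAt p S ⊔ starAt q T) := by
  simp only [starsOk, Bool.and_eq_true, Nat.blt_eq] at h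
  obtain ⟨⟨⟨⟨⟨hp, hq⟩, hpq⟩, hA⟩, hB⟩, hM⟩ := h
  have hv : ∀ a, a < n → ((Fin.ofNat n a : Fin n) : ℕ) = a := fun a ha => by
    simp [Fin.ofNat, Nat.mod_eq_of_lt ha]
  have key : ∀ p (A : ℕ → Bool) (S : Set (Fin n)), (∀ a : Fin n, A a = true → a ∈ S) →
      ∀ a b, a < n → b < n → a ≠ b → onStar p A a b = true →
      (starAt (Fin.ofNat n p) S).Adj (Fin.ofNat n a) (Fin.ofNat n b) := by
    intro p A S hS a b ha hb hab h
    simp only [onStar, Bool.or_eq_true, Bool.and_eq_true, Nat.beq_eq] at h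
    simp only [starAt, fromRel_adj]
    refine ⟨fun h => hab ?_, ?_⟩
    · rw [← hv a ha, h, hv b hb]
    · rcases h with ⟨rfl, h⟩ | ⟨rfl, h⟩
      · exact .inl ⟨rfl, hS _ (by rwa [hv b hb])⟩
      · exact .inr ⟨rfl, hS _ (by rwa [hv a ha])⟩
  refine ⟨Fin.ofNat n p, hS _ (by rwa [hv p hp]), Fin.ofNat n q, hT _ (by rwa [hv q hq]),
    fun h => not_beq_eq_true.1 hpq (by rw [← hv p hp, h, hv q hq]),
    minorOf_of_modelOk hM fun a b ha hb hab h => ?_⟩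
  simp only [Bool.or_eq_true, Bool.and_eq_true, Bool.not_eq_true'] at h
  rcases h with (h | h) | h
  · refine .inl (.inl ⟨fun h => hab ?_, ?_, ?_⟩)
    · rw [← hv a ha, h, hv b hb]
    · rw [hv a ha, hv b hb]; exact h.1
    · rw [hv a ha, hv b hb]; exact h.2
  · exact .inl (.inr (key p A S hS a b ha hb hab h))
  · exact .inr (key q B T hT a b ha hb hab h)

theorem exceptional_of_tables {n m : ℕ} (hn : n ≠ 0) (tabA tabB : List ℕ)
    (h5 : ∀ a b, (excGraph n m).Adj a b → ∀ c, (excGraph n m).Adj a c → (excGraph n m).Adj b c →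
      ∀ d, (excGraph n m).Adj a d → (excGraph n m).Adj b d → (excGraph n m).Adj c d →
      ∀ e, (excGraph n m).Adj a e → (excGraph n m).Adj b e → (excGraph n m).Adj c e →
      ¬ (excGraph n m).Adj d e)
    (hcount : 36 < (Finset.univ.filter fun e : Fin n × Fin n => (excGraph n m).Adj e.1 e.2).card)
    (hA : ∀ c c' : Fin n, c < c' → ¬ (excGraph n m).Adj c c' → (tabA.any fun t =>
      Nat.beq (dig t 0) c && Nat.beq (dig t 1) c' &&
      starsOk n m (dig t 2) (dig t 3) (t / 11 ^ 4) (fun _ => true)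
        (fun a => Nat.beq a c || Nat.beq a c')) = true)
    (hB : ∀ u : Fin n, (tabB.any fun t => Nat.beq (dig t 0) u &&
      starsOk n m (dig t 1) (dig t 2) (t / 11 ^ 3) (fun a => !Nat.beq a u)
        (fun a => Nat.beq a u || (!bit m a u && !bit m u a))) = true)
    (hC : ∀ u x : Fin n, u ≠ x → ∀ u', u' ≠ u → u' ≠ x → ¬ (excGraph n m).Adj u u' →
      ¬ (excGraph n m).Adj x u' → ∀ x', x' ≠ u → x' ≠ x → ¬ (excGraph n m).Adj u x' →
      ¬ (excGraph n m).Adj x x' → u' = x')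
    (hD : ∀ v, (∃ w, w ≠ v ∧ ¬ (excGraph n m).Adj v w) ∧ ∃ w, (excGraph n m).Adj v w)
    (common_le : ∀ a b, (excGraph n m).Adj a b →
      (Finset.univ.filter fun c => (excGraph n m).Adj a c ∧ (excGraph n m).Adj b c).card ≤ 4)
    (common : (∀ a b, (excGraph n m).Adj a b →
      (Finset.univ.filter fun c => (excGraph n m).Adj a c ∧ (excGraph n m).Adj b c).card ≤ 3) ∨
      (n = 8 ∧ (∃ f : Fin n → Fin 4, ∀ a b, (excGraph n m).Adj a b → f a ≠ f b) ∧
        ∀ v, (Finset.univ.filter fun w => (excGraph n m).Adj v w).card ≤ 6)) :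
    Exceptional (excGraph n m) := by
  have : NeZero n := ⟨hn⟩
  have hcl : ∀ Q : Set (Fin n), (excGraph n m).IsClique Q → Q.ncard ≤ 4 := by
    intro Q hQ
    by_contra hlt
    obtain ⟨t, htQ, ht⟩ := Set.exists_subset_card_eq (s := Q) (n := 5) (by omega)
    obtain ⟨f, hf⟩ : ∃ f : Fin 5 → Fin n, Function.Injective f ∧ ∀ i, f i ∈ t := by
      have e := (Finite.equivFinOfCardEq (α := t) (n := 5) (by rwa [Nat.card_coe_set_eq])).symm
      exact ⟨fun i => e i, Subtype.val_injective.comp e.injective, fun i => (e i).2⟩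
    have ha : ∀ i j, i ≠ j → (excGraph n m).Adj (f i) (f j) := fun i j hij =>
      hQ (htQ (hf.2 i)) (htQ (hf.2 j)) (hf.1.ne hij)
    exact h5 (f 0) (f 1) (ha _ _ (by decide)) (f 2) (ha _ _ (by decide)) (ha _ _ (by decide)) (f 3)
      (ha _ _ (by decide)) (ha _ _ (by decide)) (ha _ _ (by decide)) (f 4)
      (ha _ _ (by decide)) (ha _ _ (by decide)) (ha _ _ (by decide)) (ha _ _ (by decide))
  have hlinkA : ∀ B : Set (Fin n), ¬ (excGraph n m).IsClique B → ∃ p ∈ (Set.univ : Set (Fin n)),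
      ∃ q ∈ B, p ≠ q ∧ (⊤ : SimpleGraph (Fin 7)).MinorOf
        (excGraph n m ⊔ starAt p Set.univ ⊔ starAt q B) := by
    intro B hB'
    obtain ⟨c, hc, c', hc', hlt, hcc⟩ : ∃ c ∈ B, ∃ c' ∈ B, c < c' ∧ ¬ (excGraph n m).Adj c c' := by
      rw [IsClique, Set.Pairwise] at hB'
      push Not at hB'
      obtain ⟨c, hc, c', hc', hne, h⟩ := hB'
      rcases lt_or_gt_of_ne hne with hlt | hlt
      · exact ⟨c, hc, c', hc', hlt, h⟩
      · exact ⟨c', hc', c, hc, hlt, fun h' => h h'.symm⟩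
    obtain ⟨t, -, ht⟩ := List.any_eq_true.1 (hA c c' hlt hcc)
    refine minorOf_of_starsOk (Bool.and_eq_true _ _ ▸ ht).2 _ _ (fun _ _ => trivial) fun a ha => ?_
    simp only [Bool.or_eq_true, Nat.beq_eq, Fin.val_inj] at ha
    rcases ha with rfl | rfl <;> assumption
  have hlinkB : ∀ (A B : Set (Fin n)) (u : Fin n), (∀ a, a ≠ u → a ∈ A) →
      (∀ a, a = u ∨ (excGraph n m).Adj u a → a ∈ B) → ∃ p ∈ A,
      ∃ q ∈ B, p ≠ q ∧ (⊤ : SimpleGraph (Fin 7)).MinorOf (excGraph n m ⊔ starAt p A ⊔ starAt q B) := by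
    intro A B u hAu hBu
    obtain ⟨t, -, ht⟩ := List.any_eq_true.1 (hB u)
    refine minorOf_of_starsOk (Bool.and_eq_true _ _ ▸ ht).2 _ _ (fun a ha => hAu a ?_)
      fun a ha => hBu a ?_
    · rintro rfl
      simp at ha
    · simp only [Bool.or_eq_true, Nat.beq_eq, Fin.val_inj, Bool.and_eq_true, Bool.not_eq_true']
        at ha
      by_cases hau : a = u
      · exact .inl hau
      · exact .inr ⟨Ne.symm hau, (ha.resolve_left hau).2, (ha.resolve_left hau).1⟩
  have hswap : ∀ A B : Set (Fin n), (∃ p ∈ B, ∃ q ∈ A, p ≠ q ∧ (⊤ : SimpleGraph (Fin 7)).MinorOf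
      (excGraph n m ⊔ starAt p B ⊔ starAt q A)) → ∃ p ∈ A, ∃ q ∈ B, p ≠ q ∧
      (⊤ : SimpleGraph (Fin 7)).MinorOf (excGraph n m ⊔ starAt p A ⊔ starAt q B) := by
    rintro A B ⟨p, hp, q, hq, hpq, h⟩
    exact ⟨q, hq, p, hp, hpq.symm, sup_right_comm (excGraph n m) _ _ ▸ h⟩
  refine ⟨hcl, fun Q hQ => ?_, fun A B hAB hA' hB' => ?_, ?_, fun v => (hD v).1, ?_⟩
  · by_contra hcon
    push Not at hcon
    classical
    have hsub : (Finset.univ.filter fun e : Fin n × Fin n => (excGraph n m).Adj e.1 e.2) ⊆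
        (Finset.univ : Finset (Fin 3)).biUnion fun i => (Q i).toFinset.offDiag := by
      intro e he
      have he := (Finset.mem_filter.1 he).2
      obtain ⟨i, h1, h2⟩ := hcon e.1 e.2 he
      simp only [Finset.mem_biUnion, Finset.mem_univ, true_and, Finset.mem_offDiag,
        Set.mem_toFinset]
      exact ⟨i, h1, h2, he.ne⟩
    have h1 := (Finset.card_le_card hsub).trans (Finset.card_biUnion_le)
    have h2 : ∀ i ∈ (Finset.univ : Finset (Fin 3)), (Q i).toFinset.offDiag.card ≤ 12 := by
      intro i _
      have := hcl _ (hQ i)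
      rw [Set.ncard_eq_toFinset_card'] at this
      rw [Finset.offDiag_card]
      generalize (Q i).toFinset.card = k at this
      interval_cases k <;> simp
    have h3 := Finset.sum_le_card_nsmul _ _ _ h2
    simp at h3 h1
    omega
  · by_cases hAu : ∀ u, u ∈ A
    · obtain rfl : A = Set.univ := Set.eq_univ_of_forall hAu
      exact hlinkA B hB'
    by_cases hBu : ∀ u, u ∈ B
    · obtain rfl : B = Set.univ := Set.eq_univ_of_forall hBu
      exact hswap _ _ (hlinkA A hA')
    have hcross : ∀ u u', u ∉ A → u' ∉ B → ¬ (excGraph n m).Adj u u' ∧ u ≠ u' := by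
      intro u u' hu hu'
      refine ⟨fun h => (hAB u u' h).elim (fun h => hu h.1) fun h => hu' h.2, ?_⟩
      rintro rfl
      obtain ⟨w, hw⟩ := (hD u).2
      exact (hAB u w hw).elim (fun h => hu h.1) fun h => hu' h.1
    push Not at hAu hBu
    obtain ⟨u, hu⟩ := hAu
    obtain ⟨u', hu'⟩ := hBu
    by_cases h1 : ∀ x, x ∉ A → x = u
    · refine hlinkB A B u (fun a ha => by_contra fun h => ha (h1 a h)) fun a ha => ?_
      by_contra haB
      exact ha.elim (fun h => (hcross u a hu haB).2 h.symm) (hcross u a hu haB).1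
    · push Not at h1
      obtain ⟨x, hx, hxu⟩ := h1
      refine hswap _ _ (hlinkB B A u' (fun a ha => by_contra fun h => ha ?_) fun a ha => ?_)
      · exact (hC u x hxu.symm u' (hcross u u' hu hu').2.symm (hcross x u' hx hu').2.symm
          (hcross u u' hu hu').1 (hcross x u' hx hu').1 a (hcross u a hu h).2.symm
          (hcross x a hx h).2.symm (hcross u a hu h).1 (hcross x a hx h).1).symm
      · by_contra haA
        exact ha.elim (fun h => (hcross a u' haA hu').2 h)
          fun h => (hcross a u' haA hu').1 h.symm
  · classical
    simp only [Set.ncard_eq_toFinset_card', Set.toFinset_ofPred]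
    exact fun a b hab => by convert common_le a b hab
  · classical
    simp only [Set.ncard_eq_toFinset_card', Set.toFinset_ofPred]
    refine common.imp (fun h a b hab => by convert h a b hab) ?_
    rintro ⟨rfl, ⟨f, hf⟩, h3⟩
    exact ⟨by simp, ⟨Coloring.mk f fun {a b} h => hf a b h⟩, fun v => by convert h3 v⟩

theorem exceptional_eight : Exceptional (excGraph 8 83076828974393524069991210876665920) :=
  exceptional_of_tables (by norm_num) [
    65000089266403075888602554, 65000089266403075888603721, 65000089264884077840426740,
    75834795208268996915961202]
    [
    6893332358566165616448432, 5909099024080370712766063, 5909099024080370712766064,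
    5909099024218461444418521, 5909099024218461444418522, 5909099024218461444418523,
    6893332358566165616448438, 5909099024218461444418525]
    (by decide +kernel) (by decide +kernel) (by decide +kernel) (by decide +kernel)
    (by decide +kernel) (by decide +kernel) (by decide +kernel)
    (.inr ⟨rfl, ⟨![0, 1, 1, 2, 3, 2, 0, 3], by decide +kernel⟩, by decide +kernel⟩)

theorem exceptional_nine : Exceptional (excGraph 9 3062717841966356767206029093849570214152) :=
  exceptional_of_tables (by norm_num) [
    65000090781226873922174536, 86653222119263788009044034, 86653222119263788009045212,
    75827329705116811339526790, 86653220603302453416542866, 65000090781225163552665613,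
    86653222118124539580092591, 65002107514870300792655455, 75826656955121879851317322]
    [
    6893515744041619269374655, 7877565509391132128776621, 7877565647205798909913198,
    7877565647205798909913199, 7877565647205798909913200, 7877565509391132128776625,
    7877565647205798909913202, 7877565509391132128776627, 5909099161929715811106891]
    (by decide +kernel) (by decide +kernel) (by decide +kernel) (by decide +kernel)
    (by decide +kernel) (by decide +kernel) (by decide +kernel)
    (.inl (by decide +kernel))

theorem exceptional_ten : Exceptional (excGraph 10 1538798038815997564603107654535359408702030594) :=
  exceptional_of_tables (by norm_num) [
    65002782288170920125814508, 86653220604063093258594888, 97481131770224718228526770,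
    97481131770224718228527926, 97504201484580842905571443, 86653220603060795074612003,
    87564931390697383339614119, 97504195364462908830431779, 75828675710554846205524049,
    97496067826789340657141196, 97504195869530758119484852, 65002107516387875283506412,
    86653220604063094544753370, 97504200979893028761780247, 97504207090827350783295740]
    [
    7879167321430744451904902, 8863277735794495370808067, 8861921070020428929866173,
    8861921070020428929866174, 8861921070020273441728887, 7877565509460281322250304,
    8864018316780076627779223, 8864018316780076627779224, 8861921070020428929866179,
    7877565509460281205326919]
    (by decide +kernel) (by decide +kernel) (by decide +kernel) (by decide +kernel)
    (by decide +kernel) (by decide +kernel) (by decide +kernel)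
    (.inl (by decide +kernel))

theorem Params.Exc.exceptional {P : Params} [NeZero P.n] {N : SimpleGraph (Fin P.n)}
    (hE : P.Exc N) (hN : P.Hyp N) {m : ℕ}
    (hm : ∀ a b : Fin P.n, a ≠ b → ¬ (excGraph P.n m).Adj a b →
      ((a : ℕ), (b : ℕ)) ∈ pairs 60 P.exc ∨ ((b : ℕ), (a : ℕ)) ∈ pairs 60 P.exc)
    (hdeg : ∀ a : Fin P.n,
      P.cap ≤ (Finset.univ.filter fun b => b ≠ a ∧ ¬ (excGraph P.n m).Adj a b).card)
    (hx : Exceptional (excGraph P.n m)) : Exceptional N := by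
  obtain ⟨-, σ, hσ⟩ := hE
  have hof : ∀ a : Fin P.n, Fin.ofNat P.n (a : ℕ) = a := fun a => by ext; simp
  have h1 : ∀ a b, a ≠ b → ¬ (excGraph P.n m).Adj a b → ¬ N.Adj (σ a) (σ b) := by
    intro a b hab h
    rcases hm a b hab h with h | h
    · simpa [hof] using hσ _ h
    · simpa [hof, N.adj_comm] using hσ _ h
  refine hx.of_iso σ fun a b => ⟨fun h => by_contra fun h' => h1 a b ?_ h' h, fun h => ?_⟩
  · rintro rfl
    exact h.ne rfl
  · by_contra hab
    have h2 := hN.cap (σ a) ((insert b (Finset.univ.filter fun b => b ≠ a ∧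
      ¬ (excGraph P.n m).Adj a b)).map σ.toEmbedding) fun w hw => by
        obtain ⟨c, hc, rfl⟩ := Finset.mem_map.1 hw
        rcases Finset.mem_insert.1 hc with rfl | hc
        · exact ⟨σ.injective.ne h.ne.symm, hab⟩
        · have hc := (Finset.mem_filter.1 hc).2
          exact ⟨σ.injective.ne hc.1, h1 _ _ hc.1.symm hc.2⟩
    rw [Finset.card_map, Finset.card_insert_of_notMem (by simp [h])] at h2
    have := hdeg a
    omega

theorem good_or_exceptional {n exc : ℕ} {L : List (List (ℕ × ℕ × ℕ))} {W : Type} [Fintype W]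
    {N : SimpleGraph W} (hcap : ∀ v (S : Finset W), (∀ w ∈ S, w ≠ v ∧ ¬ N.Adj v w) → S.card + 7 ≤ n)
    (hW : Fintype.card W = n) (h : tableOk ⟨n, n - 7, 0, 0, exc⟩ L = true) (hn : n ≠ 0 ∧ n ≤ 16)
    (i c M : ℕ) (hL : entry L i = some (0, c, M))
    (hexc : exc = 0 ∨ ∃ m, Exceptional (excGraph n m) ∧ (∀ a b : Fin n, a ≠ b →
      ¬ (excGraph n m).Adj a b →
        ((a : ℕ), (b : ℕ)) ∈ pairs 60 exc ∨ ((b : ℕ), (a : ℕ)) ∈ pairs 60 exc) ∧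
      ∀ a : Fin n, n - 7 ≤ (Finset.univ.filter fun b => b ≠ a ∧ ¬ (excGraph n m).Adj a b).card) :
    (∃ p, (⊤ : SimpleGraph (Fin 7)).MinorOf (N ⊔ starAt p Set.univ)) ∨ Exceptional N := by
  let P : Params := ⟨n, n - 7, 0, 0, exc⟩
  have : NeZero P.n := ⟨hn.1⟩
  let e : W ≃ Fin P.n := Fintype.equivFinOfCardEq hW
  let N' : SimpleGraph (Fin P.n) := N.comap e.symm
  have hN' : P.Hyp N' := by
    refine ⟨fun v S hS => ?_, fun q hq => by simp [P, pairs] at hq⟩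
    have := hcap (e.symm v) (S.map e.symm.toEmbedding) fun w hw => by
      obtain ⟨c, hc, rfl⟩ := Finset.mem_map.1 hw
      exact ⟨e.symm.injective.ne (hS c hc).1, (hS c hc).2⟩
    rw [Finset.card_map] at this
    change S.card ≤ n - 7
    omega
  rcases valid_of_tableOk (P := P) hn.2 h i _ hL N' hN' (fun q hq => by simp [pairs] at hq)
    with ⟨p, -, hp⟩ | hx
  · refine .inl ⟨e.symm p, hp.trans (MinorOf.of_injective_hom e.symm e.symm.injective ?_)⟩
    rintro a b (hab | hab)
    · exact .inl hab
    · have hu : P.starSet = e.symm ⁻¹' Set.univ := by ext; simp [Params.starSet, P]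
      rw [hu] at hab
      exact .inr (starAt_map e.symm hab)
  · rcases hexc with h0 | ⟨m, hm, h1, h2⟩
    · exact absurd h0 hx.1
    · exact .inr ((hx.exceptional (P := P) hN' h1 h2 hm).of_iso e.symm fun a b => Iff.rfl)

noncomputable def table_seven : List (List (ℕ × ℕ × ℕ)) := [
  [(0, 0, 48835529124631161949114)]]

theorem table_seven_ok : tableOk ⟨7, 0, 0, 0, 0⟩ table_seven = true := by
  decide +kernel

noncomputable def table_eight : List (List (ℕ × ℕ × ℕ)) := [
  [(144348468, 0, 0),
  (1192962, 18830718167954, 48835529125772408631558),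
  (9859, 113854024302484807282702255983251953453455491543, 48835529125772408631558),
  (58, 18234320272399038369865359011198648851863218414545290046896788116916848495450626647835828042271656, 48835529125772408631558),
  (0, 23802152404904580896636503348954114037336181758906667370491699774153242602667983170697884411503925250642771733056268380541942075172564149202141583059795446507864951252101421531164238210109145624701117364933257307963673924899568092673424137148719840, 56975804063315138060445)]]

theorem table_eight_ok : tableOk ⟨8, 1, 0, 0, 144348468⟩ table_eight = true := by
  decide +kernel

noncomputable def table_nine : List (List (ℕ × ℕ × ℕ)) := [
  [(3794747707890419412, 0, 0),
  (2170504816580, 0, 48835529125773694784844),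
  (262636051889794, 47363600100102, 65109963092955128365006),
  (2170545883386, 94154714080306, 65103848324014867024076),
  (17938056335, 128677426220247, 65103848324014867024076),
  (2455838066826, 346383013388002352667730406794309931368540562997, 65103848323158932817497),
  (2455857553997, 18988681857239504917603096559170447139364337434271672148499794370, 65103847185050678750220),
  (20296004026, 736431034475328452825028892413354378275894824390894069219400218965831374645054767, 65103848323158932817497),
  (31361551304879499, 9417147908839, 48835530263881948852123),
  (259186374420491, 285597773272537, 48835530263881948852123),
  (2142036152213, 558427978070250679811384007604675032692288401513, 56970195120298130232551),
  (17739641503, 3214928337422029783482888125664274346206402448981327372433630268990109724493270071368742310670402556651865672648498992224798992517596790927581230075, 56970195120298130232551),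
  (146269212, 116116225773144511596618102157459963297356771580947045440289442469850523093572413099085284637754378343132670254104901521759617287379, 48835530263881948852123),
  (20485387758, 4149038253166277510635902020573437724622724973939832268739078690712181169634314821247736465561129397955212205344790, 65103847185050678750220),
  (20485240138, 187725282612445514280158005553210309278540809815796243188668120149437971740317639081082509732908823031798014241137083137364987261142428051942892611057689742949493123377759213341961834814770377473227154231790233682683450307120278893428180644290727510955311414711741502703934664331614, 65103847185050678750220),
  (169299505, 18496062705056450665849818824528766169554824336504021715347513598002810867955660710384648087296526285332836139535922886472358538400214439751574503882960000177112051569771518718082732, 65103847183909432228829),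
  (1001210, 18496062705056450665849818824528768227776889742037956126223552330591669751876412411554476396687627657443109946481964675484261861571257368036935327157475997427135911631829490387330039, 65103847183909432228829),
  (8274, 24290272537695702056202488762158226922795749797940905876110869593327168980404509380856777516309216959482052835118585708092073911678663239295726185854942991564542526600722356330731938, 65103847183909432228829),
  (1337953, 242487966839462201616709640730571636818503569435253389230920183371203155363307053102049117340224122234661606255522478027398757193757005230863394032132168442001186112505973463728622456442866235713232459316404280291066093597552838715988214855957235000284589238637284801199074725967752, 65103847185050678750220),
  (11057, 242487966839462201616709595294286511300053843291433077545843259353584920782431797765165287036448334405586112953149228736531952594093495314531050585214155671657845160179856447047077676928872326274864160071801222600056038689719471747801707324090847890236467216681852536414667026072471, 65103847185050678750220),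
  (46, 269531356952458164598876869256269808309948897882690977017745930973428243082988215554461308178226656171611542492904226175058748461307245716049368153830434315321687689509613684712372802362813268479926706981759223878724119219743650933911508386449314644148368163517874354934255540409767, 65103847185050678750220),
  (0, 134220806367960977340254499645689765229305676681963302241420997058346936241279545546021516638663440259610551069646137017081530513440228529448504168234220167201726322716367323004424631702837417459163141100330883751545967144182197357284789864610003490, 65116069812053141457346)]]

theorem table_nine_ok : tableOk ⟨9, 2, 0, 0, 3794747707890419412⟩ table_nine = true := by
  decide +kernel

noncomputable def table_ten : List (List (ℕ × ℕ × ℕ)) := [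
  [(13825888371909347949805053762265, 0, 0),
  (466232795395140311824, 0, 65104352632649801546262),
  (3853164138238135424, 2832770214718264206951679224187, 73256349342544000029969),
  (31844331720976325, 443989614528255758407481951915444138759693308471506923339644753957666898823015295, 65104352632649800580804),
  (7789002614174904892894850, 283175524370127698076723442912085703688186451671, 65104352632649800580804),
  (64371922462006523021119, 164077294909220, 65109958877731120909479),
  (531999359190136553893, 5690796420762846121782924114824, 73238513180717646228410),
  (4810236483236656561, 0, 65104352632649800580804),
  (460672878081648080278, 1210946788719501445473773623157723364239717212415330883562645253501373359948567905, 65109963093807829633810),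
  (3807214408374563198, 552105326775262783235029487715374543127787616544465472681343977278794134392584087, 73238513180717646228410),
  (4955957654963867223, 268719448151461791954136625739593943382230884686, 56969688155983025192363),
  (4910007925100295062, 12346894584061683966233727579936047156750983130770421865316407686, 56969688155983025192363),
  (39336559561645996, 3536956891755247005480647919979377343991977142170618408617778797063148324262024084132549203774083429039225065027927, 73250233437804772846772),
  (39336588088775879, 8635868231374986828555538462872489260278100451427636273179260831634647621905429625540183425141509150148407397950190144618795253491972698680392648647, 73238513180717646228410),
  (575922840657666381374, 9526054036757755426779494870375277527100691194619343492289140816053682249042751494301550350060581503758345866248497439922268104801650080561813770928, 65104352632649801546262),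
  (4759692897997242821, 190779377808463918897097754735981574100699096886904103463775338949064494333312100489894620643325194599800620518314912529724993556633, 50181029114496282933826),
  (39336304942125973, 190779377808463918897097754735981574100699096886904103463775338949064494333312100489894620643325194601386880567128820518326029433774, 50181029114496282933826),
  (325095533567322, 190779377808463918897097754735981574100699096886904103463775338949064494333312100489894620643325194602973189863811406966992058345625, 50181029114496282933826),
  (459168585422688755659, 126472980814451609049361149433649929703481069913199528988296976202100879483166741578366671564867011, 73256353933776812191591),
  (3794610480013976437, 133547332384914805211902142080932510875326726199536668099579551430385683515369602335773405765814150, 65104352632649801546262),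
  (26732631201059235, 140558817827832606667659000835222447509411290923508117879977896448695349364198585664050375123446339, 73250233433213848692882),
  (26903848895251648, 12270058747145303459411044120813057899772539041343793365397251640902053027915734588154119329527858868614364633862879932827219789485792333805582202346, 73238511660578352332588),
  (31360417190195468, 12066036975812133671433229392544648960609687993472348045384019864630701891787665666852180655555871371877867375013223431043091780243078972239679736163, 73238513180717646228410),
  (220930836369706, 721173590879675602449908418986480473453215797159994440305039653912259899267569434134544242422434925747945200523472537073200418160598948393878453823138627818505173224, 73250233433213848692882),
  (3251357367966538831, 53789375484542397225345707624956436600796755325433469945632753533128738543326965338852030502468732576682757385287970828518330570468630749926529396910151519254734321657318003368392892492266026726656851989448428929565, 73238513180717646228410),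
  (26870722049310238, 1582645440585545297712582208700725442652849254307559710802051582220597028945881750953309574620817920244752663340840280646082478829595353976785252845634009147915563502781000024559803989208600665531073, 50181029114496282933826),
  (222072083052150, 1582645440585545297712582208700725442652849254307559710802051582220597028945881750953309574620817920244752663340840280646082478829595353976785252845634009147915563502782586284608617897197201701408214, 50181029114496282933826),
  (1837410765059, 1582645440585545297712582208700725442652849254307559710802051582220597028945881750953309574620817920244752663340840280646082478829595353976785252845634009147915563502784172593905300483645867730320065, 50181029114496282933826),
  (587084730800220582556, 962369863583758, 49509797359398387755832),
  (114263540263713619419876475966, 28268939698384, 73239017107606850660051),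
  (944326779038955532395673278, 45819768894492302846188663471223, 73239017107606850660051),
  (7804353537388583506666907, 1061667810651426, 49509797359398387755832)],
  [(71092345638806200901412, 2031926244616285876721565675086250864827359138338, 49509797359398387755832),
  (587540047712258511794, 197131863507555547323234562807272348185391359891168411987971602169548164243224168337405800124259104, 58322314947234877282811),
  (64498789635350883673751, 238862066605961727822409667587991329196699601456656720611934437074820755384230449797611130995761068, 50181029115637529938369),
  (587540116757682799656, 5353510526100059629520527935203260716427990110420134507075314153857885884042018936, 57642943596231357197196),
  (4855703698897730525, 113130904757974537662348793849433134228878466679152089708110759504, 65109979763971967021428),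
  (4396206400262008915, 2687358224975335837930950409362704740332539639925, 73239017107606423069648),
  (3844808816656441481, 57868244436326358462348657640016, 58322314947234877282811),
  (3748729795574206289, 267207261785197980258163321380497806594851220078842591431211610275390379053046139015936898303536176, 49509797359398387755832),
  (30982063222653620, 5674028159691615992841416354065643558540600100793437855666217251812705356710016532, 48837047364465827746631),
  (3841012143563310573, 136824762584047489100066497863845414089521767357438823382227746942, 50853779109430129096311),
  (3840729109668239008, 19113941802106996795328575957281780164053990595030519597673557332933343739491043801442539153865955045924476959056793536516572600983437195119863898491, 73238006213549424321055),
  (3840729109668243001, 1288876817858052304377804385651796597799953910340674201115109684485872845298428552923251594433689030837674967392117385410140479975500868050903343567817222636169154991, 65777102625870491531800),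
  (31741562889820102, 40380495151050956205971329732948949936551771368328938067592089117195171503618321813491985314641883160816507560596617092927964249815020383623882108394151006858665205737899666197840796, 73250233816415094266842),
  (3255534616116465958, 19125188088360025980352342596572788202801635427602801769280283182176643172550500792529258772047061623355809606845288895577368571068168806325372366830, 73250238024734135118427),
  (26905244761293041, 878797226250151258027809709973455841009675322953510930125953412656248650707456711694346919648076854533393496336080611098964921966014529808839856274892716145559558933, 73250233436663526486435),
  (3251257513580160579, 700033726891280183760249403149108350866062290315873576344566900672416605558822496198851097531768881691817962789039722154168029316182, 73256353940675523414610),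
  (26801676624861248, 700033726891280183760249403149108350866062290315872650447770457599622768655258914240843728318751755055895052812399846215380404861673, 73256353930326705357692),
  (222326702411099, 700033726891280183760249403149108350866062290315873268588920955601168999756469064557778524381620400505564021187119488465461655329179, 73256353940675523414610),
  (31364152179335316, 743222242764535112458176211562673597190804217800440359065491355380389882765305164864567178038511897410395794114368743732807597783966, 56975800987341486036805),
  (4956719493753971086, 166359134132476025912537233954813662708437512226122201861703179636, 48835530263880662699930),
  (40098398351749859, 35517165894607752225841510856107698514565025719405473805479255959030203225551451264090531398540834535685199109128425503824488777873301498376478369258, 49509797359398387755832),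
  (40478148185333100, 3506846114704618762115851185990236022157079196241626722478961296047793921539721162628534642722074788565232909268709417547771243497427915332360828938739003786012426479546446961984525055797923625660348, 48835530263880662699930),
  (35541400348750967, 36963203912829453058164791527403565628003829267196873008239532967733236392905085230143505492830915382477183515014156467820942795633527796764992711758, 73250233434069354986466),
  (224665825509554, 7571543482680618436624348967690905434935406038429241526082741109945581115676813285515449083808951241257785892409934913426885252790938568205589330222121164564303595612592946455766399968269465999471369214894573842438400510705336759694, 73250233434069354986466),
  (40512670897477031, 829969936871894026723283486356530730963069627275607491445981936335524166875547033619762492764723695949585435426149688126333233591305, 57642943596231357197199),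
  (259188537653485, 173954176877101776464843675921531988594451505730577423512154367654708514846174763221197553499763086946450832229946496754069354034670384555924839061027488155477195353411978560455862272681865155470217407637297289387544, 73250233816415094266842),
  (1837410762363, 177011788243167671669444300181859529579876802823164568817722629752027446258409382116933135326471009110423940616455352111115295297952814799402967127526540283193781707789933137650061867015079678454944438087238167530577, 73250233816415094266842),
  (1837410762396, 40399078215641688005866545191063838568440967002130326058224220693747594788044408721955806243007991213157039231119587379907451832207235201434119052424, 73256353937230817279586),
  (222072083049476, 85142356725827936757349033953500205142256534272564276217217157000433982771322428380693025670165354007328666722604113740150139179282764796720602864130322915768509715626524894318473617, 65109963089787313173371),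
  (1835306471483, 85142347878833927727121871813197386365639368104590241460091916073908622342341752517403702650476897126657981473495149318693339735223724223856190856492879864223977717244785555616393468, 65109963089787313173371),
  (15185212912, 85142347878833927789911800416518940301208741029099178271329648923995100249230765681786371970989640628011519145089452912236948112134373897951425434869432113381866250585907156297141551, 65109963089787313173371),
  (319042622228946, 937323886479925728036233465428912339409599974024654600204237758010216394238771323565099012433561635991655910939373491605725735039124, 56975799849518543639532)],
  [(337623309652178, 4244522564237451231262821387477366063730906238863712400122901831873500649615508341513524051898961981390535515598380772928312463146719729934170022830650166779157464385044203793577212878655101399857112, 56971204495355795292391),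
  (1811473343031, 4311071229302087698900879705310859184207272711615960027706679352645967794631970429879620787965274292279866442030048990358972764124059646293961865826413306807898485180279243404022909912841785579116473, 56971204495355795292391),
  (14970854031, 4178510861789336852639471406489828720471318559375246046026168163047512929144733435595349729202054090160018171684348535317263566414448516659001948282863941745918239501235862461233967439103509931319522, 56975799849518543639532),
  (180091242, 96730775679598212559336816494848950639769781597073134837768491132778726548793118088423805954345530594468329833684866168844029107543904143587641316020159044154949656124828678215252610, 65109963089787313173371),
  (1488357, 98179337779694918288211613578600484795069496728055364455790308264481130856900987862745547676505187844120330862778261003767679323116005689090316459352690758027302697790881721979376511, 65109963089787313173371),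
  (331707688677487, 937732042895368830688351381373609934775324887057565505444589084477578967636403597968165244674949176971095782623195904320721196753828421570086238195542742051691577821139140433921109840466901213767773150494909391312897243780475296474762948733042270251913882858518662721302804317192781, 65109964609642582518164),
  (2741385856838, 939196106364285641568663628762498461786024191451098270947696383578246429537631838190347104290860794456709028830280700946000221009524408215589994861911241273297532659934786412340847587334885290200252840784403808523980161651154477413576662842339954916397054170770769796694211184610040, 65109964609642582518164),
  (2743331997122, 44346496302296794907860301441634247691214323851296350924257411341391780152011408270529091565644961541756331549804396325479742867881846538405258753675805375071019456718542084518318365634560965471851156897772945376162050069201785927098007628772552336232080167107221440340376892561310085046183088619894, 57642943596231357197199),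
  (2743332319224, 44403403437891089446160827633545851194926749438728770684289141751099541705154839108015596970653548260432874588688988066184831400392841815197815431859309398821321892818313408642138076094141824411406386256639424156708012357309523480142999546110232217846736636759149941507736387801050481682841596609396, 57642943596231357197196),
  (22672169115, 21300378223222848547594222314791216305545921069583026415236115696920290888273422271638789004240000595315666164794439231114129595301400636526679992927540997367232713785415773001319886791495784529695028659954411977000450096635162524705980678642008779996377914214208417, 65116079001996520749955),
  (187516903, 444826199353943754562440720192020220737418749914528696180965439182411422632093728715106362647812684353219314186283207735120994327210914337411743837114997532825928070129917759973888719919716414051437785368901667332855166707145227263637156615816710845, 73256340155764131211464),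
  (187370493, 1021001730958422278315715966778058873230863468285855044663815487396537713316170545009887726090604169816159857501256635221653959554674075648836320305916824323641478862161842596685427719442806822937381436104863448174549228919084175741088430352830304575976430798287283520760200321423951, 73256344748140781849275),
  (1546921, 1021002492183358749971221434096298817837927524844832783984584369312629589615143211260974570344260471278365732996396907104597854470026906926567865461892446655488607958017742123125502117802767441706667285089240997236045925383662522557989956951134930199321944086002574223283522663558849, 73256344748140781849275),
  (9616, 1048271227715689029046821196296724775211767518681353307131510262293512400832690539182802768734311964500427374112071988083295602057717379151498203018790612007963539694949439339261811882077160809686710806050678705392653275066746456433607758342182100178543604090951771709820401038226656, 73256344748140781849275),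
  (1575114, 48732008285570541522567575302844613698678922426031472269884698157566535369392552120943737782807095701115625284765868697701587929871040433223185113759471180659499503014110153195880234906445353793069226204260960153594127168483414205406243140580216499648424844627105871367952831043921056203917773458803, 57642943596231357197196),
  (8527, 49358593330381157776208274494430142552836473110822600543806982483095876421521013718629260830890743688523898145900078075049655737038185791979164895186718759099150667478847953020729342680191839730083758019811287663885565243741765586494761109862261915269075156401673432554392189970058725240640628105338, 57642943596231357197196),
  (57, 49985122153085223915683461534172128947690463098197176848008047161273892356992440204398877173907794179036414675695837315748360638531341770860293602491145259237382340399106892122644534204172101607704287791398824683553838885916592976094275028941138782933452480685609187502653355534632265492901074236929, 57642943596231357197196),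
  (0, 521623203532187933283313927789254812408543443492620973644277043593445395411620614282580789772357489298993786312841962733336357747880735896290632153043235790065841810378500656517367964675698834133437952875508679710455462369267090504554682445863911165, 65109963089502001502756)]]

theorem table_ten_ok : tableOk ⟨10, 3, 0, 0, 13825888371909347949805053762265⟩ table_ten = true := by
  decide +kernel

noncomputable def table_eleven : List (List (ℕ × ℕ × ℕ)) := [
  [(142956699702181555530094708207, 0, 56971709942385151217393),
  (17275347135179231343602910865566, 0, 73256355069861946495789),
  (142968362196367795738502426191, 130112487977023798868692974542207070914948852300, 73256355069861946495789),
  (17274143655031264027955704183519, 102138724962032, 73256353930916620998689),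
  (17275335472685036748898164316280, 0, 50183050902611350937005),
  (142956699702173201033755876905, 6004246239765058326761360961459, 50183050902611350937005),
  (142956699702185317645182478554, 55414839621426933531030570656193743170853313019, 65776597178843063871385),
  (1181460328117234030125474996, 5376194450703173605696178849358492752590600410399534931716382726807096380269237922235064523335778, 65776597178843063871385),
  (17288257544810730617324653245064, 0, 56975799469770424928422),
  (2091904198352654333182102997385627, 261990654544223, 65782714987491933866721),
  (2091864861110253637907135121323509, 344083021640160, 65788830512478735511883),
  (2091864861110253637907135121488565, 11562233694971380234197923845174, 57650070399330602530606),
  (2091863982671283984359265447409097, 13948902719814016369433169010937, 73250743478664366951006),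
  (17288132088192429622803846672802, 1353283956210635583617519605413325455773490466377217809187215911960380596054302350, 57642943596231357197199),
  (2091850872677092484428898385473438, 320463989178758, 65111985640565343639453),
  (30626991845205926341106790899277384646, 516696571730455, 73250744997663701283970),
  (253115635084346498686832982638656049, 1090941606060586827567103581254246793199488541961, 51527539998418401861870),
  (2091850872677092484428898385948726, 1090941606060586827567103581254246827722190056532, 51527539998418401861870),
  (253115635084346498686832982638657370, 481965517103334, 65111985640565343639453),
  (253115635084346498686832982638656027, 786727922481358567657077987928076394017168823217, 65788819806986558902676),
  (2091864752763194204023413079658314, 2106246016076513999923413745631687606323609725062951330938203111808506554656679679, 65111480193536844344593),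
  (253120394012238013161556225948770733, 1295920341104193116403064305403359558721939588804, 48836540018688161826144),
  (2091850872677092484428898385473449, 15193700702170442914410082007269, 81378281153085883623101),
  (2091850872677092484428898385948737, 3380685178214368991145367528550572297586398091093461215722187249561003283832078654, 51527539998418401861870),
  (17288023741132995739081804842551, 69310816417755966865231173192754929362414214762037436806324768209, 73244122882093072752670),
  (2091904504471512256871309091922982, 1806153708197753304787725030219801060980669143073, 48836540018688161826144),
  (17288445466876548795876632726106, 3996282537969580357041444393615069117574714962412490678557665959173946699493476960, 51527539998418401861870),
  (142879714602285527238649857240, 45838050024017554165933449533377648326291146145136105925100639991, 73244122882093072752670),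
  (17287055958827031375473575157454, 0, 57642943596231357197199),
  (2091733771018071314411075601596696, 2016801620419659202606409005919730555309760891330, 56969688154271155330721),
  (2090304781651197822001065902416257, 2111568528579216286765086825734431937595405935798, 66461574397459277754921),
  (17286950120271332709472481251882, 4739069434864298285738003797571530725911136013739870945557315791240798829788369305, 73250238791137912419877)],
  [(2091734074547022757776537292938159, 2016801620419659202606402737908349416757200170740, 56969688154271155330721),
  (17287253649222776074934172593345, 5045596219370508921962471999370032292486835199565664944896807660532182175273352417, 73250238791137912419877),
  (142869864869609719627555145399, 4877706030346360347743909591399621066417329498834862758030974732564767102435169160, 56975804063312544641181),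
  (2090278865191766265505793470836989, 531281514903426761407483055385944205505290926126, 66461574397459277754921),
  (142956699702185317645162826382, 4291362264133235450018627065969575604419953243426497430500764459687433247375294976, 66461574397459277754921),
  (17261033660839776214200049672614, 19130531145262138795858679660624550670073450740378081857013908649752175554197189369245643354765014567187872047158737069812212963248109041408476811518, 73250238791137912419877),
  (142653170750741952183471484897, 19130531145262138674554518369145704368347468949415766128733824203066494291364295815679837937803772627383538422313776700807566763361323819621948694724, 56969688154271155330721),
  (1181460328117234030125312614, 19130531145262138674554518369145704368347468949415766128733824203066494291364295815679837937803772627383538422313776702393875572116594771377000152655, 56969688154271155330721),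
  (2093465479479096597616725771307873, 132504594978405354962639287028596869926955775507805109135375901854, 65776597178843063871385),
  (142771367542851643516608023061, 62757410280740763105520106725137, 81378281153085883634101),
  (17275022094000929692436785208470, 289761040595175569364465443803423800480812737624299702393385669578914074601516712583019853092394318, 58995062245945998234582),
  (142759009306444899000871237913, 13639380987388443828534114871792812069841494768120651924290776670657422916563663628312779926581194535979470230538207, 59005125236786120537841),
  (1181460328117234030125308664, 13639379986915987711625001514099934653172193669858751089429869641171515768373618948626334280045313114143340855011852, 58988583334035234559881),
  (2088547154140834501976398897455953, 318005029215327734669863354221532610891285216330671443554664579490403549225585975404447239704285706, 59005125236786120537841),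
  (17260720282155657041127263615338, 30731355304151910135064013594801873246201073433298029003102134520428955094731733798452782374865303244780068322259920301419383611127057283355441814714, 57642943596231357197199),
  (142650580844261628439068294341, 668803829650258474406115183907826311536664690946038073393170548758594917276835360944659064921162969691050128235372365263810862759622, 56976812261148318206979),
  (1178951824386297125483235379, 30731355304151910135064013594801873925620400832078945597214340124646345513358043628171910641906911978585318109431362444938268112561836906930249114001, 48836540018688161826034),
  (9764134943117636612605856, 668680442307758676626470631296982993657186308517869895309399816879204806815748021787531001888092704460879916714130337977302815554078, 56976812261148318206979),
  (15423031494579933392574854538024, 0, 57648575082576799981529),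
  (1866186810844171940501557399263341, 7845733601233494285647598633484525338497152694339455031334641517912565735063334657, 66461571701523365047989),
  (15423031494579933392574854537991, 3702348338629599556601512569239058902202580476689, 73923484284509270428854),
  (127463070203139945393180616016, 3702348338629599558181793866962144895982426782530, 73923484284509270428854),
  (15400606303300550883656544732557, 45517117836928706650437744853706, 65782713087886830939535),
  (1863292425760136463191128108273359, 1713940720915412, 73910756209337061907535),
  (15399414485646778162714084599796, 1922712495130823, 57648575082576799981529),
  (127463070203132006029943400342, 86919130389702630349157732289539, 57648575082576799981529),
  (16999837672597732149249301112963, 0, 73244117529048695207044),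
  (16999840262504216653672725794634, 4277641287132892243040653625332017520399603411799, 73917883771080039716718),
  (2056964756407767616665353012014012, 4358362979808956780124529527394497573927247863753, 73250743478663275830971),
  (2056966162314652276674729915828667, 1724811593596520, 81396619689419569944288),
  (248892892845270179603555507784580813, 4502939145795938045214200430103347860015571474065, 73250738880527659656777),
  (2056965178133511157605536432785730, 4358362979808956788095405995826455489316132589445, 65788824781708519619337)],
  [(2056979479945356430256845954378862, 2198608880611660, 56975805582314470606717),
  (17000025594663538211189873482168, 4358362979808956791412234526275937978889246871822, 73917883771080039716718),
  (15423031494578467282594652147699, 2277640213370907, 73922988782615611369412),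
  (127463070203127828781773984691, 4808958697135048388273515184460756958431560812306, 65790340743044183917414),
  (2056979058219612889316662533607144, 4423422254503098347326459358907541692462362177120, 56971709943241943664750),
  (16999830412771540846061631082793, 4999919716376186139084665068200983166175292142097, 73244123262697964586097),
  (140496079294740085353729587779, 9202150293089580992634038822116590740237001464715944689219258723045184455108178972, 73250743475213598358548),
  (1861742843466089626776941561589620, 226340301973980050889323686338742675458330991677129808368809050240, 57650070399333194164508),
  (1861742843466089626776941503916048, 477889860435429451543506791591870140658316805887172522749847414845305925141944192969893115997146624, 73910756209337061906567),
  (15386304491455286171710260362931, 501910035663595497141467508063887122529192757078321474592672056255131871658608317642024515407703279, 73922978837480771135083),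
  (127159541251696579931489755065, 501910035663595497141467508063887122529192757078321474592672056255133313757969382634364892168344089, 73916867523694227708281),
  (1053413803331735085894054742, 501910035663595497141467508063887122529192757078321474592672056255134900060998542744800754044328390, 73916867523694227708281),
  (114353076011640015026119155645, 5531237126378342284396192046462608874112261344109, 48837550912746230919571),
  (1130398903231525492406543350, 353522627137285049245772322941741800387123561562836512092539034741810142591655694143611015636510933, 57648575082576799981529),
  (1130398903227763377338743327, 3643915759556624413621690545255519264396522542976, 57648575082576799981529),
  (114353076011632075662881939971, 3643915759556624413621690545255519266510293711353, 73916872117523373963667),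
  (1255457731432970285044397213911259, 5684819409205102944348073320988549501708500014628, 73917883771080039716718),
  (24422196754286148911837219409988286936, 127796092278799413881569226664608, 65776597178843063871385),
  (202583449692235531343466828946283145, 126827650548344909656996636027466, 73256349345707725829258),
  (1674243385886244060689808503688290, 2846836996239852, 50183050902611350937005),
  (13836722197408441818162853891901, 126380212906117421678993164127111, 73244117528763382571096),
  (16550170342212764734619021820204, 261163177213819125113196898763561685230154831687242315494986279981, 73256349339091946411582),
  (136778267291014584583627804206, 551414101779952196030527555546035014831351110440000722836599808900098909612990346045303239125246018, 73244117529048695207044),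
  (1669604179757262715049971463203793, 2619728906433496, 50183050902611350937005),
  (13798803376630009759741956886122, 167436944797240258943573573908950394548036862163757995788989405847, 73256349351931613216746),
  (13836722197406975708180215444150, 167436944797240258943573573908950414868528673016143906883190417895, 73917883771080039716718),
  (136778267289548474600989356455, 353522627137285049245772322941741843927998015985624751238788271261679674902040563157437262174606602, 73922988782615611369412),
  (113161258357867294083659032080, 11678530581195772333451893223687323750381123114797360060908215751187281852274430032, 56969688154271155330721),
  (1130398903231525492406552546, 34297787365220175429442469348297225035336158144263681269607833122500998359650665044970964565161627266120151342924374497419682562268536345265708291341, 73922988782615611369412),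
  (113161258357859354720421807210, 3643915759556624413621690545255520750714701074635, 57650070399333194164508),
  (136778267290053921629508773736, 126576862818989920986858999237261, 57648575082576799981529),
  (114353076011640015026139288285, 5684819431647696369756598663514189146496778516000, 73256349351931613216746)],
  [(136778267291014584583627802809, 6982420392472666717732325128924110144212635252947, 73922988782615611369412),
  (30137153811023044286351782577114825411, 6893867453401297221593796115872804645872642991898, 57650070399333194164508),
  (246380072627435208882507423264973814, 692844129265586931042515071237203673153511493885602691081674284047411414589466222037268656976780261, 73250228843119691903838),
  (1460262381345595759216053776622978, 699857319113226653013320234703617298582625051536634636607464903913450666030800579107333168064229581, 73244117529048051165306),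
  (12055174149160531137534209420810, 556963575967567320306563619010939524240579553647535465949244164739975326140953297783376343353117432, 73244117529048051165306),
  (100051264166367363716617695219, 712013511220269575238487537323247433567992582972161168688634338012495129377050531444508589995823560, 73916872877026704556273),
  (1130398903231525492426676056, 15650659826062559832818720611327076356287605706350931676963396582956985697375364846, 65788828993479416976558),
  (1130398903223586129169327676, 353522627137285049245772322941741810435017666429633798049365781631036672938789334197110076879675072, 73250743475213598358548),
  (945066743897851363852224491, 7693682382615034096137509264779149586970880760085870393441535154435286419237182309, 73244117528763382571096),
  (9342139696128309854599596, 34297787365220175429442469348297229259551521032176806151674201693852509946347124227452465564062969328122833950599340054805876319455664659694771990009, 73250743475213598358548),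
  (112739532614314137151547267451, 7717349213797227921385127769042918926486871056336, 65776597178843063871385),
  (1130398903219408880999912014, 7725752952387988448609224964655750252672960884005, 73922988782615611369412),
  (708673159678368560294787917, 749531180345991807645999804824659559421761845725295500765363396750937890627642063911223177381078144, 73245128422820381157670),
  (9342139696028172570247206, 34440755261222710945822691982898374025778000776096097658195560199776289549741829717998315464594523092230003359729690, 73923484293120495396386),
  (7810468957833482345886152, 7693682382615034196616447391624693110639551081330824516108869462992020441857788439, 73245128422820381157670),
  (77207766083705040120657, 34297787365220175877369103588469662845534149223354657089728710240867926544037757706458838211163939992507398757893779130009335853373944882290174960029, 73245128422820381157670),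
  (126271252487197239945327482063, 0, 73910756209337061906567),
  (1043564070150065313218566143, 177574740223924650766665247426586, 56969688156267479106442),
  (9342139190266148273822838, 17526705419895584923760687810436390333668297638364316457079476391559793992146563519, 56969688156267479106442),
  (114036211990793082292536654586, 8163095876941200169674330413565329790592977347863, 81396620448918379675246),
  (98437720768535723817709440678, 8163095876941200169729154025643424010298790889684, 81384895217109077981335),
  (1860012324225405308060495211069878, 17233128921782351967342334832117885141284075213009225439717119979426644798371707236, 81384895217109077981335),
  (15372002679548804198847067860059, 791960981101530456993787549623334556169719787593762759596236777305247371178249405463042265398535436, 73238007352799781539996),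
  (127041344459081026436752626942, 17229310371040568927799350550950883481170954931247773299717188926512369029606201370, 56972217288161960990879),
  (708673159172606535978554276, 791960981101530456993787549623334556169719787593762759596236777305250543790575737065052541711224628, 73238007352799781539996),
  (817020218590196398444014118, 791960981101530456997606100365117625875012701799882193152528474881539583295887653393036382742554758, 81384895217109077981335),
  (1130398841061540986993732885, 8163095876941200169689794516071646794904883301672, 81384392847478195322173),
  (817020218606490258020384527, 791960981101530456993787549623334585410016883918120530784860343648613503711234464759733023953939495, 81384392847478195322173),
  (9342139190266148254013565, 791960981101530456993787549623334585410016883918120530784860343648616636993578221861952199082247574, 81384392847478195322173),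
  (945066743384049839014099353, 17235378389664441673251841910426277313793542616021489392137444613995543983734759047, 73910756209337061907535),
  (9342139182326785016474458, 36390393144104901861814971117264228650671206545821460178772515033283845599402357681870795685451974284951823671338053, 81384895217965012992560),
  (813534882384592758824042291, 3530495279185034398049780072995485979383086422581478577804449443001024737353236621532503408745488218456456337686612448327904386665829577210886711656666861666835642443, 81384895217965012992560)],
  [(6752233211623886429917860, 3530495279185034398032757295751533523355124189585110245676077235017948744600308527091217118080849520180207008639088754996997639349618075928732131177734750393922572901, 81384392847478195322173),
  (77207761903026018625538, 3530495279185034398032757295751533538286004769858945687125743355431180475817676674740564285471782697349386070910374855214708656393054600253553959961809894327604946123, 81384392847478195322173),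
  (15412329297945762649042611767678, 0, 73250734289293113620090),
  (15412209288330478087772532735710, 177006245970768541991212217241639, 56969688156267479106442),
  (15412211101153652957709475225586, 9533587284046930153481237792360717778951679833703, 50183050902611994979953),
  (127376235370050445713450938104, 9532984920759661179351513958241634371523746688156, 73917883771080039716718),
  (15412209288330490204383939847514, 177005595888778893231570667823489, 56969688156267479106442),
  (127374601387739744455925166549, 205552130380019098653527358159245, 56969688156267479106442),
  (15412218345998348486585498663479, 215397073466401949838143894603390, 50183050902611994979953),
  (1864877121513910123125643656532981, 4284678091947053545452974507976435317700205040468, 50183050902611994979953),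
  (15412211101153653057846759577910, 9963701415262542858892367448102094858752115033944, 48837550912746874961551),
  (127373712623837348095738465737, 9451930224113172190718137122462698589104841795101, 50183050902611994979953),
  (127374607315062809055513024008, 8140070354088362559373818021422899380955687763181, 73910756209337061907535),
  (15412217450568105231348126416948, 21666724932761216796922229252745497826293495017975953709518693240633075329159932730, 73917883771080039716718),
  (127373711884819553818140777477, 21666724932761216786569853508337282798588229793505094982405460450104657809321888192, 73917883771080039716718),
  (127376235370050545850735290428, 10261889757610691716656745592025668650104295547864, 73917883771080039716718),
  (1051876079806789074118538995, 373725080819252928259315194920001282238173056606363969932262956565, 73917883771080039716718),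
  (127376235370050545850735294433, 1023925133322912144163031149284896959158141018454535713413778493713004352213331369075739935592660138, 57648549465271894695115),
  (139292798834799694453883421325, 8159511343883339200564952770464699655128372280931, 57648549465271894695115),
  (127374622297072419414709885289, 472031821312042504916222840503213794097564158623791920181857676471, 73910756209337061907535),
  (1864915462052910041800615387808549, 1045081589363291972132864322489013529731331411159767088048221341719383833856183420908623746794417115, 50181029114497998126976),
  (15412524479776116047938970147178, 791613219619846357234503121852660912404468848581292966757226455194128706151951715014299467925080367, 73910756209337061906567),
  (127376235370050545850735290461, 791613219619846357234503121852660912404468848581292966757226455194138800847479169960515768545599824, 73910756209337061906567),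
  (1052696160083062362402770995, 1045081589363291972132864322489013529731331411159767088048221341719445421907452386559594376727277472, 50181029114497998126976),
  (127376235370058485214012128653, 23360369023301520833262372219561825535532512955057056434414103482378328703355776571, 56976810362400866450227),
  (1052696160083127976975306826, 49322561624703777849614250146288176254331308478623006847281136355958927496172378095610986426405447375350736167240534, 56976810362400866450227),
  (15425545049290725860370412858031, 76690589660465022371658575571825474067489323074536957416718080583699833790042596182180327204835047736181742452612538707160721473953882160929810270479, 81372810439296205184828),
  (17000046390043728197499690649812, 1094535068576665777194021332754274621117952317154067426144075865350108092408031018015931219071896249, 73917883771080039716718),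
  (17000046389247160006396795671946, 2328600352969445966083012683432035150314530639534456600287635803792763480386897803092218709591936533239470083329753588429233392393865, 81373178035994724515196),
  (127483864786749623988696174469, 2343778032752819379019702227483019107401760917355750847628776141938032646851444173208362056212204656921439060595367419834547014315178, 81373178035994724515196),
  (17000046368515728359657770356711, 47698961270389869139132641620548583453573385823023024332759984104838939349227855371304466693083052377505260616278519, 56976810362400866450227),
  (140496251150802975259477650148, 51566012685426827505810054934216008809573165039603889135134267690667079840354124186363753517702899763236184793592953, 56975801369088501313711)],
  [(1053585659394624991642117111, 51982257666610608873273533991313667937312940272712355578173020178631891861327782796453612251990147414145971312921068, 81384389770081436122480),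
  (1052696160083127976974982062, 1138357010708034341769915783801366509220556195398245760531888045847772420628344956930394249180181057, 56977825851426541816243),
  (8699968265149817991528755, 52307197130337699854734264543538670441844546913501847668079763763648385274742491911182659800879157947452024943079903, 81384389770081436122480),
  (16999712215978925292566894115720, 25066501260500225228213769350237075497957249265144550896715190879056306503961878176, 56975804063312544641181),
  (16999830412771034983900030657812, 1157526399920448855538271116482260413143372320094680809254845625492684952398407123866437687573626757, 66461571701523365047989),
  (2056965948225420883524133871721792, 36390393144104902221756314002128989092483573704985488012011684957532726226310643195325585127186835667498175446802472, 73917883771080039716718),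
  (16999722065711601100177988827561, 52924851140130010929975370226308287242817434198780979284809131000768817923960477139451465850303106011086795772367982, 48836540020685343519340),
  (140496079294234223192129162798, 111744349125372256860807081601271738017130865732169238676846346172299408609825745331097300459126850950698438071341918862088079351192723431727883301532, 48836540020685343519340),
  (140494466221248223007438265894, 791960981101530456992287265175206160963929900924724678531564601529852401409669287119555940627185162, 73910756209337061907535),
  (140493570791004967770066019363, 100710521924822968351409655936666136991444238995241279181466624182331287388478698355148631447699426111502806899841079636230094359562963955191964142889, 56976810362400866450227),
  (1161124622266398538777922960, 111744349125372256892026211562194288530287064651353583661241631223011749081961044578876380756817495085516754619030835215100897633372391650019574149880, 56976810362400866450227),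
  (15385987627434439238976677858044, 8163095876941200198147683962574450467985093423922, 73250734289293113620090),
  (15385991112770661136475874357326, 1672128734600808654379623677573833398320136164432896005798295190172996431923338674152696738678350720606582789531408445186649071266243, 48838058259664073016617),
  (127159541251190717769889330084, 162225304363169110952143898482636956644337608202510138471185993641520964925972525678291403933233035276567475066261732062219833240218164732341220005304266726234558863277771456072584405, 66461571701523365047989),
  (127159541251190717769888849472, 76833863652023905538434347567351790466613925461708957670953526496071741625147855893551208601170615401385550802410212238263375963457801707320868787064, 73238006215546606015334),
  (1050905299596617502230486326, 2431882612958743079250842515454316340945986150993286354072761848245391745337756674910862411279163175978712574095391773787532922379045, 48835529126628344931803),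
  (8705899196908040696637563, 2431882612958743079250842515454316340945986150993286354072761848245391745337756674910862411279163175978712574095391773822041350434626, 48835529126628344931803),
  (8705899196908040696637618, 25066501260500225058618871616089191091343586940032452858313679954307378810154968293, 57648549465271894695115),
  (71949580139735873525930, 111744349125372257026404201144676100215413661501745219438543730322840683657660196145692640278062414824021336059670468573255052114609643625922797116499, 50181029114497998126976),
  (64376534115228066839932, 27483070607743516548473988000517705245250853076823020387826584904743179840006873349, 65776597178843063871385),
  (638080676884512550624, 122721473274931688023137903657537627982790368499685209359874381760764300401209560027627900194050639728586222976832010683816248803784307058656174705119, 50181029114497998126976),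
  (127277738043296546845957339963, 13192541922697149343949513343559224150500448956767, 73256340915836136590214),
  (114353075949963360367175509357, 606180887423662366813022791553352904703024863850529257030868659237, 73922988782615611369412),
  (945066743388126945183267297, 13257628396999265979403937570987917236449278990048, 56976810364396333273456),
  (139077717788914064937422125481, 291553029724825047831292503065859, 57642438151200039114554),
  (2053686268416377232067356142930505, 605849001814683100231987912460089611571704625403289603776853974496, 65782708493486185547709),
  (16972613788565101091465753247359, 1279176056570991263678767676143401101122327042090213446904224210700431376982238900193481404134461851, 65784730282169090226662),
  (100051264104690709057653749882, 1279176056570991264168447394130501066007871196603312675127189376346379271956682906497002853401485983, 56977825851426541827243),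
  (1130398841554870833462730719, 1279176056570991263215162560159951010068392236534677389677765790833701935616727985503043351500602508, 49509797361395569450110),
  (9342139186403891185642402, 28285668445501134434826437905057318268533882260456206355849577826251673611725765526, 56971205256852643347889),
  (128341509172283803366898362722, 606181032999194599302585379413162368610396689202338275433205899564, 81379292047716097183485),
  (1063263535497852801031953320, 13192265434399437472762831126400728402113877036280, 73917883771080039716718)],
  [(8787301946263783881791040, 58810006994438169507429525578551763172956285462117050638130373621381600402246872084833822635972398866245300247350040, 73250734289293113620090),
  (16986609481614122496452527150590, 27849173913437638555783965587861821653247156186464566214643335062166532669935762633, 56971709943241943664750),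
  (17301249342210120825262002199494, 132337797570563878335841960561049961196984625324802322687742719843515872019469529813091326240431078996224657412685448433340940916618367787401922803282, 56976810364396333273456),
  (12068284143290366461378912943940, 1343471826926581180658051032612307710141832179512969840746199091493770183029849023880959143397469959, 81379293566144808175227),
  (142643321017556519725084718429, 1343471826926581180811950372551110557484042994213697220567709224167847807769607959564683382465163330, 81379293566144808175227),
  (1178870421632698510124667094, 6080886049107506416644537625851699918233621081045078478280970676197241384158655653928937006181882181493402097565119936080211892279539751263753523005913353648629270536, 56976810364396333274068),
  (9764134938905861015150892, 6080886049107506416644537625851699918233621081045078478280970676197241384158655653928937006181882181493402097565119936080211892279539751263753523005913388171205004277, 56976810364396333274068),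
  (817020218602727572328919870, 1407195958496422961902155441456814985468118066098834767327627318310408948103029718326305401843071535, 81379292047716097183485),
  (139075127882939253836090441094, 288233779133460368450772930799435331848590083040437794048940864591471809901001912290455020340636249960598997216156948172870766090005938655320947465114645993950257259208673341319928211, 66461578989838519541787),
  (1149402626354662516601644892, 288233779133460368450772930799435331848590083040437794048940864591478338993895653992727902207690909231789970338489637872762357444625927889477266998704457267913831693091623873147609359, 80583213735902818307587),
  (9519926690745341731810929, 288250050334787316191084958455937369266039774784144441417741641095341629629509773402530651172267283416340484495478464544595726205533321014971901822165203274565573173639622212699270920, 81390508753070772677565),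
  (77207761871929442665693, 288250050334787315907362261596252586056125013163134232304669129733763108344332800996245280581809219240252066883933803533758247302963938545715843681134967665568681879504005714517078383, 81390508373323952651354),
  (1180825556936234347429855268, 1441017908360084383408230990208981365277616855076620227434889632095614026778846299480310329784741049, 73244122119427733984571),
  (17288464389196922576587018848575, 31360748205453296332386253232896210596597233172615733325555137757818208610152557223, 58987940037818430702910),
  (142879870985098533690801808665, 66214383617715661166653519804436512626558006395845928667200671976666838974920917297799678328989768092873784991874068, 73244122119427733984571),
  (1180802683436372084666130829, 66279960543739090039149799361726346063572509488947843534849883224649231793915537851221092482447851439333046840030058, 73256353941819362535250),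
  (9758876757173662730115747, 66279960543739090046191482866903818113548635928394049570523750927049002017964695471595326525304280196390695204528439, 73256353941819362535250),
  (142986529990976934883538133843, 66252613729676830329005925586629954618107743672868406995970697865879889518834993152948051208707199038922506458687299, 81390505299944688273613),
  (1181706859429561445318496973, 6430298427324037943323894754335000439560957911659942587594023302103998582524380948916461836710677697759646317466668076661613908608763921411965805202966863130369882251, 73245133016648884336655),
  (9766277007117920890216958, 6430298427324037943323894754335000439560957911659943241155373348252823239547211278939011042401946880086776378959771364354436943544273857016456241008856535743128307743, 65116074403859169721332),
  (9764134938936386967773519, 6430298427324037943323894754335000485710976114762840493351765599013903680507544663918749930189605100406552612354926626772231891743733577126955421547224672213117532003, 73251749777751831003767),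
  (80695330073854437750161, 6430298427324037946748857315748034341868151999927274148290908626931635811981833079279477591750112579154549920728818927530954375072196878250812610131934590941503098417, 65116074403859169721332),
  (127463070141922269347926237036, 32900904716396519107597863493436973922496480979334919678064395989272161855485998266, 65103849084655781678261),
  (1170974354942205579249293645, 1518935751606814532635839570494157660365497812067979102804638104016401242938956122039475995277293026, 73250743475213598358548),
  (1130398840050577884570541912, 1441849906982811375293327042866947357782300665323836722908069635711528993735833449312445761289731895, 65103849084655781678261),
  (1053413802825803878868865280, 3224823834812056539425323226169528508612189244178561393369464008908642155952452168572250771878867035463548721807113448847326572025227, 81396628866129034401108),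
  (13799995194222576921245833411990, 6868744116420350136927370853557183227704238276083407298789331544761800698634047252715525156351775366177703544943408957963431599691719803402128884472746688678158734371, 56975805582314470606717),
  (100051264105149687666607324295, 149483884602022982068189149842951224942845421474636442503247792899376208952636489113553478001236633396247694661838600373743115229262684275261634045735, 56976810364396333273456),
  (1130398842013849442416305132, 149483884602022981993365517632518115536742801686045192435756075743539292798501022865962083831108581980977088688091025908378504802051751072624497545214, 56976810364396333273456),
  (9342139190197102829410134, 151479695600804556640503374577904965125257540473186265227652592323287254086949616244877395770846687288137991664677905190635278277657293546483478977082, 56976810364396333273456),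
  (9342139190197102829886819, 6746032096015472687353410405239098716206315952272500441677046602430909576199315036447262128859367369342178361714115923057900144588471159824361554625849599095364974629, 73929094746523019652874),
  (77207761902455395284381, 6746032096015472687353410405239098731182409456616389325455625709766278873894422605898598262186262365648102380923798326247300001671650342542963753300373955369667974840, 73929094746523019652874)],
  [(638080676879796655242, 6746032096015472687353410405239098746068092436633199065082490995423664238902226349919225723324868707619651717074769992999455899388693975834128601235161357876981429303, 73929094746523019652874),
  (8781371014536400736343757, 1590803655672470851281721612603241938428757034439303057211024938941602378527067699316907731979675178, 81396624660689261234828),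
  (72622330134411417236812, 154972446500771429709215822888352924877526361522408317636834215883345418934338608092447137122721986625981219886537121732134798166000351263998177109768, 50183050902611350937005),
  (1053413802830084695194840239, 34624453732256904236062176819189363077340526290215087437085510752898788865140576584, 81378281149066868641153),
  (8705899196942848720618492, 154352895361169473284705636365343297164572438680091695297855734914944282570757684387216974885593283000435810900527382276574042305936019240574861918981, 81378281149066868641153),
  (1139471490929468358131333414, 1279800390128096389057733509617747927542957726674180002239366601185459739004628464662132882092260617, 66461578989838519541787),
  (9438523941358794356211292, 5705242232214409751875930564217119515302203096561793673938342730751180837543157248559493479518151828096136374327502699172863686756728409450205991266592203873988616094, 66461578989838519541787),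
  (77207761872221828179377, 12046566634601202297992418886721030909250925007447522404654681078594312912550494476957727793243506701369990299282635695097198708257974871358405183789007487691989240297010675354515552770530555833889766, 81379292047716097183485),
  (1051882132589228480391749579, 1591041773210575444786247884732780889452917715454678047551058447592215827980459313876826970354198715, 81379292047716097183485),
  (8693240765200235375138426, 3359290079209793815695447315778101695945124639575749205675492881517814710821452977142493248445547263068235426850500727137769206114672, 73256340915836136590214),
  (1053413802822045187541271111, 154352895361169473386787120312903256322754243595676728921442061644902949107439704507189889281501657672157640213826113360724812493624289053030343776389, 81390503781800510109846),
  (1049928466603943790909093082, 325909030965898290948192044227273565851283993367142718132971686108651837127746420260192468915704525126738217615042113410575481516666721150444938644412181927024339266150318535994518506, 81396615091282433932297),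
  (8705899196876406508604171, 7092730075531327990437808924283096150330396473703605598408939205977712290530770299626690330973112443677438077510855757386385114583944418882681232000535565787805500681, 81384392847478195322173),
  (1051719327090454800869526942, 162592673613975248585324616981636342154283550347167476734075631009830679222353615515732822456697858045864573699511835448300338301726870507019188160818, 73250743475213598358548),
  (1171610594931801281845622772, 36626337659483716060753514028284089253788649710199302870828364450004270644539528002, 73929094746523019652874),
  (141685307042028270773792946209, 325909030965898291170735781644378497258212633722615721173208359868798244737256829640961743998546642154389980953605750195262155534128781676457350251888906106354735231664207455492334959, 81396615091282433932297),
  (1050823896847199563497280411, 1452874980871516002426943819121267721336388478292990812512583942704369957403818040926987884702079041184713850970536182883012987635860783991035508591446353646444099607166430961400707770493700034763101268441355251975863107543466787187231931244163505026, 81390501085293681111017),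
  (8691895265210370255120024, 2701569678843872034081696761568389355808505970604193334835833753741786250648903096084099981111958133634259446980625383066635549759361, 56976810364396333273456),
  (1161103218084756610176304210, 1452874980871516002566528198404692593826195404980209206058061757643812076362553364414881310289285932379591901506935513295822198867810723296259161123029879066131173671185361722532314188896842923395420817974243623374204031370108939162794467243711538662, 81390501085293681111017),
  (8684495015266112095018813, 31618792649819695427833901605037966050134506829164124027711140553733053954143227497886917377584974066972955490079541370444828203019966067825507362055600053464079807268372941464306317834702864437360450685564053506666143474929471361832, 81391018407279222905219),
  (17157265054524921911039736124492, 73107939680684784018238911586364480645668417698663682744291139647275125268166773077143647859906885407463404217992930, 81396615091282433932297),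
  (140492593958012294593960562934, 7092730075531328004180855473668413588222047315731462009865257899200850947029971425546927276145976185882581179757061023575123357542179131959604720002176953589333175666, 81390501085293681111017),
  (1049928466603944326125029897, 154358471673067953031902379318926244009984385476343396590479078481845166236425008207996669707457559439663838292705820458108369851334437491255147138183, 81391018407279222905219),
  (8677094765321853934917602, 688117051910816838294315626628141065546956345014402529558847754867270307735883493121771997088429215567208478311180917476781207098458756323637271639579438290694569927492860421388929724917561925333313289363617599299668, 65788819808982883161429),
  (71949580139478857227611, 688117051910816838294315626628141065546956345014402529558847754867270307735883493121771997088429215567208478311180917476781207098458756323637271639579438290694569927492860421388929724919148234142068560315372650757599, 65788819808982883161429),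
  (142639835681338352992080136846, 7848911895445283532484731276954551729716332932920986501072897317501048890024634116656708079930041847633213909709993483144091438793525833645907069073042134438482089181, 81391004633573011844988),
  (142985471755234874617767297812, 16572017345437365516907056862241924118274911769149165778784064936206807981922117232197505914703200929461801329598361814748500711252456689080764620711259377956750700713527347150238807914634512146891728, 81391013815758507762396),
  (1178870421632697687200922935, 363550888012924577159871621625812046694860547979656631393830798048495897629143809129844680486910287815940663317471499245526219249579398776781846637248727501207395266681393274431335138, 81385404496159053968601),
  (9764134938905038091406733, 364993307356566399595138789521493003065907427981125437705086719311898008799238808364802328726320648403748722973051604052459668908635167730707256893000369445227467748716335539596671653, 81385404496159053968601),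
  (2088534044146581337404427718274919, 25432713221345767428248278321506196737471193856234248666213876064931848967015290617635504514906955639402311488560912452683136874554247271610997141203757622720103840902342738711613335767922359753845433812998967735521837184584587861195, 81385407948715151958754),
  (17261033660778111572595931472648, 25432713221345767428248278321506197069997636020360421407222539641548533846742631856435846749285599327216932452276068144009138957346539425136024761368188016383871971440456620076131746453744187832594849750612399345310545659107447254797, 81385407948715151958754),
  (142653170750232327046246888250, 31886255433370034341378641188661250398272690653780754010256062612074351186423570209341383806663873724784553951291045143780855184719608453595900079516793082083480697406108890047452882278465579660722370626604456134871874270731965607316, 65782708493486185547709)],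
  [(1178951824382085347489643693, 15102108835354934592528543809748995441708299382927011095923157722188506565864212879304033699434363579424221564171395639918237921207277383971277721426489644648530790202677518046077830758082479622403756, 73250228842549497279168),
  (9764134938905858619014170, 15102108835354934592528543809748995441708299382927011095923157722188506565864212879304033699434363579424221564171395639918237921207277383971277721426489717538992032712331062887822651378963370296662647, 73250228842549497279168),
  (7647663454847204302460387, 38303116390608665396791153583947154155930452501947438651132525968084042879258792786, 56976810364396333273456),
  (77207761871106518921534, 366471937995987453359248328363637391334526597149592723824088923984716342741267790703546052355388430818177340356855274047144994390757785859926838476562185715022084890347986200476485728, 81385404496159053968601),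
  (16828403852458613870482903280405, 789052885568013169584621772017435690460988735310260364209331171625851862681850146279948437154059540011912336341316725327346068297367543505541813333021474737903660986694420824327867011813792535362295902218795622264682, 65788819808982883161429),
  (139077717788914164218866489967, 789052885568013171048405783408110743136746433103528692343294956508362938778106443544112723417444959192046521123938444905434390368081805991755801208452683844058250904631675960393086850136631513009992179651609049417592, 73238006215546606015334),
  (1149402626354662514205508170, 15102108835354934592528543809748995441708299382927015898415127181798525712847450474675557552544700417191061494866174278476249518395711670059529280389063952845697609666013072715537080868365278190687425, 73250228842549497279168),
  (9519926690745339335674207, 17172089757888985775704216396886349946971822813154638560998723003640351848975258733564880382882822155126876199077519106418168615275560036817906792261486360092755194493973906218438966559906410165135129, 73250238028187479091096),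
  (77207761871927046528971, 693937821354825625944066080906122952396834065883983159678929206894777287239302515210049119312869484620870349724363187678074646603211079808443095138981265433324220384228913223098080997701678038680843596728383718170404, 65784730282169090226662),
  (638080676627496252305, 15102108835354934592528543809748995441708299382927015898415127181798525712847450474675557552544700417191061494866174278476249518395711670059529280389064171517111260631724727910248279396829782692538968, 73250228842549497279168),
  (945231199710796462330681211, 2700667087582739598800605468879636361824916600899444180311271368573272038000780818927236029363557993814117462597959563115517255514796, 73250238028184670347015),
  (114036211990793015850324806651, 86398870818971848923665147606744976520437424764532930652470015326233944650292669804227307910819757258225793014926926, 56976810364396333274068),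
  (140387910022300783317929080771, 8448234780598437241524775568716446512194497072426153140575350882592167246364103255931444872646832306275105633671410831875897960466057063005606489751889796704106261429, 73917883771080039716718),
  (945244530892433050093547734, 7092542927772307950223645603176619675025054677962103360661237368327837682006405897099384218806598889858537985378382797534871187411278803154975286389340569348775601890, 65117595341056312564818),
  (941581407170025260843448289, 8511284268789478307255904485723844912645172614861466899587580652615363606343259226042902791996906448947305376865372861310604531296950362363996908193510784039167182520, 73917883771080039716718),
  (7810468953586361112543098, 7092542927772307950223645603176619704833231663017310313570160398405601542525892974817043479569563663379230904683450837877021401384731893491482995121708357228982751769, 65117591129285424211812),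
  (826869951274258361481172843, 7092043850922689346519538890179514479292930021753705520102130706323114550718604207601823357909294733756406838000836485461982705824986206007615749701801307011457000998, 56976814958796101271930),
  (6833635960944283979183246, 8568214411751593371003599469562081074159076713032310515799184849999268179412225956738728185875644425342544211102952266455363955955609653928177654157638042033966773706, 56976814958796101271930),
  (77207761836583806777603, 8382179448993161259701712063261373878970758873340013131791890708024784547059636608173580575278407141738585728994720602442164052355800759706246019141480130219727903854, 65788828993476809546227),
  (140385142328821631586578835316, 919644995209789078510399073281624625849074660039627619967881094832, 65788828993476809546227),
  (16972300409942144770666517481523, 325901413545908472054553343698736459888826059723035367560853715797474651043144282239898362492367350012829074749042171016280073955733813660278105033679848366541119998418789788274893441, 73916872980593769193661),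
  (140259685710006900302062497920, 31618053628803705582236879426380838254345284265047745485902955819061664571995458777432122495415992610061479316146860627929212396632644697983664007509433232687068123915290389117591928803044078587385962873316779224821102290334653973986, 73916872980593769193661),
  (12068284143289860979268633741884, 31618053628803705609702618650381091564390681803890468576150705861406731002049964607167740729720283395179710675228978597443706171914626904304462413111342889096269045902942967421112208715864428608720257987725998074072856211851780267023, 73250234575916264376019),
  (942476837413281318743302279, 124082773769328865337320236770443885682154530315885263338162472615477575018660166581664457133976626960319438955705832078478247035193275578078245484187, 56976810364396333274068),
  (12068284143289860979268614254713, 37367049236177299852643865944593543275910937926194225751036411479486252238605171407693548288417402277077767476584945155982281388322130845228714536166651599616243787962399535578081370471555697871337889667043685913240018608176513218152, 65116080134629384807529),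
  (99737885481734388258417984046, 840681602453720704689917391914003405478418080964895062410809432847236565390879396162751258587164934818124272824616431761271694789487144253327803426104091614035072662798496012973756548746524852467813736453850249596104, 48837550912746446243789),
  (817020218598550034226964883, 31618053628803705582236879426380838520587847779924383294945932774190908586922499418215114973183486337331848577352231578842108657585636264338921812122589994840571105497516973073562116032730826908524614296675183583509225501106669514805, 73916872980593769193661),
  (112854229087686492126846283455, 39752746501933649945291409484526028992588790529404974864524152889695903022325492528902511777224238653380905539420719539535816967547661273548963444784170466224055892841433328607374823721616289333316530129472670185051780742478499425303, 65782713087886830939535),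
  (99629538422300504536376153795, 31618053628803705609702618650381092757368888766767719297571137809279269113276964764677449939507234426951371626724224900713158971504671680548612746049050327121771907110181335206464610951577360791550989997454002157112177182370308024022, 73916885408770141008821),
  (826869951274357645321676724, 31618053628803705609702618650381091564390681803890468576150705861408551479060651665661307047061243148560625115528223283751458166926204914331690921634770101115260813862180946178887391999554979865293898946138890132232984723175592534622, 73916885408770141008821),
  (9342139182325924460593921, 31618053628803705609702618650381092884439203171595205524614376810590878527261915305601057356800381165286175956488010348885816948968729677345977320296804780148920640653848678149517653271588261081390737151904095999319203614379517475005, 73916885408770141008821),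
  (71276830144260985547799, 813215863229720451319335043776458845410484019562469386950230834400935834281468328832454967403162207263435125131404110284073165771655984790907398324526753107142018280641824373789765409655803750579307975070078334826710, 73250238791137912419877)],
  [(9342139182325924461070463, 182415446712478759674063206355438584000459908920692633808697943495912121800817794523022503219963178248839061604644194651413753680368943465896089715409, 65782709634160529457337),
  (100051264104197207429763585802, 182415957874838422793295289103465979983071468410586791713164025349098407673246462190762014968224118763459423570264819501265107117506939598485386454965, 65790340743044183917414),
  (100051264104197275083922719902, 813215863229720452244657278415719494412033750929292315979575235424010416777992196614488130891721797997390383091340934639477030486076694728909224903084094601131897292527222638002264194703820043944733381581318546125088, 57650070399330602530606),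
  (1130398841061436859731700739, 17697946552552388341495794515762873204817829804301207438451221229571502740966345480005026489667501901891523490426312082208587493092849441992788039738552715619607690414831084672100707434368776866065391, 65788828993476809546227),
  (9342139182325924461070540, 813215863229720452188497039926291743356269378242706962772804812357054605575420798760404162839185303617788567897270169419104141220374563898272690597019008662610669665746375685904076673903648969654483748548216684902995, 65776597180839173771257),
  (9342139182325924460592568, 813215863229720452184100564331254988732674126814153075933945611720696353814379842959570615106772325404221403136738004178683168433310290181135809089559369941059335710622966039583435340445599284330983093394236220847592, 73238006214405788050652),
  (77207761837404334385062, 17697946552552388340177903980513558873360717383278728585809943957565847833561899475513567141391333351527019133596099879860797765145110828417156448531308978918373335920293877679160461697597941265578710, 73244122122594477380595),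
  (77207761837699116035446, 12046566634601202420996771976248473358502029273472985354772342258828621630466073437398516337196816666044666642243352815368639802333451621002873934387493388386931466139897170283886375085041690512963421, 73929099333738550868274),
  (638080676342184581694, 813215863229720447994930819921956442285442930297667928474367117924963809103507233038291588364370443646792710932192186406331339701386232679503401315046281211545738782515308981155825787745824338744461145889299242681615, 65776597180839173771257),
  (823384615060399509362870911, 813215863229720452783119021011000706647394032573241710009148619144672638044503593489002584444714315480016343590877711431980058696649195876365022034106176223562482057796655496169797294010279146107250430210927930910063, 73238006214405788050652),
  (6833635961009865635147960, 813215863229720452783669143108280367965470828465649831142065602643401249809689886606090834747803134823645166463212609227719573358261448930517576668294862602241433820627820850047981682519502673437969322479422834007786, 65788824781708519619337),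
  (56476330256279881282203, 17697946552552388353226263145130735847653522504720987373662895065915703890899060785451851645183732048337078029031338395033297405701889533435740016861271176986216545510435500016401875320024889089668436, 73250228842549497279168),
  (466746531043635382497, 17697946552552388353226263145130735847653522504720987373662895065915703890899060785451851645183732048337078029031338395033297405701889533435740016861271249876662826270042869405379498324810634711241077, 73250228842549497279168),
  (5273394023780169574, 17697946552552388353226263145130735847653522504720987373662895065915703890899060785451851645183732048337078029031338395033297405701889533435740016861271322767161473123141187761013483702745159204066778, 73250228842549497279168),
  (7804538021894580581093150, 2135544704461994768935654932017209824332098901169375077549955882725535485205149523481273678581468074, 81390503781802811221175),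
  (64549330195477675235645, 2135544704461994768935654932017209824332098901169375077549955882725537074476631030077767236162485055, 81390503781802811221175),
  (638080676884474361550, 9519831007211467477832709201757904903817937785381545875143050731263174873777379882767596202005359813910179251589887512730167091669651377817086373605332533705074066630, 81384897910165937683211),
  (9342139186438418575495325, 2134694620679150593576629859897783395790088723014927229370727093993232628968138711366811790716998959, 50183050902611994979953),
  (77207761871391889053658, 98127702281610705776356808949290715585780382100335510041026807726986958077206971404763302542248963778925251484172474, 81379292047716097183485),
  (638080676627554713818, 437445023087680543793655635788875389704648558877787425415597467770513337344969526009365840931243966544516942659734019008223231082906414642741301594710442570619479965317871156088420672, 81379292047716097183485),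
  (7729066204265958962537799, 46475674847329258614215317069591579303861607789704761128781338221613201448153440789, 81390503781802810577094),
  (63876580200545115392841, 207184639850835076240265446962659785290932467346343478057520949996212924347940300098514624949319117066240101742805003230773216127279173937356049686698, 81390503781802810577094),
  (638080676884474527947, 42439706072926303949789317527222616247677253376016934917010845155624894726646400758567772753351737396470082535660832998967466455729884621072159653228482474452433115020647833519526669985192063705261026091269343863453678321095646173876, 81390503781802810577094),
  (5273394023838631087, 42439706072926303967873389365482734327590509157066402337381397722208802027295590651105733537405445732681503832885641508818596568717628945937773520766819176882781110001333239279276621614826112092927854772909205539906202106241103656107, 81391009223952909022520),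
  (9684201507736141591702278, 4507247152733587177207872417841583559607341900824000317183758695947287890025567271603792944769841844769716129287583102685019922650920, 48837550912746446243789),
  (80022580078914900348802, 213979879893355310355955415441491763552774613029413325017828513060963109487119460381201887708968585768948614577183362103231394302323466765271802354311, 50183050902611994979953),
  (79917964940847585384361, 451933840753718868201776107524508592066141437220079474448818514522772856858187385583946020373574501721420455886514864723297533512513614863703340115185627977274442987144304034618260406, 81391018407279222905219),
  (661343637015825622706, 44238205898639553114560259464882419289337632161438345942732336656661915563372413114748543226578200743855862855169391772104465852869682823870487805868975026037755293431790926376676963287219148384349929982951680488740230318599657819327, 50183050902611994979953),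
  (1171789179004265638646329611, 4656792004962848425389614142682678879735609882614925534918177110079731987682964906785067547058586874511971501001336790479793535792284, 73250228843119691903838),
  (9684208090944344121044024, 207106793215595413908899280811002051191873684395693960056019638478574709271827019614445088321532859953208795584663211598686588143653734332907332364438, 48837550914171718575327),
  (80034777611110281992066, 213961826185067896028510734920337756036714414562335841059733695972195179955829769830155898967026861220684918563616027921375627840847767539019799864271, 81374188170552055936256),
  (661398043695185369310, 43845371081076490960378640685289464207013935682744504719200396114966482588548170425615249182413128687573687033668208191665867559424158913715760047678601590648130632339508690414226134287426897670590875218688491502777850821508066761986, 81379293566144808175227)],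
  [(5465649892692771035, 43845054323786270459604393863905757710625518755303745646170617997984935791497324789229662887679117271414964493547677376976078257511820446774572278984068027260564213134190033399165987791736363006107488652509379952297816642097166119524, 81391009223952909022520),
  (532555001157729029866, 9516477380245407734425419086789967161414614162388469937605281312980251882564582860820793920101402121960208110660076484372332426313868663768265278495514207034819636614, 48837550914171734387607),
  (527905621492011743729, 42439706072926304007912448137869627207547540326808935433808282657047102392819762793659676815132122908944274568360192624726476533391221889342298481347560578962938806518372945205668225825985628970934431931293130389170067861180512509269, 81396619682802505999451),
  (4362856375967039171, 42439706072926304007912448137869627207547540326808935433808282657047102392819762793659676815132122908944274568360192624726476533391221889342171051171135701032333627263224384927865017472229736882839293409087928569580530060904318303390, 81396619682802505999451),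
  (44031410769438423, 45109079090301880268967959026173005402346171418622851870235534133674392373004409863503111351469940374985758853030043337184904296459830535196176891191647034977860604132988979820740430176773655484272344205059629179265348877050784609848, 65117591129285424211812),
  (124874403270407564639043677554, 0, 58321304053181329871914),
  (925367278044586620811790013, 515358392301930768618098544410399, 58321304053181329871914),
  (12094299100109827695326835194955, 23665186632713930439276046444006689454069447140585, 56976810362399151710948),
  (99952885124874743717056024086, 23883976559638045406408239589313795512960739169298, 56976810362399151710948),
  (1032019861738905492865004923, 521410557884393331865768517023047, 56975799469768711476461),
  (16853432023249501924578828792870, 0, 81396628879366766292493),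
  (15134611622366483921217048507024, 24102647984507774171533948796495880650171139484972, 56976810362399151710948),
  (125079434895590776208405359474, 24124936836283014181819890977658544435725610374099, 81396628879366766292493),
  (16828307167954517516996863183200, 515503970373506900767240985095876, 73250228843690315244818),
  (99954579600606368626439749804, 529787843358734293744152787415645, 73250228843690315244818),
  (1033714337470530402248730641, 530928413667422281554484745601132, 73250238028202266941295),
  (13824709986328400914493850178034, 11585429771902121, 81385407949856398641692),
  (114256391445886959876566555992, 534087922267573764480916937487670, 78558848221810132196262),
  (944267697899892230384844885, 535477581651872757466173725912520, 58321304053181329871914),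
  (1033714337478470342853620264, 24694205489856752892948937839821686316312000400585, 81385407949856398641692),
  (8543093698169176387219990, 52138794161669485547143103373398628928478823953877891610369761136231521596625024921, 58321304053181329871914),
  (15278821558472962683569611425333, 0, 56976810362399793368504),
  (2058130234898973720244684681102830, 24853189431750633473114246044222635032753420038320, 57648576463485285738769),
  (17009340784289039010286650253032, 1088129068670983351987185394876011278503935705203155574625567388369, 50210850489177741266310),
  (136778259828628627878550755555, 1142070088239571941604269661310837037233483915509120262134652217243, 56976816476372971491654),
  (126271252487686427929443405220, 542425878573367720891254906943508, 56976816476372971491654),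
  (126073562153626422635056490613, 11767676995923299, 48837550914171734387607),
  (1845843023491250047552888178497259, 50010228302576449008496843223312675614225178768390550828846108021848452044396666192, 48835531024806889667832),
  (15254901020588321381371990743066, 25190583685936859725034567228460416337682552659294, 73911261655510697017568),
  (126076070656835621505107305183, 25416483956504390243140108774753087952918267967455, 56975805582315544186350),
  (1848737408575167325621474568243909, 2298142296277103632375534684561359090853659879775981677309662691607556534331121388442577987862294103, 81372166383864617114227),
  (1672972037102681152499627468742657, 548742531837828493704943021146133, 48837047364465829196090)],
  [(114373870597229329513416919490, 2411246132615878620196899455296677114260026009840248915845945645917790612898672036218541885426767657, 56976816476372971491654),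
  (1674547839385049787392357724155940, 1178758870459535884893871414001065564285538969226289191603428245436, 48837047364465829196090),
  (13826215182604608214480170199144, 25800815597753115437234799673639822335291916527341, 73916867522553624103448),
  (16854623840840101706899482093879, 53831686979971012517763022061894565921860306051418209407056107839009042801964596069, 48837047364465829196090),
  (139290926571567594647026421383, 1141969664253507886122481302823924504133472269880201680209303712165, 50210850489177741266310),
  (2039358455934264576995634521766996, 115286405675934985879189800898046269221461541060777245397393654069876275007144730591603312416463162609936859789873942, 57648549463274713132607),
  (1844242412382171113342658807065403, 2508968083560623309368648754438103975854744611788887408977815409024865122577435288686610834565024248, 57648575082579393722161),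
  (15227792743441328042813286326080, 54602455575036421923793026505126565380429548186508967990213416162824792464855346241, 56975825087647905507365),
  (15278821558472457236541112131562, 1188308521881516727126997700980787273193736046981177698919267404995, 57648549463274713132607),
  (126271252487180980900944111449, 2508968083560623308109472336756989803183902140206871265007041463750310244589464700714326735570978414, 57648575082579393722161),
  (15242094555285610271750922791679, 105599017701982330069548824915440667194156031966974338902875388765681888818623987829981926685562726484845069171114890, 81390513726364433737115),
  (126271252486190558529059144967, 25496000847797229936649112030012688546938380664457, 57770872239144527160890),
  (125967723597401737783065474932, 2557066876177843880446809247943493484858122363811272465986298929251844799096307687703200322981013062, 56971709943810852939210),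
  (1043564070133806268835195529, 53831686979971012644759545899715133622943406724270710054299335846727565156302702875, 65788828993479403448274),
  (136778259646638008060111498752, 10238874988002418078227630270053646107365438044322188653797684935772896723566460575497556697410134426596375262997284787447785784852654310537711149783051885880951501877, 57650070399333194164508),
  (138189428902084562400196922541, 1225125446546354760201380057614310179000529732191934218581660472657, 56975805582315544186350),
  (16550169431802654938595631189754, 222892834899542802169832202484695091404699591976184657595638373908673640440158602938093418648310461263743286745384749417779097974326268463635417123536, 73256353940684160289601),
  (136778259766964090401616785328, 105505239256757581848104161854253680925253857956169982485091825970583505078948613648498069085919743806274895787621323, 56975805582311878651313),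
  (1674243384975952668185134698998731, 2587340480107997203579578379014684705616118222418127757094766741426394467996657851716964449441325928, 81379810784562213537646),
  (1464850557749315780362429053953119, 251022285889963630837595456612660683297285084810658687572846063026822278788082805490148593750053512098161873735378199255162737365494055812725721182187, 72449053946764018270730),
  (16550169431743972922048342387636, 251022285889963630837595456612660683297285084810658878039393675175600384007127054384956274966982074853081113461600478616590115228300314029588134196564, 56975799469769353134017),
  (15567241423161897157089589617506, 586265699149743488784798449071897, 57648575082576799981529),
  (2036238277316687593568273894198698, 2297510046948362361087588622958348384355566635786041071017221403409214445077474261341098004388820271, 48837550914171718575327),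
  (246384660803838928903653798542142904, 541603250300195719002558497935684706895612736697783188534945518266354909997723075193583829003534026067523316681960454757921268070367948585940877716380299274505251691061181217345165535, 65804902212439023517302),
  (1464850557749315780362429053792068, 11786864730396722739304474562552479311344334273852970934746577942348317398010545721382414729665459293583445427445726201885786672255911487815703872751095096248695499363, 73244117529048051165306),
  (12106202956605915540185364079562, 256516518495162366033554671912921893950454737012281331291002873404382927634963720288861106860760639015382295192324908307190706677260580526458751591202, 73244117529048051164096),
  (136778259766479115058250760839, 5462976314230044089981918004277258671653573881177182199634418367517632423362748336646573638280107902351311756188732277178397817922834, 56975805582311878651313),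
  (114353075948463349104457335414, 56309339084473903304498072801348118202455177161837114705527483489896755685222945415, 73244117528762310776691),
  (1130398840054859570744723119, 251022285889963630971973450792283827102609584579126652881296183770313686489885982076888939501224504095089701997666085747296967689888611226557509574954, 56976810362399793368504),
  (2002570611378940643962046215389673, 26669477357653884421094206519508845176904641962943, 56975799469769353134017),
  (16550169417243198975273530807840, 2587398919727861602074781151014658561280373307090293776874915235783770362400752697618756177186343979, 56975799470339976475239),
  (17009340791749457622621339449447, 1225427601756520514797856127919905312465405080562727443181012791190, 48837550914171734387607)],
  [(2058445196307768887444360298839999, 2693484526622124797134054774760261762856941016625858359616171539510493205087122851126378817434045081, 56971709943810852939210),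
  (2058130234884053379249170221478480, 118890281410793670978300911803137132378375000597416345249137797047640073642243250032561714273706696156028147015435666, 58321299460205096492552),
  (17009340784107048390468211318331, 251022285889963630764174973107724260734102543537685614900061351147998568681684612430655169949937366905950373379588343975038693111628839040573706906330, 58321299460205096492552),
  (16865130848059231172980259645282, 123764886389998173242624043240062940843695371873523608284499328326515497003801401873288581167464828878296394036974869, 73250228843119691903838),
  (16865130848000549156430535254250, 251022285889963630764174973107724260734102376792276303050592123316119094195759497237942333906122927288331635324532656553710518028755686993494978318216, 58321299460205096492552),
  (136778259646638008060111820854, 265492132175982392591831533605381223836832333544878836717105627106697478902960803304114744673949539098683710618126728571700294327438140072195513400537, 73251754369269524829584),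
  (128654887794726422785864376971, 515050820851955505062255220150031, 56977315810854207938203),
  (136778259766964090401636915493, 127016457624097686442997302512566021747753588640589843048308610035576588287079581347583557294158434394470140290655936, 56975799487302409087166),
  (16986915600409864153884442281316, 58633314525005252528037455012958718017186384325838272477574354307706338877545412471, 73916867522553624103448),
  (1674243384975952668185134699000062, 60478612190881621576104111409587456066601773012532104774206368847613161563860882336, 56975805582331075461637),
  (16550169431743972922048342388967, 251022285889963631181005886182808717466447695330076046260830623193731284960648296216886869198563053541261144705536152170851809510368230698119895620406, 56975799469769353134017),
  (136778259766479115058250763501, 268179713278135704397534571549897582438131755644681786498061563304268323618562543264416380834663002735024299729940447427751969459815950035830523059961, 65782708492914489445777),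
  (113161258295175603505383357307, 2778917445817156342894185490009970703218343411464650864464095957172765883467697747575042530299555951, 73256350858090850577326),
  (136778259705320024609836217210, 268179712926073169845252536898868869791464892318298115469385996164277490447639429058082313538865002542895392790734359878820651998714286580140503245672, 73244117529047622446334),
  (100051264103190697794935744944, 5462976314230044089981918004277258798767639869647151648224044709199472046689064123851685466515923531996542219040728046431859204169442, 58321299458207271722237),
  (1130398840054859570744725781, 5462976314230044089981918004277258820157868904948294931433754768826238271072879984247901055756092859430122287159658046892184324976614, 56975805582311878651313),
  (1130398840539834914130877773, 268179712926073169845252536898868869791464892318298115469385996164277490447639429058306195575599100685976359567338233642300717147206522614154687824768, 48837550914171717478100),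
  (9342139174007103890452224, 251022285889963630764174973107724246737529369796599138040198460142463246808198199466082916068288632632059121214064033562141936579639238402093268836088, 73244117528762310775723),
  (126076070656856093190220926243, 637053816403589446697886363087225, 48837047364465829196090),
  (126073562153622659942620693208, 1345061205432020153626957514309139489183456630859573928780550758018, 56971709943810852939210),
  (114263711271147657753359682308, 1087104905046624517578681534939239011863951707671944719033548751494, 57770872239144527160890),
  (13825909063808866622960043837331, 1345061205432020153626957514309139487334947449858085761895902700589, 48835531023380331124444),
  (1043564070146338013343442482, 1345061205432020159392040760353624658615900751965328002830392708867, 57648575082579393722161),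
  (125965133691439389380817749636, 2869621371475496019230390220854464683397735638539102376053282495385423672936221208278931513217488791, 57648575082579393722161),
  (1040974164171457866587470233, 62743857847336232200804891704195335284481809031164274269240148215788630084803484464, 56975805582315544186350),
  (114353075949474243163834000812, 29300869005985646901337006308317078487873458817258, 50209012499983198379870),
  (1669604179757200561394718206923321, 1345386431989078124637988196019401640811883692152268992855882756943, 50210850489177741266310),
  (13798381650885955052848910798334, 2842689258453624327540831375452993649734719439545278261944116912652237033535787008286454523867049005, 73256349339091517693820),
  (114039697327007075243708266783, 2842689258453624327540831375452993649734719439545278383629056618361450183112405163908941789041475278, 73256349345707738698697),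
  (100051264104694921691659315780, 62619212021964820182849935637257503683213724808959938874572747559453394671185440814, 73244117528192116153231),
  (1130398841559083467468296617, 1362776499620029825332921995906733564020748870248874811437216659043, 73256353940675952132857),
  (16841210317759821310282766279259, 2297451422604753936359767906368669565817796377672474108844216074450532023109284432901134916512569939, 56971709943810852939210)],
  [(112857729405910161912342845863, 64017025114102692164208817056997610261531771143261372758731860075676805490789910671, 57650577365361029576230),
  (113161258295685227782052066729, 130620803695429725348656677651459583090193346114263216577188324142486070341669358240884457732835364365330077382658359, 73923493473596926960207),
  (935217010708277043132196580, 49999236762132046687225983182312369391426155166502571894236910267867279137567296895, 56975805582315544186350),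
  (99737885481734423934186673651, 6000488287886076676407220870581595250169487627520406827513193912259823658836091376451883988641654041351935644007632222235162098875380, 57648555577247032401146),
  (817020218598585709995654488, 6000488287886076676407220870581595250169487627520406827513193912260087672097722835158656205637869771571588563294463696692700695369589, 56975805582315544186350),
  (112847879673230177053078718371, 61849715290704661396184378314674766627181844724733901230336773321668908248203260475, 56975805582314486550766),
  (817020218594408461826238837, 6000488287886076678356858486671187789469571596806856428010174996134994348196439690972091037852540651672688700767155482701267435056314, 56976816476371470979487),
  (942476837413381755640351823, 62619211990398675860675378914208356018430430953079550440853050031708358421046821175, 73244117528762310776691),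
  (932627104737574144545639982, 61849715290704661623964324840704719119322880289709162317154255353289737225708354320, 73250228842548854203493),
  (6752233211658701642726928, 6000488287886076679981556805779098476581685208146112905887561514543803426195041267794183373587284621006775728205589094900328996595160, 56976816476371470979487),
  (945066743384084654226908421, 52459311874235737871195343772117355229637692816042167819230012013226161180116910651, 48835531023380331124444),
  (826869951274393321090366329, 6372403151188390079120870042775865907399331506893636988835426001328192327055210099868584459373146108708594330368580905874187049056107, 57648555577247032401146),
  (9342139182361600229283526, 6372403151188390079120870042775866521404102667751282479365290858290501652004166546916282231466413030868397456913150352822612000225924, 56975805582315544186350),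
  (932708507486960984306753303, 66004997469052338569189977021507886991899754703411350394507909091164065614160820771, 73250228842548854203493),
  (6833635961045541403840249, 6417195808253024616760061088486775191681849929104009441034445406664575417645853817403484810183665538682597980657486979005131762581348, 57648555577247032401146),
  (77207761937841231434606, 139949592173946908905062384939857187922070896847429005613669625244094465884403946452057703992075627223484085916227339, 56975804064741696412036),
  (77207765700531230849689, 2298211366009140427017922711866192330830149797493632479012919297251494564357954527441385937681346572, 48838058258522826335023),
  (1161760862765653337524421942, 296993698076348008850498631603422865955256139693115206381547861390328543492601659276683811247230205254778278673190833814908436569588570318231490504505, 81396628869578282994230),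
  (15412524479838290245082697116897, 31632653525102690197480313135924671670236658165591, 56975825087647905507365),
  (126271252549371437089034324311, 3054780296933928880120027672764245280180149779385754232837508193374608345173158999916637657294468539, 65788830512478735511883),
  (1130398903223620944362003973, 140661682512000260131755281891345271948537611762987648408587869087890401071677591551930917870920448758407681156894715, 56977821257882708519776),
  (126271252549371437089092946996, 66788383835422848751858183192176850689678463428154125372299681853658714826636778753, 58994054048112818086710),
  (1043564070655962289992019198, 6479624248674995415139504169620325218408595781519442708320965838183903372700101691585131536142242896590366672829342964144238970907248, 56977825851429135234191),
  (127376235370062697852344969909, 66451821077834458055912702341506108120606894769953280750750833553319610887690477666, 57648549463274728944887),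
  (1052696160083162792167655751, 2296107215908773117584301653366824497998255250308525456150837156113836965873596923415040828798251958, 56975799470339334685914),
  (2058434689300550768872334083823915, 3053480928527244530639764993497727795477877277642549695508470806650126821322363650977953825617792904, 57648549465271894695115),
  (17011856936368188172498628791878, 143260753862976602626914314162813681345402658080693683703944215764100993516183282413216585693219552722426226118083471, 73250228841711198962347),
  (140593858978249589170950307198, 67851789658858812792311750612543193005383665937574189441968329511545847654478922580, 56971939691033612446960),
  (16854316826615107282513848803795, 105602642592095663287441050390052660791497097752068489827191063495983049098647810178835033822889830793201195146515079, 50181030255742965699923),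
  (114266241178562767485283509538, 696297880399002402915811142204864, 48837047364465829196090),
  (16854320311951333357836224610042, 3139629180609625320354229340362035244990891828777713227455258126538882553810127524599419226102586206, 57648549465271894695115),
  (16854319512905837048225965543388, 6628942958258579723788751555862332373780621758941324576124482524573039021096051563146265002496347444092823491107714599888944652954651, 48857906643074737623415)],
  [(139291903404556474031703851124, 222967059314082356681758003229762574153673273695583251770074839037936465697931211608233911821978079068118154128715084489600121514613267733647409988640, 56971709944381476280432),
  (1151193486841238903114774161, 4852412842819458455217547250557746920986439546753962499500699581150033544921192027258834593070035858442014641667149525038562904721351, 56975799470339334685914),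
  (15278821550951375762618165176548, 3061821057822809602499987469066024431659145280065924314347353891240649870349206408030576919014908134, 58994051351889000291241),
  (126271252487201452583621190478, 4852412842819458451614117041882496772638345857223730828509156614711515734010553977242398744588713331147863822069401957379741044820707, 73246139317162048339180),
  (15227792743441348514496002540667, 3053970124973174808020783483998047966019157130807793205703262447829447944979444849870994956321508327, 48859285134970645666705),
  (1848737407665116467277370833662135, 3182054616566041296603320853113263031824767724324577146632943235991374403342930555603417068762103175, 58994051351889000291241),
  (15278821550951375762622899450378, 222966122127823488804841672002926557338202410314291703566886163151515485576875236714762609056011778235562877216501705442972889808413122360798158433322, 81396620068828553258519),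
  (126271252487201452583621194471, 222967059314082356635607985026659679232448776073997766005888596642332504188887336761750777564172370941610474324719791256646913291019089681919241027244, 79298872076986447455322),
  (1043564070142160765153894125, 222967059314082356635607985026659679232448776073997766005888596642332504188887336761316249593173709923105527860671195846553031917879958731928716292494, 79298872076986447455322),
  (114262755842336692162907703291, 50015988433346696878069778753906906776637039125362925658667276544163059323196485035, 73916867522553624103448),
  (15241672829604732231354469819632, 222967059314082356635607985026659681775571338532326634015782244709090643848287959548248830328956089512451542111965983991272210842113140234691143917411, 57648549465271894695115),
  (126271252488667632132986350228, 222967059314082356606609978936474705474398367784914980424841150366172021127835464918385434773112636998905078131417888659352014862808452744012211954695, 48835529124631178011142),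
  (15241781176664166115076511649883, 222967059314082356904363965723999449390452429862822118207472969317731145289936058044999055359602655459327777085970682486977389631724999215655029254721, 73250233436666761195770),
  (125967723597422209465742553961, 222967059314082356635607985026659682715479360560220057242852380954435473750167390449479239758906698522690766460515707026144112538074802006625974095970, 48836540020685343519340),
  (1041055566920844706328450848, 222967059314082356635607985026659679232448776073997891366657123202362732331184298905312021564570065882538402972400063606270871416820398985063630888891, 79298872076986447455322),
  (8624496447556016128200605, 4852412842819458454213188392733655169529497853939206453222881209568447398172047644181017145652552438429571117742921158688056570211791, 73922988023118535835622),
  (16865130848120895710454737431911, 150734365197098700280114490953806394040659117987047856093181224180899223949158245649385218303906038133144456910595653, 58321304053181329871914),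
  (16550169431805132012201993986712, 319005613769326941408662219874022381755344062159702216860079912766343154336155802115602290052121559955648356767633046255993266461586024205325376890183, 73250238028185975827634),
  (136778259766984562084313998515, 150734365197098700288431137958315850546782240982408663798201808097913357024124286789419321431744517905227365778755446, 73250239550637579425429),
  (142956699639514098749563759354, 13615286959140391626874133974969450492953277163663801393545082265695914660913123583247582267321470390447865981957924563673538005186304732664314405050062811755832526740, 65788819808983527042721),
  (136778259707797098213763422592, 321075164970094030410578527751676287624672959810394641481383926945130607880270753402976416909928999567573050287543569528135315262502341297997362606326, 56998181581758697701514),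
  (1130398840560306596807960795, 321075164970094030410578527751676287624672959810394641481383926945130607880270753402511442841392106558226717084476727622357488512403771561975768617240, 56998181581758697701514),
  (1130398842531933174671931163, 105505463038353825231667949314791074618819123544569964568614418930471376913897897791355596635158434431328002749785019, 56975804063315138059107),
  (935217010720394229470448300, 71390202582079883306455096796946946949256669831741291525361343801130619046610859693, 81379798356385841722486),
  (16972613788564611974257597771206, 318257173462398170553204191445869646282068128499361629757947113002762353704234712769699586053086372659703467160977349076651397124922162149071164883796, 73250238791137912258947),
  (100051264104201591849498273729, 14910419746604951333539975612557535108464923500484461851977062061410002444216612622581010456456277355556860848473408672808921057952003904269423832228291631026909388924, 73251749777751401641559),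
  (826869951286510507428618049, 318257173462398171032232738434059700466161544757383491181105950219813296905956857142610244539702620045921271987386984446625795744875806392996450057064, 73250233436665903760246),
  (9342139194478786567535246, 318257173462398171032232738434059700799157529704408585151889195897940599097777043629383398970704610417988234935847634346605343122806604305390675450268, 73250233436665903760246),
  (7810468953687618517067395, 71391474398476582672265940067668122590169951973310597397259846887318167671004233668, 58321304053181329871914),
  (77207761937841211301900, 318257173462398171225100327876438920211102806602102931028926165637436307256217203616316149362720802442887770498087787484092638671634667767016338254354, 73250743475214475120195),
  (2056966369951163430314643154644952, 296240412059500071069709713268419093224734595429127222647661892220565388848806777616506679843965440366688752174068512477845097150261718578100885523036, 56969688154271155330721),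
  (1861742843466088164879599653545337, 222967059334739955978324640573940522882297294928286957921146035950302578729861271668593459025269250794050609209860480818677330556424359882484768652540, 73251754369271473707737)],
  [(1053413802830085562608099115, 4847579351981429621994915265749391883135143869181353888211893087333227805468564675248150503373048831442598030066756703172480193146127, 56975799468342152992248),
  (15386304491392614952814700903944, 10245276321906117375524642952714100409967827845075484393890650080811362918666503134309737619125071182271398022844952611408284594209342437808491295857942130067998990494, 73238006215546606015334),
  (127159541251178635973675214071, 4847577337665631460619566125458590067074979972999239885859953436812459276919871596041209399658982731687318660821036208808975967062150, 56969690053019464522752),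
  (9602126008385765304787623, 3379363385813601301849769456166824855390327398518085187448051246287330360608011107265405691075997552, 73238006215546606015334),
  (17000025594600879108905720662338, 10245276321906117375524642952714100451058619453720594566599209634895345784820905124599824113100535099454838641782487711422356640080370080373981254841540912173907228724, 73244117527639344025985),
  (127463070140468726497621164861, 222967063186770237369026802320472946934313913341391114186048423935357052224920801180289427550633952367257986114336030228393094714521975964829538772957, 73251754369271473707737),
  (1053413802813791128079513748, 7207052143503331228243895484558036464112618455458739943816971291753902813710326343656383710190277899100817733291336267592544099737311, 56969690053019464522752),
  (8705899196942855889637359, 7266775662761966565968390898977724141893178182067857176716081808612304619727599847826759838319611051631313781406410227005205663232242, 56969690053019464522752),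
  (77207757760593042209682, 73544793317548514799523181565916426640213052530525032793078323555273618145164775448, 73250743475214475120195),
  (7729066204300778756277507, 158532916495184116731013755336448094528947371495494657594920943781416865010871613898489364248466953958498159803369206, 73250233433499160363979),
  (77207761937841211625333, 334722860566893654235287041011544443638703258500034384608648635154961212911971728328259922392928202777909358260437967374917590258283548299417377577655, 58321304053181329871914),
  (8617892765768333399271315, 140359982017415976726395661962008743843854890297311691975207820245034726433617794369396290452369420734337860931046740, 48837780661394477951308),
  (99954579601115892761052306846, 297059761487717836958254601526449862667993739359516563294015063100347738136968097103473210096861030348710608804629526650734539155273560993758648028949, 48837780661394477951308),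
  (826070905790100755192150413, 297059761487717836958254601526449862667993739359517753916221853534303178226532787118608054528719101022568903746071752281950816180465035544233216464403, 48837780661394477951308),
  (8543093698069034331067610, 297059761487717836958377989635139900080241642377310176908218330324907755869026902441915843297490908182337544150233063730440098348561684035679537710088, 73922988019952221156149),
  (1151179917606348263706434670, 34840914227520721449000557133614577442010903139436, 57648549463274727773607),
  (7804538021894868348147306, 49952176720256661133381733022723549114161413774990257558916346999973417654568923478, 48857906643074722557826),
  (139290926571563731812534471598, 336786553853061999160161430725117536738936497686087783389729400537642262811962300689135580685881513404372054233338722617974583969418412621525315696250, 73250238784519328313430),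
  (16998526762721610661875462413986, 3456554421427480403689450392273262850176771552098139498862558518746981249482494227994938226165579840, 57650577365361029576230),
  (16998526762721606416409488848202, 341640263403659562380614950647351398055625561195000396872415278804208021905747607178947297339129283908722509275427734819877531082410700736248945947085, 48865350499312621247908),
  (125964238261196034001389350725, 336853571491364277436172961335175099226657008075082802363754452872628129509852092524417488473885779819108911704975408387256618705461899932923892647001, 73250239544018995479912),
  (1040078733928102487159071322, 336853571491364274821887903531435306764083279820837849133902559512332872120101663145506707834582982148206805038986848128669372913600334274922542187918, 73250239544018995479912),
  (1041055566920744564292431174, 222967059314082357441629158563205495215424420282458961216466656729925795503458045076673199635440348856573377116683784810312556822684066991059485060890, 48863512510118078361468),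
  (8624496447455874092180931, 4850787642016939457310943997092462799101753094091277294542995458283058357080253606578447451733347164554260491411134208340294780251265, 56975805582311878973051),
  (1130398903223451756901696437, 3563225847407064535698881779685981954802775746779964690912012940450380058893011327397319854786240332, 48859285134970629722656),
  (826869951274224133609926087, 345694315066190401635252746256985036246354497970619296642561079443021200119529917046130713502652576222067620242530725889060052496519343263534652550583, 48865350499312621247908),
  (6833635960945399347687869, 7523315503542242318969180192003632279083861698716472122999118976601525142285016893164192530112783521456618294096502022207319786041079, 48837550912745160090503),
  (77207761837699175282226, 4850787642016939457694963560378145047555187221807639827309078501195722654826533021073418441024723073638597284160212731213271101381132, 56975805582311878973051),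
  (56476330256574722179389, 7579954162246050425033880034802829549772054214629084143669967683773613379812729021900184441512315258957521273959132766742302550458097, 56969690053019464522752),
  (638080677172241415706, 165294883350801932962818056908564923369951679134838838767355187806850135020911037185181605339906333962616770574801206, 56975801367091319619434),
  (1043653674325372453916130008, 165651307645373338740544413997504884640286243488860016722777291971954844755593047410911262745775151198849120965846417, 73916872980593769193661),
  (126282094593370066923834651719, 3606415226325698909280279416696192055789810928103035830996601019683719358216111018774088118373926505, 81396628879364193985437)],
  [(1042743496658095689009936306, 165613962340961212547596350479983891760825051555649648522382476611635934225786779979655724816630701448210216510280209, 48837780661394477951308),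
  (16854524566431542462773828560187, 165649073835695823082904710543420838007325457991120593172037711728654945520964004564922678161015010163038293902836072, 65782708493486185547709),
  (16854527156337521105617755711063, 2296808987241219806762453124313638021255992886163902072148733029603107850505871775412787076232648093, 48835554362160298482035),
  (16854524566431542462773828236754, 7611326998997054307833263608317227064865722241826623683976516065449009020173197792043071115551182486971542201408853371689388045287253, 48857906643074738501875),
  (139293591458111921179948993680, 165644651700795547248710160000529891948474068851028640452161135152155218818653743155675093872224504539702909485385154, 48835530816244057001732),
  (1042743620476291854573593404, 167983020293801708146898119361895471462823512037251818828778976944492521710180465304288136815074619713340953018716423, 81378281153503475834539),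
  (126174567984115818826829485029, 168216654573562926041066205614074765884493480106394858039368252770348285725009866271862111015988790899496694950171915, 56969688913771620181834),
  (126174567984115818826829808462, 7748636178354664410396320695107564837211705956464115209341008980477557391625893695490750831343509427366723584036538527852807173291698, 48857906643074738501875),
  (1042765024662114205180408955, 3660884516035447637937005816040156471250501286088023119508378301738758206679767328830985116520505177, 48836540018688161825063),
  (8617892765768045710165842, 3684086484693547227614438428127697126306779448333391410793268984253512677362616350620476530883607848, 79971622831418672844677),
  (17301458776502291459035570123081, 7790668895449939193654941176966894827438060779187007402100512634519945103753332644624162525271488552612243444624358772254201070731659, 81379292043978516086147),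
  (140472894492660295919820863044, 349879273480154315040150251301536871917985948405234640790024231825074307842953056696546017462770031047229643456275146153575248626060942188962413508905, 65788819808983527042721),
  (16997641959294795634806338194497, 16487178021531317120695167248083050932583534003630382319962605811284543866178583578606598006661501914669325834572574472602625895765468207404035520271651606529916706414, 48838058259664073016617),
  (140476379828882608552118497442, 16073952927177197751895827819868239934340445419348521153978143933160377878440303955049215012218225984741661406619090711871201757999094052268890159204181937550098539548, 73256353940680492965622),
  (1160961816767624864067094932, 16073952927177197751895827819868239934340445419348521153978143933160377878440303955049215107272128130600493794864708493683557818119918053662248402295246504492160740994, 73250238031638245253505),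
  (124766056210969468856053104392, 3726665049157689601024687910054269766380546311408785999320784654959670655330019899988840763018421004, 48838058259664073016617),
  (124657709151535585134011274141, 171235102050018219332162232538352048556675948367390211195657833915336918675405730713992028746149456097740788131596561, 59011744690943333826251),
  (1033714337474258284282957750, 738600288550980854950475376465673618346807384037872664901208271021096544852777275427233985416255499553027089911899854397484070204692376134792254145627931873725187431182767871354160872, 58995202788192447848291),
  (8543093698134365985809535, 16612755927763059937434672531321822568731762218599668665205159092142078936326444726262286217843748409011812764946485421972026385453841898275063231739103790813949041681, 65117596478879248168675),
  (826049501608520984409010495, 349821451593155172289985384030866339884963918304071103683908514707096261818031698378695327996247528197327681883080440698080509393290144103993011179674, 73250234572462920724359),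
  (826049501608524410489932902, 10241844732883687381056305304099779343791492752742270488270020557031903128661800218218930769374793346993977543105802311199187574617769035579202744566493461946485292955, 73256345130487806799784),
  (1030229001252360207718619463, 7613030463384935962487285621328941871196430839752433733432513333150321600133818808425690030166093910920839136178757648406855471873805, 73250234572462920724359),
  (8543093698134365985327592, 222892381811436397148655246788970832887802597902152353084093234220355267167123890762978713350957407142061010910725206852249382849377908334688754205160, 73244122882093072752670),
  (1030229001252360207718779304, 165683624151156624816715342269830062959426992165192045194210489363426096176201844771507588254290863412773512946336833, 73250238032491802669074),
  (8514289266548431468748888, 738600388796670460988822063778396348006034680458691574095572814477342452050962248403972466480991862706139339201898702983413891397265043410519463404752670755740163509645491077095203810, 73250234572462920724359),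
  (70604080149870793267137, 10241844732883687381056305304099779718433300672018013502002052566040749000735553003538995160613626349557154726025675930958395771277034417428872342085157144784248339650, 73250233816415094266842),
  (9342139186438418653441324, 3804453013217760188236687079606993416078179329896933027294232819563942608293481820111802728246789127, 73256353930916620998689),
  (1043660454892834271963483464, 10242130519917013977714275829981303692980665224222509151298768691339948805517401176887147122128428671844484849165038640941357024144048743577772204967233399800460525567, 73250228843119477543747),
  (8624496439166709407606949, 16959930753815776143847857911753073309816824064652214164382930142035919309979267030357293236477392285309175798519760423951108434929279224454015034190097083166771262777, 81396624280937050055675),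
  (125849526805814167662770263844, 222683060793947187828582061719864722667706049151960050856956109677281996453293088412646728060882889081354954480617066293039098842617568049747162544228, 66461578989838519541787),
  (125849526805814167660703994155, 16956791402488562324869013954341636363762222037147215108126167634086304559658343865470998895585973518580939616126586851021827038177044848530928447033301039579532537942, 73250228843128909334511),
  (1040078733928167818813328642, 16959930758665283258921631785424968848123203710481170415972084609541714067777497511671768939711057931735530219522780763257031954249291462454685305464346990009618469508, 73250228843699532675733)],
  [(8624496447521205746438251, 16959930758665283258921631785424968805923872909786954151050235193360496887907429308867736865789494841145813513306538012349172470018329574758875123593230850537992826397, 73238511661720026766486),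
  (71276830144803353276338, 222892381811436397489350908112473036821483097397406265712938204263437138110535904708839881444454333736225110634588092263811403314587591355401152054891, 56975799468358715798580),
  (9601329440163282879800765, 222892381811436397506996564601299218319770512755045716579320602583225065382930389508971872007564822708926979910992126721411951522193339131877099731000, 56975805582312093009831),
  (99831920023588725586958688839, 165681013069401889625607067035889201943042616793246585015611159847524163054261538209255862113364975713400260514329831, 56976810362399793368504),
  (100051264166351069861832432142, 16956843146934756811514530300488429673165661457350911726755606564979452234974378148810144097197435395024393730785467872518680682816258573719327465117679978965387835820, 73250228843128909334511),
  (826869951788160035526599004, 375263377192202050351257882634439176312267827187627511419575169900162176420401585715053857167260766741490894658731759499133018725044230224778310020472, 58989959927182831244028),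
  (6833635961010731001947851, 17243767604199216038719389490248172468474321833311747986001189261192689570898112752259512303460568758366313381569303224999917994618466281909137622289162850934462037205, 73250228843699532675733),
  (77207761903030829542208, 369097507406908783296521788951847649002848922919798073624762287485533408534427099572942533102913313991031302677227431869930802080290570062491664162654, 73250238028185098743039),
  (77207761871934198320684, 3804453013217760190391298079964767253906065222222143141015306457909381833407181608059701620542490749, 81396628879364193985437),
  (78004330094128953368348, 10242130519917013977714275829981303692980665224222509151298818677379353164636314726819083493669270661900401510805161750307533586323562613893543897033120368504734295209, 73250228843128909334511),
  (638080676884552310233, 16959930758665283414720398604284758371965894648730685833952701102243997678111892421618855207600999860977996235074932843435337898753573037726263589223220842887668053007, 81396624280937050055675),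
  (1181698784929606992684792398, 222949104369027655399932947666292212170355026947283642871022480878382975448615939193637786889181015485870873424521816523034889864007137110810614662915, 48837550914742341784780),
  (9766275507102658976622795, 222892403184024418396536431599847915932815621989795421637956709317567652414862465345049422338812377204157541566726071822113826061977305841692533126964, 73250238046988659783995),
  (1178870421632729613577018812, 3606367591015292803841121528141980423259606166836878519538731051995858836366312025486292782105025163, 73257364828404219117270),
  (9764134938936964467502610, 3606367591015292803842130749459109144819137053654969164050736811832607855896633452399329556727548326, 81384392467572737996211),
  (9751421931347151804849672, 8316122448593028830762029136881230208656763200901892913733049635315566908618975830896540954715737859740521593105069827728793961507815, 56977321540483178597158),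
  (9757531257183802382821080, 181899029922797547139135790941636111041448512156994358985978008180297166056148886321747705976861756699186044132604207, 56977321540483178597158),
  (9764134938936964526125174, 7613139453007988021353541841936460780679065738564128222312772988253721786557198654684302178726424467957392935531467558087849397940486, 81385403358336540289695),
  (9758204007178734942830281, 180334725000674181294433051738634971153088406900633212798105501063559149218321493826535167214824302830753408666214955, 73257364828404219117270),
  (80695330073859210473896, 738728414730979549730491402029981106434566266884999604177138705605920482826452702477529489029704767244413042961202209659738429702016671453607249480938170808661368441808276626671250862, 73257364828404219117270),
  (1178951824382085354658505481, 349812167112023677699059767823285492563434278228798809538283629720177153718063435230376575987402247751995066232108023571574902940836091486541056531116, 73250238791137912258947),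
  (9764134938905865787875958, 8431384979362119949464574588918355135826402728607040544396829595639930671378689932244728632368988975634577855454643807052124685268278, 56975799468342151703923),
  (9751427491264465297081153, 382123580025237940109065698401784698642835293834030330742795447796330297807538053703424891516352603485232171718420056955421922115286022821992173702216, 48859285134970629854425),
  (1180742684868561306690854612, 803916999045170807460261773931589838876740506768411331890397556768258540150815610710660388653447506233738133337673922008909939436727086509369686500350495701889263906474231055028238823, 57650577365361029576230),
  (1180721953436980182237751775, 803916999045170799836741806089762975005577577772716716411101050539542034969859772211822934735810857510809713682057378862016387054032161754938158989713627460418644661308179178840471314, 48835529124631163045950),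
  (9758204007178734942831612, 821030412819337493794090833427669135170208438219561881739137806517497590225347675905258980363864353801020884663434326600260433982790686249625749723111415379647090279730599649537641789, 57648549463274728944887),
  (1179847254625271546606464150, 382117910058092524850277789069526434445690554994227892979978278061032342734763995477608890107272017031108541763291123288077394690393203656734396087163, 57650577365361029576230),
  (142653170750223973417340338576, 1742958652890784282842145827787402606647657812031058771902178599456017112287335288331680000696099534395896141690084441602501815208973769805734162415597560750386624753468399571601668246688692208467866262834981846086696, 58321304053181329871914),
  (1178951824382016309234217619, 33938738380757074879665095971020609177550376490990354451370990844209836999327830513771996750423508248712676853484115110803686584459125253471005490888536380293399729353689056368351440242214720360786814, 65788824401958686036101),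
  (9764134938836820363588096, 33938738380757074879665095971020609177550376490990354451370990844209837001352870678436774534665140682807900955046070567202795390412124337547605106568733301614608297712339141920244940944087817191333735, 65788824401958686036101),
  (1181638115111882165494008450, 17842315686013471986639376181284889895021877860872822542378554189316736669666361709097550590124035856175366987072522236139631505922331193215069581233031841127477900004, 48835529124631177088990),
  (9757531257183802382822411, 17647340711261506631309112870629789083422506219378886952828752132468343468805004687858575172872298037815762344833044456774612798474041067948570235391639682420286610169, 57648549463274728944887)],
  [(9765604257122993102932823, 1559475860506236050636796686713577525950241418694303945640017329160481659173306064375385405624189667862604573726190639981894276962535566793919163863032367332861938790782064998528009455694647243730317611514384556919334, 48837229264636115085376),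
  (80695330073859210475227, 1559475860506236051109322194002235683907102888103405476090517595576332880494034148760253926946518222066923036500634942010598369971966072946069206170802839149735095273134154877733861419776024617041888428164162179968765, 56977821257882708519776),
  (139172729779454105813176612019, 85702689892957971053727934551175106024987403663153412384205780395833183855901295938, 57648549463274728944887),
  (17299941917670200792492164548983, 18252184731506455631500048637454938874092481504740573158632251037739011658663139467840357041546878254305452606170031245361719553055803760160812493463162730679617497919, 56976810364396333274068),
  (142974726592315843695735382645, 397220718939989852129993367442523105028305712061913915738556379081851571502956376177584283583548739946581290159921827402227346453067957435577387456856, 81372166934800595628544),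
  (142975622022559098933107629176, 398589766406086193124631072211102824881247031823436012124438588869371235775625111986725274910888197304143322029028910136302925987980608511090738058742, 81385403736944269754968),
  (1181638115111882165513819054, 396461453192722371613229565873221456974694759054179302110084075161277215745123651215951644250377638737393380958440800216807112608410562709209762591586, 65111479434893112191154),
  (142653170750223973417399279370, 399961906968788938814525576651769381190120161598656397531889480022367282149513775344596767089802350167448447712493180787377498691450875039878381249674, 81385403736944269754968),
  (1178951824382116453397079461, 8704336416259741811100276020055817799503467347143402817800503393900574306189080700380942749900010798100600890836341569707281701234325, 81378277696509057711469),
  (9764134938936964526449938, 399961906968788938814525576651769381190120161598656397531889480022378840457963541112698368017332160768457603236413289632093474277931409860827958935365, 56975799470339334685914),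
  (1181460327607544138941229674, 17650039983093340139119275324875732563634428426448282100702212384804774309462637907429228235594952307027559908096369262768770086162271374806441908618124975331726559407, 48835529124631163045950),
  (17259841843123833509591313946118, 1794938844747213255938818955258341563064612317537044021185623885494437953632151062790569726100964501576867743487660152898017714947139836539844461836090991161343615470010618788771121279501842943003564954780875292629810, 56975799469768727288741),
  (817020218602662242891369603, 349683106321116644998106183917585339583838862821734886038028779073117120717768811932058332022039337357898623761660504829472678167828771523869920145022, 48837550912746230919571),
  (17259841843123833509591313301914, 38997058299735866964270937916205561224677221080655360130883223540785170637356952138997723593817987756229107775343151129916602442234972929676424938978415418753795283171045807032038160502541584987018554, 73250228843118835272360),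
  (142643321017552343054473662288, 38464343648035891791926394470727594842097167902823383850341646618129656776264905669747221792961310029580656836151334439294655971211534427919078150906326452525611293582465264475436442012986612751579594, 56975799468343867862688),
  (813534882376238241066698950, 1559440421585118403823049695069490999263352498748696303542484674734293089267639613209344678145360950914665737739526801182811544233359310484278847270680341847814662548102402385833258154917977512376277387077930033129774, 73250228842548854203493),
  (17259420117441936634944858546850, 1559475648921063914664136623091238713853065206420444032761204778748135724899699531893397784581375784924788010771352104027898337491448964126010241237789123296204040246419929304540744157853780442644328292584006583894616, 65788819806986345348447),
  (142639835681338319297064946624, 1559475648921063914664136623091238713853065206420444032761204778748135725227821734604075648688449480616164618845522242122840252340951203522151951909537461906500349648487914470570820720442038457456576751452475857405452, 65788819806986345348447),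
  (1178870421632663992185732713, 38464343648035891791926394470727597479493733844594789207519912816005228208183526226036643266552554755833435787254601122916720458852129566357516728399024429188858738509626295332926597080086911232976991, 56975799468342152992245),
  (1181719517861203383824698948, 1559475648921063913260263738370940866283917540729193096847380565047143328951557696969141015316435704282367287780959231979884212422557866397633860555316259504175058454079367964265263166116243752064795396657275808613524, 56971709943810852939210),
  (1181460327603297845348001449, 81213332348107568606993153769534152881670402108368239396086886242161465363724729848784121615554275750877871015768656461720391330514119185957133684771883342472892218593086665749847324895883949010623119004222930817901430865992989497198, 65790336148071843229757),
  (142975703425308420151418509070, 1822756224941523117099680521323769982315243635264821694661274404490833799290959539851076177447287656363054539730397261362399385219275291866309510296010860450570513305175141339395908209629443579578050713303349850868736, 57648549465271894695115),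
  (1178951824382050831946846034, 1822756224941523117099680521323769984022819709291757342563002246053087697689285386490972894374577820552487437904830867006050810097853617393101407082447629201659402342395852999398442249210533973910040010500785595517951, 51527539998418401861867),
  (142978211928529701687531808416, 1822756224941523117099680521323769924367698293318567749308069146966000410117793141024689958749806910009211962693089403588183442963858564734441495888216180798292719718538044986270478449364026881380749013915796389061281, 56976810364396333273456),
  (1181460327603332368060145380, 1767426200006856981702211692204487654136368889937146209938935401824788911869635265262583675174511500085830485543380153967711210871527594719031197583349697848062978300141859992191389080798414252731295343592277660588220, 51527539998418401861867),
  (9764134938871343076216511, 38464343648035891920853756452270187847915893136502944028169859315798031579237927535857210796155978755266623008863763636633346876815304071183969016645954686264538241176467920004315146950374703964017028, 48836540018688161825063),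
  (1178951824381702152498145253, 8628324618509818216707344601396563780489586281361417679289106984176109532978047514459504892853950590309477765397215763990809042326920, 73244122122591885747903),
  (1178951824382116453396754565, 8628324618509818126720082332771512339704095192213590271928381105545612997185247537676891743172730433090176887466575061189557484356647, 58315188144135417430688),
  (1178951824382116453396761231, 71669083784355642549685568098368347264437014132223675164815761174374460240913706804447535182729738688394047281432681706132037661167311803846344104785965420205391643632977988482662678744104459564691654133531481981932767925239816512080, 65117596478879248168675),
  (142653170750223973417398959809, 1767426200006856981815529808080654028430531030233646439706682625289509626324809972075652144417238623760847471486149042177776681887355663670780989818724333948633859840456156567906148492006730378457912164128451488816532, 58315188144135417430688),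
  (1178951824382016309234702103, 38464343648035891925462790014187487699897623592867159044092596335517274655593993005969986343432322281768163552932902765564235237136844737129586386447335354018456325941575563633028307953044128186408177, 73244122122591885747903),
  (9743403507290218623113674, 1559475648921063914664136623091238847393277682449302931649003207472383535766401275808251900919407510594053334407682997285932195205591080264576153652211126391271046842772157709732286015607068312883932747207760385862676, 57770872239144527160890)],
  [(80640754191601672585297, 33944540133472968533675862391407856999762686455926864789684583614044511915161572734138442771296203231711111625365553997912194758527865528474059575749101166547585482059628585555354064831904093720062724, 81372166934800595628544),
  (9764134938836820364072580, 38464343648035891524211318629800897720983073308896451845527873155868797802025943735120932905355554590105331014459538681690697545833697273559566966857259298004825929812105020198345835167240125959188380, 56975805582311878973051),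
  (80695330073859210959711, 837096186685734948139328105531033189605598826695265155693703779412860133632691829514252869744419942164437505546601244329132271966492661845929863149449383559581805282611480532571965179, 56975799468342152991637),
  (80651874026228657048259, 470743700392868185143780063458593446221003549856074055847225326850095114925828009582259253685106736506096664351366346648588557221952305275349780548627248935158199783611693869517817199, 56999509528951755743560),
  (1178951824382015196285324563, 1871413280113031496607045013962409106279624840198737960035576592958421784473993247782746635926845124788458546461627154396834953003769458945073999341864276489638586478979519147542674081817240878271463870785300278509924, 56971709943810852939210),
  (9743403507289390985406745, 40727405485720665063769922179201845489501009837395158015600864680586570256001647454562643739797823811997235499098614074069142521075641572326965536017324223559959022755935525101505857623347004492104682, 56971710701883960947382),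
  (80695330073031573252782, 40727405485720665068127553377811137043405425740903261619013211422107559356407269866556556962881219651661381910361341126920082376012910494608191232149879306167586299652397679503103036053481338914476293, 56975805582311878973051),
  (80695330073602196594004, 9135974829468316614466189650181123945335865633481645991130275751486500687132262908828292720221320796934128333274795307526128955755070, 73250228842548854203493),
  (666903554329414962593, 1559475860506236053432893691560928710081773563065529412662416514555202038984896298176222356428198435363593959787115875132074303051869655952002042542000286631858504641350792108718385571400085999284145308035710321313939, 56971709943810852939210),
  (1161111913356792755324847320, 200352476035532057816492511017428533580578230828402055597849604764919474869729223434933164767693517700772207793222462, 65782713087886830939535),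
  (8699791371221330789904319, 41046306428166842504147557356861048383940542663997906830478257490610828404977454759782851236146164364295896065448350747566756359641471798220543095785827800795480092822840604164852221477552899698847576, 56976810362399166351948),
  (1161118514440577161762661324, 41120468325219672330726837651491494860977065401588593013776718592571206212778284206173837680135323340073153269863390257608670556905731740024595039550358654193092872073803136456774975619935751399340470, 56975799468342151703923),
  (9596022242435043934955722, 19506921648673699267184109120197821671412363213414367264191886813602119676943534537616405512757669414833939687512483424306026864671919505600321219256764593763479241998, 56975805340655487384428),
  (71900564174791884697165, 10235852371152822404782777376617781881788817847442483786263902926577545592427850955817242327468393560351170249746226102845507320874359369649047703405956350018449373805, 56975805340655487384428),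
  (8705899201088462761081144, 19450503966510247155630356821695807716050739121090605767301595631611835090740971533586335054752871497299288507328564287796499261265894694576927253519771533772529972911, 57648575082576799981529),
  (1051882132593439145493277926, 19450503966510247156384465581980443578460671626986669163324491364926851480793893536841199316806623378512737605323498421624963073373745414702516212304485059424511441824, 81384392467732027273963),
  (1053413803331633835717638980, 41066410448845261207522741577286506557973359176142772293353262793105528597314773348139812809066361994227956669099692672747144079683335899481879620271916883925332470791628959917679517867100393753815078, 73256350858090850577326),
  (1050905299600798181309295614, 86706694268059274217509448334962304056450328725812912960568870290709225838379263940380324797865444082223501465343371629622158062042422336515304258373601475947149845569280879734246325406295115867864600680900563610943272201954479311941, 65790336148071843229757),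
  (9342139695993649661762118, 4852358976643550743927118074481514931688032620349912601342105485839667036309131446568862690461568544966313478742031435185706054853185, 73251749777751401641559),
  (1053413803331600425954711538, 3984149543221137649884772448819773816276717796704757268463457466646799121304564163533922160861112852855382948739592976882227902221707016261258641840578615007899603950226379996150455944143346452246297932492212036304989492474093317143497917086105939086, 66461571701523365047989),
  (1050905299600797068359918074, 1901972438399968446921673591895117791220047704372625685206871090955894023216582383999007069023520218561635252319086995910453360176171430994573612419550990948495019624032756556059966330991841384939714055792227453141496, 48859285134970629722656),
  (8705899201087606826069311, 41520082208912684163362739554611346519859611845893819404996538883082138477252353456725725318478934306232202525489270109876551494729032212232327408043678759669897512034639497269134023960994181256273526, 56975821911557316471308),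
  (1051800729844052591043835216, 19449874408586870471733029311427203705411769546131415832134975119632491395898015205753502490562555999461123379587368381423059894376300851090550864924270969096112780468, 65790336148071843229757),
  (1161124622270578390219025319, 41453521417757243632447976085528915808756712513531051061747400335148645266241576072362167674863587589160186913489188538418518088287496142066488441252823354760683428306108264171783676166265618600696026, 56976816476371470979487),
  (8705899201087892137739922, 1887034090552507952866864442005602758553510164104152444847834125451435504343090375658323867426838041314385460552186926842097881695975917896991542213682926806177458343787105466851131485575280650399098579465639128823228, 58995066461169151007090),
  (8684495015300920178080135, 36933967220299437131653032876530844823274354962429846107755675117006658490322049966179650470400553441081167221313447414342752306960626323219592077457597739475162530510480218561076469403317602000192901, 56975805340655487384428),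
  (1053570858894771026388677692, 1887034090552507952866913628446204866353572530551159862671607798614778788556715119015423807974851566267953471526861426785228445272637695093822706143869692451790605535827540769913831460138219378743721000143433942959260, 81384392467732027273963),
  (8685167765295852738089336, 77981553820957172356524585758674215534691114261323804656152179236750494905342688513557050050515357195834818595792009339269650984998383763840593796221136557379701383067548141681197975823131951845753110195350199517667461640204454107974, 48837229264636130150965),
  (71949580174286940288933, 36933967220299437130329639399564076674810739957870173430927493594344006295927131225437881192526105484835971661338356017480614491942602274081068447232915103932979164440916208702895367615672806210750210, 56975805340655487384428),
  (8706457711945540866921646, 41067359833349164613092460306428245894853714443291205772172293077747420926487709562334452319589579200461712833873840805369641592174261810297796820914738953385024344796703757004659140690006201254712876, 73922978836624836123855),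
  (71956163347926807011975, 1887034090552507954263687020290216895130797909430205543997603997581032075907176401303733345826800491882428981899290288772623400854697693431682373821739665767576340650709090563022374230928889345022129212167388820341006, 48836540020685343519340),
  (594624629254015953340, 41067359833349164613092460306428245966619355588493583249170708253479951516687617855273720084383956795164742441728886283679101483640058474893622254638099401116455263523288090958211171925127127191301455, 81384392467730955479558)],
  [(9342139695993649914935500, 89925904916609713838492360508560142435134147199056543944506199303567354662685113408382225029811956033506146261794887072449866721709088431201166669090865219416904017774458972421649718626023307927199221275546020445719771293384109397056, 57648576463485285738769),
  (1130398903219274221060249260, 20175476331458622905871849716343041421313756920954991037317901014548075056568769304703651259613760386031764034352294776727734191651734107887862752175969732774154982184, 81384392467732027273963),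
  (9342139696061582390327765, 16076715064483074967389826637827745492932519732929792231808175421450391501259189983005711348658289782681194900310008477309378112663007639096220890679302567343233034492, 65117596478879248168675),
  (9342139695993649914936831, 42591103430324801573350351522304519277356133215607201032154685946504849408572681426736624973817986062342333716996718032314655915013858060759029051755364462480887008327381546157331413179695194976333800, 56977315809427649585148),
  (77207766082592148057285, 42591103430324801573350351522304518463847204237301863995469383785451509724790456022543917720048712619202741388435236048270531921031241177740711136554213752331486373753440016173175687348659681130824108, 73244117528762310775723),
  (7810468957832940077164002, 439005543332302328580974253734006912066382242123952529148048691082130346486506233100159156144926369469330554773577816502249938054800218816468773732342, 73246139317162048339180),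
  (9342139696061867701998376, 20172184112420352131748345146873364715063436635847285350259421547697700968131816252915522766792724141973236871570665576978185074521102825707331740797881353473319476235, 56975799469768727288741),
  (824280045307835744043773632, 4177249093623249874912847871740800673785625744646153981783171709496508826526067657497044685197942713991697627423794975546770890235400654121520660534551136476497226710072223271651423448850309930513572035108290141741744102594278253664030849115289570951, 56977321540483178597158),
  (6752233215804023182690829, 1887034090552507952861185473645977977307548946935146837584999187709601943850916132251875786107851694434792833769432841433985084252002573910510115056416849682602205856214465126823139181248453623723795766769672211124725, 56975799469768726117461),
  (7729066208446100316050681, 423299636891448582233616547493469296043984078391061451764301258735154812308089579732556469617338618249700078269282920237717296696179993826593040771559, 81384392467732027273963),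
  (77207766083162771398507, 1887034090552507954391557461056887726782715704333975356466116637902253292685900182097720141382050932231862293302860085894466677371640235262536244330957355613598411738357652737251983045756658419677606399483799297073196, 57648549463274727773607),
  (63876580235096220178521, 9554039700249366404292175524913031780515407926042240869435443399658981089979278643426527780727803025979968032882966261756571006555788, 73250228842548854203493),
  (638080711435579313627, 42591103430324801590613278061553156398902524700741707792992323530795326337925666349496677172175972659380393576171087779562398866351405241339925699741548505758366519855089363974492204822894427773536553, 56976816476371470979487),
  (6833635960910588963511081, 1887034090552507954391557461056887684876967005694282386404848551787139350014943564119890561602387127896534593857629965630467216176815431976996592565823264599368862614450225895761703986739423518977676920003441060410491, 73250228843699532675733),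
  (77207761802888791105438, 41067359833349164617306437322945465903053278027848364336794442607381920050747382921041918961141476294151656960967266666005196920972917854491332592323730305175827809892194714165666175092410279380246807, 73250238028185098743039),
  (9491122259189680981956370, 86708706704239308273778885940326222385386520066188189509768688299756501726273797164333449075971842625885775464879381383031312956392670364524941669029096882511008937913078222726026627299610274356891069749587080335958118210449613643747, 81396616230531505964259),
  (48403330316268692811134, 1887034090552507954391557461056887741519652299212666754398600791106239842891819853281717799839054208757757091534829425517413364310202146006717856503654843504935813839050847087270871631407945273288390533209066689016812, 58321299460205096492552),
  (638080676056932157863, 1887034090552507954391557461056887742962764209879016885049808083404535403266276232085357724455321830501833105046003517326695662143647488499315101974692603413171405769306951680181050731889651388242106771033173052928171, 81396619682802934716845),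
  (466746531043694629277, 41067359833349164643368425164173366062773173939930620207070349424925621851590980479324036705132848531796226917493924747970773062752367454129010304710424107729764226395171011857316631548495394463200060, 73916867522552981026684),
  (5273394023839416354, 1887034090552507954391557461056887718211109272992822756635520014758891941503150190933537205543892845527371904124768484388254629820751956509815744167703320680352514458520366460090756557938387313156815874624945341904421, 56975799470339976475239),
  (7789737522006064063439407, 20802926469435648953433179212271907613782972232263159336965034782140913354014119021472788266190046816681390068289003507823710235277349688808684155641563556883686765595, 56969688154286919967939),
  (56476330256286757673912, 20802926469435648954204425214742918334267405799064328908878612558428111504061720415907390812968978078513983205492127201565918312812906682866393399529713692910176967782, 56969688154286919967939),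
  (638080676884276910229, 9879681138853613863893929044003092077039674042619783656928604079859759590569925110721873753080826240091827685487289705217513555058256, 56975804063315136273873),
  (77207761903004599651653, 452726496911022702259569998585705055771472053460133402903604315522912962884609434049210084244399063322392220269623992744825341954787354252405445424864, 58315188144135417430446),
  (56476330256286816297939, 452732290944929100839474761107180454267622061594347249579989496559274597311988441953888359468975934434946204651400779263367913625046844106291696266526, 57770872239144527160890),
  (638080676884335534256, 20802926469435648956880666312245794225303388596244564449306516482669946164678452425007590808132157871622250225982385413175659129587200518081700246831930860598517893919, 56969688154286919967939),
  (638080676884276918226, 2018242380694743615789024576669846441533959262164625086416913511361596933112731908058959423011455367936978191686701540045858474065467532842312362849767029119641273372124870334975041272510336649247219897380314276536126, 56969688154286919967939),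
  (71276830144803077881669, 43915674266724985769117944752105956041380595393457413003960300124936561192978935568169580408831338268603885778482610651507501953983384190517024028706616741410341946152019964516852284379857216581936130, 48835529124631162916392),
  (589064711940521304763, 43908011010337296070246762915788967127326330338846349665684385125076155817621165226511655180120728895096298317595200190199396123273859423247992591404765874809604967531922833828361512009682143731756154, 48835529124631162916392),
  (5273394023836999258, 2018242380694743615994242095017186019135013839852646940658856282932199646520286633872469109884222443912022003553876398379303991238539637028460762784572249620072811382922556931566704679584841050039760643056905643651853, 73238006214405788050652),
  (4914253134330690370, 43922834512564948942227805190264643412272610372782622590706785611359040973737087075167110033149411483027955549213328487746822089259274793724140439358614287848386342519197804302449017583061247009369736, 65788824398506416609858),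
  (4408806105831396599, 2051861444720511140442147242753800737513746919148605810339731556716307386268752269636297333811889291462754614984451808620440152985279024630853948365542739937271817326487178940071643597457528237078645328808819629176422, 56969688154271155330721)],
  [(43581768792041304, 2051861444720511140577471769300160223175272992801170140697189417832101267076976379710405255625193292113517060010759762694111089872379353044342850289774308393467958342608627192504269702283353614939642973543144167500363, 58321304053181329871914),
  (3857409347468530744, 974708764302727876928764481638474936597050285469566834183082755075428772248098376850350965287837080124179928680054065292463432947178177927642046664700014332733432094462388374845873787, 56977315809427649584543),
  (3857409347468530722, 974708766830185037897581856750213943121523846492641611342318991444068054138181744877423172201208057185280351309579896904538110117997981187675620212823198139159654521509415344162525077, 58321299458207271721632),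
  (31879416094781245, 974708764154172177844316646066930997826280517432281636697558022529998703584078631074049550858077182768952491207631888767953225964858872005522904184392381633596554057316346878576895523, 58321299458207271721632),
  (360179907372242, 21301084605439853264986936658853263067771269051689233176055423294976138363391676364713601395492890112778454039749193797397151512979806042557900536747747535472526084593, 56975799468342151703230),
  (3811459617371112509, 45053838002671094918132519788920705272100994955810073815249823801658180418891256298281544585141086676873962210504684223855646690903413504780932262691291708551644014194524014917021516177556040463401922, 73244117529048051164096),
  (31499666202555507, 45053838002671094918132222900305314119106390982861370586712292918565654802777895302693417440932459444728522857697041231397577761137671031301093755777308872312459288753880184773870719521340081516707604, 73244117529048051164096),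
  (360179905419697, 45193855969416705273311989885513157566036170498069688017727878654526671809960069388597648699911575405795519831813400525826781261294966312217068328592820776610869227902753966213538338338107447607477428, 73250238028185098743039),
  (2976693433220, 21427179306190492988667860032262379151746919545049217860925909425312734519490691221672286002445701047948209347607776750194069396528298534882072590180084481191615686810, 56975799468342151703230),
  (24600770679, 21458704050288442525210011902016015086581866010007938994376641265077296598277827385304601669142088761559161504293900751235119193790613827821196072871295103142060229562, 56975799468342151703230),
  (8699795928219864325094226, 19632509675675920873271362876722023898642524055830961906736094214555462392865203541445215654810420843308618669952382113283433714991205163276310783480621578956866994414912202632283303612674199469628600766933012922577988522953797690663135146796053953303969819481108287151591809300030707115150799548990543448631510552258, 73923493473596926960207),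
  (8699795907747896023743143, 19660972129206167373147949433795301145380783365791275600132538091706215967744181931099619793323109404334304013896752041128109209438884571445643482694392945604149762853215624881938884501984882684237891137801254782679613586051367189163479345525673051202379169290839260095994211959248422629115887485289948065420877611534, 66461571701523365047989),
  (71899139733453781645908, 427251664349582664761187735515921979137736586625053183166205013023041629475631363932075435849759409395376070186732620580301192451660243341583300939616421088748079743892495892876224395994444950064848728151662686813604386232034291537522363613117035843816875653482433457668761148008970032691171669851929, 57648549463274728944887),
  (594207766392139102676, 427251664349582664761187735515921979137736586625053183166205013023041629475631363932075435849759409395376070186732620580301192451660243341583300939616421088748079743892495892876224395994444950064848728158697128753599995779649961349298930663123972571798556350766394497608973061813475440383073615781770, 57648549463274728944887),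
  (4910807986669210923, 427251664349582664761187735515921979137736586625053183166205013023041629475631363932075435849759409395376070186732620580301192451660243341583300939616421088748079743892495892876224395994444950064848728165768761847987197359159770188547838124010795583445045819088506152508184957094994358610835488192821, 57648549463274728944887),
  (1170968251653042586175103947, 430372788446118882618261341528428118024374500367186407295881649606812412557565924646631566047844785004866496500900862030274955679815176035076667395154349435482524450666072509949863780593121295023804554969188830111013632625164598540478976724036982082174422301016154735491311580921023199848469191985420, 48835531404843319625511),
  (9677423567380222553699635, 430270044709731839768890513232799439246992450997026547617940512559760745564323118737302569361738884801699150680931004562657047431965119163401535236772435509932590199489626091297834613543869127091834732022821956131013039095668379818876451327153400028216041702226606276548499870074640797151671008446869, 57648549463274728944887),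
  (79978707168431647397338, 430270044709731839768890513232799439246992450997026547617940512559760745564323118737302569361738884801699150680931004562657047431965119163401535236772435509932590199489626091297834613542243280932168908504944200210397925040641173033430321823829362797116347954366522922419726704592366216060676070429625, 57648549463274728944887),
  (660981050978773945464, 430269916435467359839431571522887374411458807527800382293541500836171314746494291674357470104612926286747384301641660569793249840388711292948843080441789415263047777214042383863534361397837151645635953750896916333753731490996333380564022623181352985246570098358233614873877361141954729520615208351190, 48837550912746446243789),
  (4910807986690630706, 427262011806475283045303506944438562476192536140648496449500583855721432288661460163981963375918452751363709561706479114549734053902107841036691882743633385603023364615095125418184381754280984708787397628697368069438042830137434498297371713764353619124409825727841719097041619985644387487699512461914, 81396624660976950501352),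
  (40585189972468845, 433513240568053144552275179475570081172285486121274471058724807477935062545815587917083283038422936751494892660918512681854046711086384580495058439510869118275620580675916075270932935087646225430597118186334427502771183643222779496084063789347598038563052049726760030819175289006512414506425548521817, 56977821257882708519776),
  (594207766392179224319, 9448370812008352272179457807968252447412888716207139427616696699784763337339468382483654999260983274466055188853296274745327164676637840971390577484047032349204166805766488729730321323941241615771542087196045981680594246165613701626423479870677200322009406072054773843960703945267848, 73916867523694227708281),
  (4910807986712231484, 9448370812008352272179457807968252447412888716207139427616696699784763343995513601972066484501268553126744232907206682077597732687939471311534739310930995065949680106063088793644563593332666219652985483793817983952456428720607978540901149370720180318602655899148108855871796788961046, 73916867522552981026684),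
  (40585189972825532, 9448370812008352272179457807968252447412888716207139427616696699784763343995513601972060433568072075499417331739838971372512933243671450760119911340849142076962455015725167844716392054355109324338092892325816784756595308573716703633836466025630660538594691001846971689777355830093122, 73916867522552981026684),
  (335414793160899, 9448370812008352272179457807968252447412888716207139427616696699784763343995513601972060433568072075499417331739838971372512933243671450697750237825985995990626606426715152836498299088458437957143846104971716972439240041719750435671705502208762085812420550717859423205911594330149390, 73916867522552981026684),
  (5361978181032001309, 202359280025683308672244720490486539981632634299689471012645195510317536499459976096550601746604156809613791455166488245699015581571232734281490238811509370982328617776335391842864746991639227675531925360136080296292651971176758365506974354662528201140646889565624844, 81390512964844238915365),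
  (8707195710556014527468624, 478802961636360562818545014594750742238044271015589649178314272149768897919417292003585827168310227395101447494197997691209402773457208352063016606194, 73250743478661560637331),
  (71960295128562140876686, 478802961636360562818545014537804171942304600677178527519561827683130423519116797732710947648126219333640958278520625088418160978160311128541046263801, 73250743475214905624156),
  (4902450351884449651, 97935215972953966725976370693939217828076082265637000175371354880255865922944194074409273363196480115570643941528932590255284537345480275633474087490956029329692598637162913104889028930209763492158405412404671874428973378035880091715, 73244124022195916559429),
  (71960800924809981409511, 21496463595600045659275187058910844140028603209642826840869699152268122163351785185628347110881251655565943757438525104608302578372031326947104870110008449151873236121, 73244122120567695083512),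
  (8707195710556563636973062, 95842294093701406724154714005681623864742634649604630327550314767587826136933218044056965509146918876790449440134074350201549600509116021584979409867024726215988729525083793415741266171070835212792889157434138848478321517552481776317, 65109963094379953165097),
  (72578962640664617691444, 4500096838294195640856403636458489848424390990128364705500652039643306953898669505277900379226568653131386514009432558341806362097268802163403689749603728245266095970598151178782138432090514206408238207133959280864579512949573325865185543030681506610, 73244122120567695083512)],
  [(594713182880696706937, 98921284033869205497221696329827834361495602716550556887646974521437778812877049345450908371946026769484429539215316898533336239123207197590878071443574528257816031294158069395004606188410293430282039533505444091246392283682750825146, 73250743478661560637331),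
  (594713213413546998815, 97935218588994666041145489043460805525397948394915886242054818894233419045480703456174770087284509443836116690959285207605008032269160110098615976475321400959010802688513670998856826129613029563412024145197480673238605633769528143779, 73244117527620421748685),
  (9677484731130154518173330, 20294595463323613414149336647506981428203098019149576680102232823815730273346540857491115317045805898403016794092027367510732531851046522679450649604443421025239981282420261902337413607731135832474369424689728516374094243637008952907660354932185624399326467776728243599393524024356254480528523005007334616992162273666, 73923484284301771032046),
  (1053570865018446768407035446, 20294595463323613420419858422449204190422059854009632100293619866203672049568689507225696859882213234913572398013154962351074551085703803196511655485091006530284511883756394927717949021774733772339964629960470336727792279831875668840178915290883869139639489410004664608014818735723237635264095336559831324680173538279, 66461574776638838442823),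
  (8707196721450337485343331, 20294595463323613420419858422449204190422059854009632100293619866203841120312232223555922408893335756749352246065412003725725627756125244913644273362136129567134036270387556908504570560957364271426483904199212727723185827634301631314931314739564762240316176630759668456125729982361131243483879068831407711695577272457, 66461574776638838442823),
  (71960303483060640374738, 9612015755604591708329294705170409364609752274754723053717959474483876664842312378989029916869766334143915754101481608596281252766734294379202454659835815230722894413288894812837459143505385075708735219670931700886051936065565168031212319110190885787573124490385421509150954271433859, 73922983811347654114990),
  (71960298823015315862787, 436586906886688134398507041367161370861965761157898858188119421000033821736193632605256379117284440890836215612748419671631282588775563212361513251246128193869665878291254097061928618803816475548267392344824468394917383498224291142047445347237106342878114812140873450976549978017660239660575375249950, 73244117527621707179844),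
  (80651962610387990812793, 206807458362531289891344994480033650716991870941244589011814244700688127636013166996266364882936796246108262906816841431623872628294515306422290187902856694785007050462098535390090554505434405943615648025591904188507954798776922723030580100640194674990611992189765256, 81384393985303729512215),
  (594713213413349717874, 9707495764568784568433277191106108673498581823124535104165480901504631420404049547561722604471905777953494478447244800197410865309340530612714624356375649098742957690974748788785680388565295649857819732952517987813101805992784216466119154900382674058818735891448521678601622299053979, 73922983811347654114990),
  (4914985234821072015, 9721027611287708577995567624039542370837202786133185708603809849546219898129251309441951337439569660127702247090011732322643111511002475785176484358763451456075056406742004142015047182294268422443755916973076114728384403131264774849505094511217746904139786792273999295872659891542292, 81396623828691685994877),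
  (594713182880677219766, 100338558249759540743781617141575486882765147217046972336186352604281493875799189226803302500847272514088208664546096014601913067405528485562270277014668990367750918603788100463215488168481606066584542581183286528522537121983937618011, 81388892844748455441178),
  (594713213415671100454, 95842294093701406773090721075108620721022930547027475563728575623563291102740452751271696558498212339329195040318639031298360448461586219301194023435020926982714376961339904429182611631279579274208984969907079468877877466809619176877, 80583213735902818307587),
  (5361978190424817731, 100339723418084673651943170929226908929534789642349138630792443978499651573048816673384317947116255877958613144601946671078769177267859559327931781212740046461217180775498499270590024223143664573808642902242069844530020397607210894867, 73922988782615611369412),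
  (594713213420637919828, 9734733622952590276074131880158640745695690027967512722043397035726598285237890227314413527435154989235873265238162067836945001950766712875649052389878789250935722709090298370164488096970566451469625029205895369350135018910198774837595728620456485352202130721142920140784009276371706, 73922978837480771135083),
  (78505791893233178900448, 449187069122776258577340965388099033097379992713792686285177325380699851206773579925731017863490200739646664704432993319330613607177178761128833819011933509619548446128956450872788656751605918265875782774910397500792412267137595454406796043866695134439528140934356465015327118872966220043433510715813, 73251749777751401641559),
  (648808197464737013000, 447308380268504654566169129060474683218456404574625661912349250494405390315122717196423500437429717597094978501336723550961090941025226123907066295893502058864578775709321977824024159121938659652757716842475281721851538643476877071844242125519228032901826349730170566960171965318035635892084250395877, 73251749777751401641559),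
  (648803955153877041783, 22599717728900569181907703411842526755734210195072478388639485456383406806140834690907734972730124463898675267740796939589993457677955927011216986975161919814018120249, 65788819806986345348447),
  (78505286446198111800487, 447308380268504654837403942531239877901158522841083534504654434391719956303580767423739675456597638955237688967123384535620957515361307170849673377316745534203477341840625076509284784736438311480783283753703218208891135503479159631708490980492083810773975414656065487314035008171366417085734076971698, 73238511661720026766486),
  (594713213408848177336, 449111816922605993019092977156128965215910417954800012529422425965735136977093780973519672091098625643914959961133922304031779641346697191625475594667328712132058816591319020252128972003018554193266801305277085307146512235968043730354232864929712748355903488094469142880472884898475356998972003683373, 56971709943241943663782),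
  (594713213420637915791, 452868883906630824222118135963410151239823712463389238620729675814153561944256599063400154252413823321972849946569200615899671878518573516949636379484749758717354508812572159418739090446770451528912036755412090923161304530921011616909027969512984259652092075198366837391298262873707103393568050051906, 56971709943241943663782),
  (4914985234881305089, 9734733622952590276074131880158640745695690027967512722043397035726598285237890227314413527435154989235880883475802378798579045305913704219640701721208463162290007070137419912006303795869586114439567954736732913572218189710712037671660345696523234880090363807828762113878922783451660, 73922978837480771135083),
  (40619712684612776, 206807458362531289710519182627904340305653643734202295436456030951293622183565786731003060109449012746705140201354531570108214902611029395003124015042714768791829811492862080973573544792818698738344264658413470299004376807069635970143163256046069857102625811476322959, 81384387872187345782585),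
  (4914985234878748217, 9898359861292918154747432684722286572611956394949253516466713490569879897824911973123596037110775197386725308327245924162633402352209534094847509641660689919825759843671192685261135110451698288630536066784152361596260149778220839387240853230635411638680851234139462956509352950293912, 73922978837480771135083),
  (5362016696003100321, 454827134294175249457189044792748211473631763068789605554341203332521481714176222026460123749429556271493878328554983702565367761700812473390737471491024386814200065032019743739077881537057718538806384939850607695235885344583620703888432919764944637740601016352860157567485994699200806458180994161815, 56998181581758697701514),
  (40619712684954822, 9896781468462536729963351694276376891315120399272701088047984741887774867944155888868947711205549104069680307204425892987955918790620826763980962210249490036903676865843215617829702284470490020839015035106782197154611495552106163854369830344134977259992991000632798050474481836917622, 73244117528762310775723),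
  (335700104831510, 9501403997621053533602951181598606159656088262499248288791058776367608851524430811409272512403957366132306304610445745936393631647056785885912767100832346149575153224823986454977289486173618687692648956868819110192664334053667009552129518045328820430047413636132598727406070934789910, 73244117529617602711760),
  (40516370948704146, 216602842538750846785218578594537958036890546898188062204028668445716474585276959250444289521419511855298164898705259589316766608385418575283326432045187108098381686082957593788937291020812419180273801393955491230680854585245088801288852691815186211025203110030485695, 73251754369271475493936),
  (40516371004266741, 9952841175296219307661784949103209483912541556762401815825057023128142899486080407944345834764633842826002160019563718795973997731516091045584502159635758433995874529204620543794067572895124858643663179419588714145339573876332241813855522087527219430998176312685376938196659346798341, 73922978837480771135083),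
  (334846041364066, 9952872833251972652057433628393975473804339401581694235815193629063011038936763800180825885548292787823306216001153815748498055845098862203542746814923174221673967787235998597148862725701728642263153171596083013695685863092046291425110521538751210631318698689776362904112518180177271, 73922978837480771135083),
  (2767322653074, 4713923498050979288732666605185189547730734788485262181451370395075419490003014498528254485825167166160141565135504090796105273157549412728388285825184393156775994405685414492000166995613969506068287248985942328362085686870841499559386986136066402106, 81396619685968822464152),
  (2769193070106, 10007409965675538437108375927176071221534314650311871843710381870249403240050579710938272050349984647042503336013472338077261260829373925284982329885964417326458063993351788989076748304727771405412084790162641158950694767694110207580501238458387447544602756321116223221615993752557663, 73922978837480771135083),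
  (22885899631, 10007409965675538437108375927176071221534314650311871843710381870249403239643303358064976989505801118214118576917778104992470289771655241175615898530429773614449777191071538951629199656202513001885681218449466475508091222731918411628758597107283300361935881903916276135243699581908714, 73922978837480771135083)],
  [(163858245, 10034688774826364161980250125682871719525954727761874971872101054705757357524038107579548470744044589582211632632070239559874592847096547212473173005005120247453933961009087620233726785614934044782550206057654182716392087532235004087937934955718034775130022927203998402112813625308673, 73922978837480771135083),
  (139183557024477027716493953851, 0, 73244122120567694512999),
  (1150277207952583230654166176, 53790158932141075650054629949244621351309733832206, 48838058259950456481633),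
  (9506423201628970149165854, 53862885248162799592837365636152783424569670523788, 48838058259950456481633),
  (16841523784947210141391769505820, 1168926181495086076383512266014643, 81396628879361882420433),
  (139186146983026539910385692558, 1175219078208686373484763454388240, 81396628869010261446552),
  (1150298735397013402746145238, 1176857177400634216090335116114158, 81396628879361882420433),
  (1151180161269410651514900271, 113419860806950400359579655211776823647802125059775907944421633490595465602008561269, 56971709943241943664750),
  (9506601118983001900573246, 505616176428048862508111882842926547438162783548372951604112786026081125239531935059820350545491511468026008937299856746241088259198913392253411996122, 56971709943241943664750),
  (1150283806529458951586903107, 53718414367489108505980607104264044009243549098179, 65116076305775308760037),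
  (9506477739912884031727592, 5230845506678329796812328733060760270562132886985802318872416116133048494529559634013736158070374755, 65110470438729561831953),
  (78565931734522594769331, 5230845506678329796812328733060760270562132886985802318872416116133048494529559634013770666634840526, 65110470438729561831953),
  (526932322345633702015, 23232926721521087351209090855577458528887281767902840672405423412737333998321551070096536736971827621316871736130069087892207743287003962785514864812467654609556345086, 81384397061272196600544),
  (9506601633198004755584473, 513777305950582618889870291547973846080961482205204187692176665091393777171861614364831154996463391627426170766680018782918203140894402744420332918758, 48836541917439043323908),
  (7729807223275688439151715, 113422278443769009891916784362435499092531518651671028534971179309412763505235369477, 81390504539873619245375),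
  (142761599944357167431673796518, 5309860778961737331589892612282241315974131642189272447338135461730106352457392667835483872171765800, 51526531003111758619553),
  (1180729359296833510736460395, 515027389274354868424155299399654670088950347375583219577522663773614185631792349492101429088832952341543181940235055873618595319591890987950475354442, 49508281018314604745567),
  (8611170875727790465751316, 244676829439786303759994471498939179394880784871449391086571801427193807661878627994088314339879445686855634136440391, 81390504539873619245375),
  (63882190109615548852611, 5303489506697575309848189571492527417398633070168828190458496616150213573579543273024995008226074298, 73250744997663701283970),
  (323017965349277, 103572630027784754934891697929931665055119148645041483373380094901335278645604340356758195053456945005256384027241553598043588378533019580976514864580864093101368373723593142624435549149766540336240999209064741474556982708986292143307, 81396628879361882420433),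
  (7729745003298004123309961, 11271209125075615063918877970269736242855933408453779038933862448323360846530918266996585244613091679320274657846020755227416586600488, 65104858077966431138471),
  (63882190108462258933499, 11271209125075615063918877970269736242855933408453779038933862448323360846530918266996585244613091679320274657846020755261918077223189, 65104858077966431138471),
  (527951984367456685400, 11271209125075615063918877970269736242855933408453779038933862448323360846530918266996585244613091679320274657846020755296447863210190, 65104858077966431138471),
  (4354812572051910805, 1067558579372234217970950374177238143364563110973946994957039118115588454937130253230747332121931427499196002009166912384731685801851261103744086499938796980559025447480655209722429283, 81384397061273482753830),
  (62957689651009724948422, 23233185103413827561482741924902894098313366889249752714441021236199013948684975283320489969502025876275107762043775710061907626923991963847716941346482328943200416171, 81385408714831668067962),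
  (9765548707941303777898729, 23233185103413827561426506167650235039376783695775618829355746187755077866880012007997670651280193779831715569372972353858083661989795353358584287663153519159411583844, 65110470438729561831953),
  (78559310827273043059095, 505616176428048862824470015862972397667096278074274032758587087004529977866006762875509038922434161705605157982945289988517130563778415191687619648226, 56976810362400866450227),
  (649250502957151123986, 505616176428048862854264352784550048565371878832275213194196382329117115642334315998633816043750182883963831269184598972382162826171998769105779393056, 56976810362400866450227),
  (5365706629050498347, 1067558579372234217970950374177238159138510006277485139081626376688806180628290449605633227382701968582343094691655063245618461044617529074902946837586434946095585412269363352088555019, 81384397820771863767026),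
  (35537964876127671, 1067546706794061167367916807727411954156293854114110689542937822658175739697669527170896724295027494979010033750155024796432476044325634560819231611149607335258287939651587832097303316, 81384397820771863767026),
  (221230352886258, 1067546706794061167399394571826328971205707650800369084973187542448963515399556789764339549592854398796414647505800740886367581991122948045259817089175702713949502628954395703862804188, 81384397820771863767026),
  (8707374125002837655919538, 1111025642770370527425732240211296375221233111244015803897120509843362731447304336413424789725336387412346079347353838730073664966242698234989584082959141165351932476008879049257668916, 81378788118260373869623)],
  [(71955190048497377815502, 2254019350745108635561270793694723597058354270512635155507232464518206106698976193391872229463036486143710828931571061674365502445328933370760744341515087231534399131929529725728740851551075297702809448756558080722944, 81390512970315228543237),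
  (8610246370608045521127529, 2312125730557795292751026515594213253754192456086459439469342085973988754892149040083029622596631753678909572012370940503195483384101907208171159791766007781592198176772271535067863574336793431415833971707458536713504, 81390512970315228543237),
  (1052681910010806342275725498, 103571580274002051629872940860879383213056878034090879130409766128770718639588119628904923424400309600107148651334551582709487566706822597044609001179373249735233101763021458130908826337984222120281356062256857244570487905501462938653, 65116079003420928252264),
  (8699850495957077343205463, 4759086135133673413241593781433382146709927511133830537502074928773373780121433282189762813616125597931604705343823841228365795317379153303428006932317131848961883137862941921525259329341635644796620151521396955201458347108849398664028708545060725378, 65110470438729561831953),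
  (1062621246807440509901660312, 229066171088218451085208573538171698150401837282261426690268234410930651005265311276697710133093815907077181524881595129403008173161885468476745011757490233520243723351619242429648713730861797820839377167978561196268568528058384141682160113031164564581068246710424293, 81390512970315228543237),
  (8699850496026122767493325, 108491329547964090818926414671483648895517039531845667613409500626023972251280550137961375518589093154663649342195656448059019688089923258287855078355975595963837907861172693513408460480410018985012427507582069772872070432511686260082, 81396628869007669711373),
  (71899590875362455500692, 103571580274002051538370580457295525231874206925424518398187067213947179348221565905877777286742527188614617311752572547455184081335608711002623456492548007690708129054681523711806175264431299140153668067720500508667947428315414364709, 81390512963417687809604),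
  (593651329824586756867, 4759086135133673409011646723504183065884315830291354051258454692576610626585605035603019890795681003323552932253636034607623904335297354886256850286327991239016120045039395570248808971291449811077800548028518376177755530977579890731606705306220409886, 56977322303148496590891),
  (594156776853086050638, 109053477751285711820571228884682218233914157590604414639617993470614605715073685962716666229819285063838774870912222821511491388058158907545262224845212525906111950760962287756988351029138684362932028994445167566574663395611738173487, 81396628869007669711373),
  (4897441082636657974, 103571580274002051538370580457295525231874206925424515117593620414139463389544844221445191252502285366284468784070153971036607661296992154162300553141115150829429507120107485691796430588646176336908658053705741551251824138988780469987, 81390508753070772970385),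
  (40474719786552877, 51775889957274106817605668437316862346042570939765889317057213492809762064849956199683945470088737912959153951854204171694040241754529928417748129916484395970325992784554168383385117528359312268002524, 73244122123446748965326),
  (4897441945645512880, 109475108385049212746509214084464655166558991016149214039981905934131694803435117162927121659351438930357312212610398324294448761721648263219829942177282098384039943026080537224686123491435560013908210144620557695150465238073421298415, 81390512963417694895848),
  (4897441971582937481, 109615786858136978238582872706803328182018201193171228623931018217215417702053675417940690378231251179077244683304216290220799071337482163912265008653770782973315636722904573603388782446795677319511169164845826307627425171130276933332, 81390512963415103263158),
  (40474722144500568, 103571580274002051538370580457295525231874206925424472031334194859596194930828015608528416435356788343941359282751226174073238449623244477694032140365603378970960023135221588856728364152126526155494223734861233441199182790833160078847, 81390512963415103263158),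
  (334501872784278, 103571580274002051538370580457295525231874206925424472031334194859596194930828015608528416435356788343956267920816366926620747948841127115436618831999424360611839519425097534101799229605685387797151420714684163467827813158458128381615, 81390512963415103263158),
  (1828464851852, 103571580274002051538370580457295525231874206925424472031334194859596194930828015608528416435356788343971192437421067562539283096642607762871045978402596497371829935942662819552766834520096807813163330437668333557422983382052634141967, 81390512963415103263158),
  (2771158843971, 21215818488463922778661183955416059671655229082276512377943701415561549252927762347155833774906989039228160992387942086756274825348686424631935734512173306366397388876436789608130885422794058958228347972958924505297941816763243705831931565868854458926664462677962746487041026753881365748701892989153135768612867959957, 81390504539882973087455),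
  (9758770107780771892727562, 491784142465996059515832396404693485770793433322688099477246676385046660751859116553417727827236088684087353271259673189293179114188905411110110648276455507185900608216792950863116811670390146162830495841368153364743235407488462139075830099455893956340423733538954224409959892646349664853879050931062, 65790340743044183917414),
  (80650992626285089387413, 461713372174607305864456303970038097344742546947073677943820648434722129035269653576255867424986179907317486567468466858827329601470800717795375615949450474165316757141325098012060365624788638837753335838585299026511966040288669653786969914830636035800220682850832290044178056342454968763956978676834, 73257360616064663094617),
  (666537129142928299235, 461713372174607305864456303970038097344742546947073677943820648434722129035269653576255867424986179907317486567468466858827329601470800717795375615949450474165316757141340028899606009017968123353114358832233494394331927598364552126751609904583991184762594994249309474339165270383898027211504943170344, 73257360616064663094617),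
  (593743230171079712538, 491726671337355536648884095461144930161711278159017991992767114005738219037539584425518881706747514419170856688494235451674155049949607462179578940058909817280460640220886523364207460054598010429316061208326765151234868721843723180824878990107218271639206175035904239462283556138272508246146919434462, 65103847183910387422311),
  (4906968837333265825, 10686316211556630242238368023260787726405948472176747283491233222106460403834368381029342739738181954990294692734484780597656242129216146575168597802744794981038129335214384912757627234756426805392543920833853429544913035038171965814733189499220989090128329794215024010547766501143023, 56975804064453792288837),
  (71842930850705343724341, 10770947681779418937047169854550915313294701369290732190680600804248766799449335673551427670094960773509774269887336751614116002776984809266547867511802461701765013498957900165400374658090260818723155740528076620052265507558923681270091881800692168507187686046787093931837487176619303, 81390499187116207686236),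
  (593743229322023672068, 10743701280616534473718522179249186332503968755606919074074304872154301870419720603392543507727806206305725763534234040038472684165020382437859180781872789202020949931820809604120238416387283546817124052208348186626332823089853208276029494376327911121839618433383449530812126855027050, 81396628869010261592962),
  (593743230171099199709, 10770947681779418953340109790335766441703311582751633330625054331589990976846495869737895233969675770024016567486554917849449390311673501512731635126067837232439750848665570117498526851344358836357752259565129214683674747148301904984385633226183213042266705977904951047456908204339372, 73929094745669677576540),
  (4906968837352752996, 10743701280616534473718522179249186332503968755606918368029920108126050361302364544700684340210719939991248467680785498745719756289021075256065333358172842133234541591248216186977520750329905227275676889409883572399024146200890205540175961000796052358173080070115958039369342360799508, 81396628869010261592962),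
  (592590374161201625936, 497428102854829814445355603710252700917002055565880790499248861289088943117549386234188490698813613340940466684035610998017289916768476609285534938852394270648266364074339971124673761784872750253233922186728527854992680710506464157241634479995606746798543748053409397289817631109656886632040131617514, 81396628876197516619111),
  (592590374446513296547, 497366905058765671768861004939312380367102259126869755231200813517275748679977092245185335796861517879260713046130576492165406224373876742807285718935578018627164897844179336400574528721976008367613918950431782139852050958147080593136609041259601104496914200885741857490437126866098487325471563740167, 73250738880527659656777),
  (4897441117910532478, 22856686952728618044995141214747916577150494101368082876495835997893281983482393607346219642297630886898318276568444843877869001393909999325107756208974593007976310763102297858974235118215049742012823930266083307732063962460521495495271980744674511755563326173213569028273094251275238550224539955221245916365246657486, 73923493473596926960207),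
  (40474719983519581, 22856686952728618044995141214747916577150494101368082876495835997893281983482393607346219642297630886898318276568444843877869001393910001028347341497803821052208443536345907955502125651557541026784253238827993260039732125800105201967712197492536938294153139155495248773967567630201895478038640482050080122889390732422, 73923493473596926960207),
  (4915019186949176471, 232592985605928929856795530325037521604508618680245577150821323887249204432994723024195424061756230789701372190727119026152890011026364162525244781181198359117784673973665597230767242357025394055305715606113797541530218607588996630618906671741396249879505790522129588, 56975801367091319619434),
  (4914943588376925730, 500432139042322770534161194518518067907645245332979168290122319567292493857747554239239005063371286867620306961680437490200167700935849796211784217160921741709534161593143566331664541408340887869582894151769295351216775785854096057563425938988250437777626046479475677703006233855365482542068085624511, 56969688154270309081042)],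
  [(40474724502444254, 501057697063100222051812692976267752617748626398755544737756977502864375431520160603676441897305933571540150945449045696281923773119292289197830537139403403972187791958016393018684323707800887665248312928115684125967975925469787187755054640507263440509553714069526652118518659475340707858961906882122, 56969688154270309081042),
  (334501855392101, 232587852238927879394598720929990289530082799825402889118475605778751808163369863747228770259341924364026191885082291798608718769949849230684441086378109657216524290767886739353691153021965734744931112551146222086523432562985199402088380121441260092180200225616727795, 56969690053019464522026),
  (40619993280715410, 10685107666314849500215608190675433114691571320733310093836502111513782651063100694352713568445963268014041162412588190339305450606916408213202290192101225389857362975565749499215586255188161724804426492447118864416215389880945485442244567504647955446536128352477186827215498058056674, 56975804061575165587485),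
  (40619368382059831, 502937847035358458774657246622473697511086343320708260309068847016280436745714167997069722222833297908007961949735806998357456926174621908919154477059312861808631087430018056810013072821766836714407406332579208137021008643497987068383032348553034330701596044048293328047565448262591607078220137002786, 56969688154271809592120),
  (335697260465876, 502938105544719480818141556014163128811361026567455720129816501869455366698802889652563213862824040955306079097565984359775915547774382920069426237784979440159206525534717268298500144107816735225625693461165275781314811849709607553016739301876493793864214976089135971181836283370625046781442621796865, 56969688154271809592120),
  (334501738469075, 504189896681735087863303835454134647447118669695103768552836911840571293385481339581541942992829587076143529941376501816658979663456941947209289111138536700844407388656294230349992061637636363390023272275782107091812476760336919595049354908131126395829626483171667890281029952151607072257505628030248, 56969688154271809592120),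
  (2764478287440, 504190155191096109906788144845824078747393352941851228373584566693746223338570061237035434632820330123441647089206679178077438285056703021409049062905266214731596520318820991628492584926261407194233410404569368947050189329086542803444864970465073384585623943014442176916345077054212247034846555285353, 56969688154271809592120),
  (15111279734, 232587852238927879394598720929990290794875145520564954341084815555408102567186142552716027801159678571719909401468038049422505189200338697546330915970383841270746312617721060819371776054634087931765382668287226569408547065319488328146931205801439324345838468069110499, 56969690053019464522026),
  (44379205656154810, 113521043812052718191886428489228065051224884326948143966838025949478208026092352299770927298804339842438321756689018946211990500644793745630734777196637481598230790657741145941519291000178848136866384859976690299866536245185426325043, 56976810364396333274068),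
  (44379205655979118, 11013518134292976859834452190212314768737663737883802263722119454894930603040941279660661562084767963042482349304760680470857396152381189459906241618631043412966205677924658127003199699634214182707110737639878047872285002914128046669186801540194315605269119754745757290052996973255471, 56975804064453792288837),
  (366770294684003, 23256311351766755795884863350046177714890687505310641559798878592499893082548828378470976695530820708445303610180686248243179968203987554163233444524462537529211901867962910609499352538748049901439612135087487604403211367962575275746048861193915213566348173691246039196008474849016600479923617974073947450532324462308, 56977321540483178597158),
  (3031159461243, 5215683955769389800925223147378198198472121247902777037245656574144769666104231369904128618364524439340148934787765741892809171745886756149884829513248899721168261709883676930249896373175749095451892260744715782558714836706454302937293773072916477396, 56975804059862866846052),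
  (2722053954841, 114110323984718301056824419403263356182418293524790462889024668965974230406647212638537290793633109608404334069710446536960780336541451302023648650468786754292146090317547504780139775286524983172855780798767444480039232925932734709578, 81378281153088475093670),
  (328224958551601, 240928207150515101649529201453365339173398241213949491539614779597552893493466058350975527670867643845512111896614158055384846390696733563644101773657031150068488971564903848713816895319265103504994064280864167786763752376968062421271135025446432391080930856008645715, 56975804065027006135394),
  (2712602969726, 240928207150515101649529201453365339173398241213949491539614779597552893493466058350975527670867643845512111896614158075283052714928856116553205527668834368975964388003802200594019266386584577032729701150880779675990191690400071426457248488320499368665726662770594874, 56975804065027006135394),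
  (22418207527, 240928207150515101649529201453365339173398241213949491539614779597552893493466058350975527670867643845512111896614158075969124545345762453612244662780531147654408563431577979160003581567241856449333264214473707921617343091260378144487284060473611618477775489194947485, 56975804065027006135394),
  (17487953264, 114672683324820278318714005620866104131376312361108594730107726413759801989289810012112610810445049364154417217569765775586887736528638248329397089708260076716563697099110454436465506022119728343178601922912646207903163443443484197047, 56975804065027006135394),
  (1828466478334, 232918295885679561004637539963521110448150807309386744289600200484090053617668563178583873598620585165360107982257621102331334833482304719044985472397924761719786003034240952472013775692782887036425364827309756727951823734074343048935403926318209501204558325824370750, 81384397061278451382154),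
  (15111294375, 242710320114126662883115519590435124146140475581795691145427495259603977893890335568385276118079776919472988420490582864187483272318208381340418406488182428462982648582600160438455399004799468271144658497259666958643324699767424231496240520794425195737336574120250225, 81384397061278451382154),
  (124883903, 243007710800820220735191759714498538865201840652371649839607213009247353457244839943693378053307931822474576799511222797985855566602079469065417191040583778905287189242351843471670819781594261349246069516344023918148642219625729325555580580584496860440568721046402548, 81384397061278451382154),
  (2476903879561, 513655627662866941918023653480235754525295161855772234173530072515323211101339167087669609482911386500566313015463472538947357701293871266189722666302230731269759624337049627819790016051434213634322444064444678374932999276107267072876072268709753996223087109595253585674603393312238768997637799516983, 65103847183910387422311),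
  (3047527220783, 461718024269825501036010987882423392845269536854697533001157586174061111751575631483093622857160066347098067729346922643494542140197773670891244568646320175386676562536681667796637669532278762374635631882245831619056874872783578101314768594078684729091271245972726213473285726851983290162108848082848, 73257360616064663094617),
  (1554673658396, 11193489235257784379864109240610742367034608899255110499475630071125881359321818333300762115225046818839796129308708162062386268811881702066279787105551854385753390689284171297182556400129014971074530443883942235871884387135290915358206742451800265569031548498010797340942562662502960, 81390512963418110568479),
  (12848542466, 11193489235257784380754261583126289543967652404715324538422214657453322871406316353286117601499732668989496090557026087558644624452214441550230698843106533271917502263582269617799953821235418733552537207469374912075830987259845084781297550929333011598817806638739937542053270135204827, 81390512963418110568479),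
  (22828228732, 516206453098634400273935351234966640629761875716573172575716066019497372799643907706076576015722713462383036153105335695047816048648295342271121405315335380197313224438763953646280942741161786194218849214356720155720240885684047035035657762301439759842776119811675250374168534593368582888208878489785, 56999560073654604866344),
  (106187346, 516206453098634400287599436812531205574111566775618582377166291703350603128009460860896691454448799240625376223454408046233250886833970064396343350938763172342345070615430643748092209104277023622578028751960073966165615018238028668891916809634753944528309750733923444756474409653846972418140510941939, 56999560073654604866344),
  (874633, 517461320405417008513019152725284549283939094524890555265558344797162833227327574122861069047713902287078304217192875959844066397156587817566587290967638272405474241462488310538908822967474230593519292037176718609404870106601661902558084780758167960089603903692095230915536534571258388614932343746736, 56999560073654604866344),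
  (197955781, 5340311964043019483691650113180163823259028957871593046376889465368278856687603156897664793804251408778745351332682974297969512187545576771958870195285357158507473571518879411837375778141328753640031476680423009499337777174579063590332086625042690004, 81390504539882973087455),
  (12730301783, 11273970671173028602157180273805700019142221425492981002625311301303118757316725837265863189646009256032116252945471243590548561123442217343875772606885721151938308753257803042028315913867040827524980198524166002877648313421137278932683058200134565419978165258085589466489841117787327, 56975804064453792288837),
  (106158097, 11275414939588500891818756101863469225422900296288444250969666188793704802626413738975313050019977462637727040464001262658757978575917253898065630485301332221761173446335991303754051007268863802013762846012430222083883968456641802935920333338456773650168490291217232757179220688452771, 81390512963418110568479),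
  (105367483, 23806443092777810480127694983662345921934270049359985182013199702752122863539260215775506975143171729758565221310389631183978845966254484599181941864384796175171425296660733088300857902629380207357325135834929095172846229617566281851903723880443759299346692196515443902580823823799243620891338170653979277686531097718, 81390504539882973087455),
  (874666, 23806443092777810480179004351313309625158948739420039574425613603141210469900628149989212378000339805494280061537949031644829193864391018999240390436863621724887848990872019708177386453061752720040192009511228946396447244923357193700655082372314992633436545671268609377949739144463101185695311285120847543683663921641, 81385408714831668067962)],
  [(1222431, 23950139373410217711525732323419309158787524050253310201674905257431358166146181856604137230304267978989812317461385580323312665339621461163285389486809634322256036642310166885669182181392586117497634257060668896312200555339313784962720918103386953040462086449577341832630964344588232197545093524439555090092539246457, 81385408714831668067962),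
  (7228, 23978928172140350159308524798029287686374245549897689446074356616190411305243248816292563918306767268252221357563973602835987920298166396879307188825831464812109904311431769312719177754866823356022228614410132737009995887933980755709286747623311631870149698823376485298324403923497563255142514654127475881060517625556, 81385408714831668067962),
  (59, 5385514788494661582388418587912054467738253206561762098435894062247956328057143328785567020026996738916938889674459394098481483136020615009019329168817319981342322024733079164978802041159743332648762778640568687066281493877288550514412605608560187375, 81396628879356691424601),
  (0, 5391764218918391050876602203823588547081220276752309246163876765175469056552541882705096728699635672333988577501454066990268370460706502801219650567277550762232776488030086269156176798229476155648100868517053398285527852861379345025614781683503280415, 81372165243187700575926)]]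

theorem table_eleven_ok : tableOk ⟨11, 4, 0, 0, 0⟩ table_eleven = true := by
  decide +kernel

noncomputable def table_rooted : List (List (ℕ × ℕ × ℕ)) := [
  [(256047496048476, 0, 73257364834732307965914),
  (531485556576162391676, 0, 73250238032488996839758),
  (531493945880525037520, 0, 81391018417342943489963),
  (7781480041772074423314573, 9879248793457094460021622907783254161736353583990398101224882584, 81391018417342943489963),
  (64309752411339458042437, 215001237717593743938789523420559510692898170245, 81384392467728362544787),
  (252595696098735, 0, 73256355076475561051711),
  (531485557116149966121, 2372777773438297081411600394910, 73256355076475561051711),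
  (4392546472138115742, 88990808637016, 73257364834732308009903),
  (64309752411054145711661, 1223550628328338955656721317732627369780633560667222471806872623185211720589018389, 73250233438383991157763),
  (7781480041803177816888023, 15334525769077313763708498075020587458620692178135181617895717946, 73250233434070642267110),
  (64309752411596431000734, 579503441324234006130753350914126345605934507304, 73256344752446394816917),
  (64309254970698720722234, 17082182377280067136269401329911, 73256355076475561051711),
  (941559086073603932351286705, 18642280640370991433422408078769, 81391018417343157365690),
  (7781480045914799800526643, 91516713058654866879413072755952146094063351949873481412544751488302130919897705076911961487984558, 81391018417343157365690),
  (2116094847460, 8822864723298625817814936962528, 81384392467728362544787),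
  (7781480045980425986303674, 1811166289771632158459283704689160008393207642503590001522538250942240752395194105, 73244119047190379658339),
  (64309752446119143144665, 1811166289783401055866432087014255520425304024167852103467337966735461814463115720, 73244119047190379658339),
  (531485557092293609014, 35430249920148573556446448314411187745277569815066776069105644186, 73250233434070642267111),
  (64310257792458560137354, 405424566949655, 73250238032488996839758),
  (7781541196716370988175590, 61947896770663493117959437928634070548607388804422089600233164911, 73256340536656927153451),
  (64310257824102218150574, 61947896770663493117959437928634070548607388804422265352880959877, 73256340536656927153451),
  (9751237434958463498690845, 28327987508788865205177566935469, 73256355076475561051711),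
  (1179899729613644843089469018, 6686747359340670656076177170875764272816793498717825270007618417006395655358923395601349705458996123266233772314070, 73256355076475561051711),
  (9751237434823511078491842, 73515892548881851138595483289373122911222468766366336248284862914, 81384392467728362544787),
  (80588739131315104119584, 73515892548881851138595483289373122911222468766366370770997004205, 81384392467728362544787),
  (531489734340463024665, 83704493923350277317891946658586067067928052015665904315277011188, 81396615095302735550708),
  (80588730874110044966633, 28327987508788865105033170551008, 81384397820772291885597),
  (666022568634497064012, 86306427933976941077891786091664827524427047118025379995866111270, 73256344751592174514354),
  (4392408328921517773, 2040325118484357186991933506888173739793545668006, 81396624280942662361649),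
  (531477268502950688853, 4427453001101261122350994654926366983341754992307652068326264533537504126426159823, 73244119047190379658339),
  (4392373806209373842, 4399473370701815969618845271704084454216046748010188211519334914335608409891931236, 81384388632258279368021),
  (36301126316536983, 4735250805147819561951960756734662696600728131304031464599439232264798482802365677, 73244119047190379658339)],
  [(5504318458975184431, 106402197080022983272151283643173518790832884530677196582161601190, 73256344751592174514354),
  (5504318692412005840, 109114870592995555233692366988064194486601721119504448772097777606, 73250233434070642267110),
  (45490237104179263, 4914339935559250700759058489207828997541431373834568736864049851328712635102100541, 81390509514593551848247),
  (300006907773584, 2550558504280078561483880414746024131575748161269, 81396628872458408275867),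
  (2479353252156, 5504748380672881076859458875174949011774881872979036753728657691718272401714013266, 73244119047190379658339),
  (36301464053080820, 12310144490239712223852757751904, 73257364834732522002758),
  (45490237654203287, 60198383388325196520952251968250, 81384397820772291885597),
  (375952451388217, 61784650060057009196610361088270, 81384397820772291885597),
  (45490246578487491, 2897541302648833599107103957414356990047809061642, 73250239550633682312964),
  (375952372599419, 2970313289373903610340661892030783123425700405424, 73250239550633682312964),
  (3107043887871, 3043321290705320425222606754781136423332070239366, 73250239550633682312964),
  (20490360352, 68198058684240729080274140470581, 81396624284964698015450),
  (375952451060538, 2897541302648833599107103957414357231706794055849, 73250239550633682312964),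
  (3107044400306, 3261875224114315825257510547867797020260192776999, 73250239550633682312964),
  (25678047318, 3334883225445732640139455410618150320166562610941, 73250239550633682312964),
  (169340479, 74543295872926695619590872284352, 81396624284964698015450),
  (3107045036645, 2883685675293737750626385449545604450299603397055, 73256355079924810449658),
  (25678058087, 3539699049146178204390572420718621153267160538413, 73256355079924810449658),
  (212215256, 3612352950358993065638194468794021328674043988435, 73256355079924810449658),
  (1399497, 80888533061612662055339467677220, 81396624284964698015450),
  (11506, 82469663367863164144782936573822, 81396628875914789334745),
  (11, 84058572816855070300852783092724, 81396628875914789334745),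
  (322209677109541, 0, 73257364834732308009903),
  (1179899791282846911633457631, 0, 73257364834732312987843),
  (17274912844171647798003165751534, 186752243930292523976086894176183843265667637800897982131883042557, 73257364834732313280663),
  (142767874745220229735563353285, 4136077124603973085078985751260248451926052572169, 73256355079924809805454),
  (664931927713982306149, 0, 73257364834732312987843),
  (1179899791282812101308224299, 186777636463600450579236586129115047635840882188461967691513540531, 81372166763328281591334),
  (9751237944486050424033569, 186447762290751106268072894457000254746082839491788633003174268431, 73246143908397666170273),
  (1179899791282811537505074685, 4428843860727610144593286844866961494698918252227, 81384398200525360338135),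
  (9751237944486045764504694, 98233055376967070131821195873817, 73256349725454751473675),
  (357017683063516, 1833124630558969, 65790340739592343208445)],
  [(9751236929548846299120554, 99410367060187465321228360993096, 73246143908397666170273),
  (1179899791282846624020205836, 209892848535440300299639411665223946547357697655877268367873581458, 73246143908397666170273),
  (9751237944486331076175305, 4793296279153125413236768825562653480036232464657, 81384398200525360338135),
  (80588743342852864874712, 4866068265878195422887670818400069407478452950028, 81384398200525360338135),
  (666022672254982354336, 107029861479463523408119435782758, 73256355079924810449658),
  (666022672255058531459, 108930780296206241849748504194842, 73246143908397666170273),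
  (9751237944486335716217009, 229994017587114743066874902693547639252695553626986217527707068500, 73246143908397666170273),
  (80588743342862220811798, 236997159357929684256821019536721341178433273990205184340525838772, 73246143908397666170273),
  (666022672254962867165, 240341012489582110542739371823680833658500762568348645989829195503, 73246143908397666170273),
  (5504319605413543147, 243695691366478557468927733181673947322053345219729475568919928894, 73246143908397666170273),
  (359896951553119, 1833124630558969, 65111984896472506362767),
  (5504319890725213758, 247377215251387119853267185961883380517350555891832017188923344945, 56975805203990318291812),
  (45490239937907844, 5536056331911241656545645376394715668726128840594, 81384397820778118548637),
  (5504319893083161449, 257419664452950744548425750575392203565116043995695016586569285660, 56975805203990318291812),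
  (45490242295855535, 5681837299281447765587800162384138987096249224889, 81384397820778118548637),
  (375952377145083, 5754609286006517775238702155221554914538469710260, 81384397820778118548637),
  (5504319866910119235, 5827448025880502508921488926328389892944562130124, 81384397820778118548637),
  (45490246776133304, 5886653534429671222350118376758650556464768120839, 81384398200525360338135),
  (375952355886351, 5959425521154741232001020369596066483906988606210, 81384398200525360338135),
  (3107044890413, 6032433107637985294168588241465956781599501818641, 81384398200525360338135),
  (25678056934, 6104722173345590070683795345111612736850929759754, 73250239550633682312964),
  (212215313, 6177444786337312980880094098540634358435008751536, 73250239550633682312964),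
  (1753845, 6250502572849854789307941968988287207733472707078, 73250239550633682312964),
  (11566, 137995667759786358931980176802449, 81396624284964698015450),
  (95, 139576798066036860875629382001100, 81396624284964698015450),
  (0, 141165707515028766997176980202951, 81396624284964698015450)]]

theorem table_rooted_ok :
    tableOk ⟨11, 4, 1, 30374224853801112390640965553420786015, 0⟩ table_rooted = true := by
  decide +kernel

end Cert

/-- The neighbourhood of a vertex of small degree. -/
theorem link_cases {W : Type} [Fintype W] {N : SimpleGraph W} (h7 : 7 ≤ Fintype.card W)
    (h11 : Fintype.card W ≤ 11) (hcap : ∀ v (S : Finset W), (∀ w ∈ S, w ≠ v ∧ ¬ N.Adj v w) →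
      S.card + 7 ≤ Fintype.card W) :
    (∃ p, (⊤ : SimpleGraph (Fin 7)).MinorOf (N ⊔ starAt p Set.univ)) ∨ Exceptional N := by
  obtain h | h | h | h | h : Fintype.card W = 7 ∨ Fintype.card W = 8 ∨ Fintype.card W = 9 ∨
    Fintype.card W = 10 ∨ Fintype.card W = 11 := by omega
  · rw [h] at hcap
    exact Cert.good_or_exceptional hcap h Cert.table_seven_ok (by norm_num) 0 _ _ rfl
      (.inl rfl)
  · rw [h] at hcap
    exact Cert.good_or_exceptional hcap h Cert.table_eight_ok (by norm_num) 4 _ _ rfl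
      (.inr ⟨_, Cert.exceptional_eight, by decide +kernel, by decide +kernel⟩)
  · rw [h] at hcap
    exact Cert.good_or_exceptional hcap h Cert.table_nine_ok (by norm_num) 21 _ _ rfl
      (.inr ⟨_, Cert.exceptional_nine, by decide +kernel, by decide +kernel⟩)
  · rw [h] at hcap
    exact Cert.good_or_exceptional hcap h Cert.table_ten_ok (by norm_num) 81 _ _ rfl
      (.inr ⟨_, Cert.exceptional_ten, by decide +kernel, by decide +kernel⟩)
  · rw [h] at hcap
    exact Cert.good_or_exceptional hcap h Cert.table_eleven_ok (by norm_num) 835 _ _ rfl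
      (.inl rfl)

/-- Graphs on eleven vertices with a vertex `0` adjacent to three disjoint pairs that form a
complete multipartite graph. -/
theorem rooted_cases (N : SimpleGraph (Fin 11))
    (hcap : ∀ v (S : Finset (Fin 11)), (∀ w ∈ S, w ≠ v ∧ ¬ N.Adj v w) → S.card ≤ 4)
    (h0 : ∀ i : Fin 11, 5 ≤ i → N.Adj 0 i)
    (hQ : ∀ i j : Fin 11, 5 ≤ i → i < j → ((i : ℕ) - 5) / 2 ≠ ((j : ℕ) - 5) / 2 → N.Adj i j) :
    ∃ p ≠ 0, (⊤ : SimpleGraph (Fin 7)).MinorOf (N ⊔ starAt p {b | b ≠ 0}) := by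
  let P : Cert.Params := ⟨11, 4, 1, 30374224853801112390640965553420786015, 0⟩
  have hall : ∀ q ∈ Cert.pairs 60 30374224853801112390640965553420786015, (q.1 = 0 ∧ 5 ≤ Fin.ofNat 11 q.2) ∨
      (5 ≤ Fin.ofNat 11 q.1 ∧ Fin.ofNat 11 q.1 < Fin.ofNat 11 q.2 ∧
      ((Fin.ofNat 11 q.1 : ℕ) - 5) / 2 ≠ ((Fin.ofNat 11 q.2 : ℕ) - 5) / 2) := by
    decide +kernel
  have : NeZero P.n := ⟨by simp [P]⟩
  have hN : P.Hyp N := by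
    refine ⟨hcap, fun q hq => ?_⟩
    rcases hall q hq with ⟨h, h'⟩ | ⟨h, h', h''⟩
    · rw [h]
      exact h0 _ h'
    · exact hQ _ _ h h' h''
  rcases Cert.valid_of_tableOk (P := P) (by simp [P]) Cert.table_rooted_ok 89 (0, _, _) rfl N hN
    (fun q hq => by simp [Cert.pairs] at hq) with ⟨p, hp, hm⟩ | hx
  · have hs : P.starSet = {b : Fin 11 | b ≠ 0} := by
      ext
      simp [Cert.Params.starSet, P]
    rw [hs] at hp hm
    exact ⟨p, hp, hm⟩
  · exact absurd rfl hx.1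

theorem IsComp.sdiff_connected {V : Type} {G : SimpleGraph V} {X C : Set V} {w : V}
    (hX : (G.induce X).Connected) (hw : w ∈ X) (hC : G.IsComp (X \ {w}) C) :
    (G.induce (X \ C)).Connected := by
  have hwC : w ∉ C := fun h => (hC.1 h).2 rfl
  have key : ∀ v ∈ X, v ∉ C →
      Relation.ReflTransGen (fun a b => G.Adj a b ∧ a ∈ X \ C ∧ b ∈ X \ C) v w := by
    intro v hv hvC
    have h := (induce_connected_iff.1 hX).2 v hv w hw
    induction h using Relation.ReflTransGen.head_induction_on with
    | refl => exact .refl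
    | head h1 h2 ih =>
      rename_i a b
      by_cases haw : a = w
      · rw [haw]
      have hbC : b ∉ C := fun hb => hvC (hC.2.2 b hb a ⟨h1.2.1, haw⟩ h1.1.symm)
      exact (ih h1.2.2 hbC).head ⟨h1.1, ⟨h1.2.1, hvC⟩, h1.2.2, hbC⟩
  have hsymm : Std.Symm (fun a b => G.Adj a b ∧ a ∈ X \ C ∧ b ∈ X \ C) :=
    ⟨fun _ _ h => ⟨h.1.symm, h.2.2, h.2.1⟩⟩
  exact induce_connected_iff.2 ⟨⟨w, hw, hwC⟩, fun a ha b hb =>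
    (key a ha.1 ha.2).trans (Relation.ReflTransGen.stdSymm.symm _ _ (key b hb.1 hb.2))⟩

theorem exists_adj_of_induce_connected {V : Type} {G : SimpleGraph V} {F X : Set V}
    (hF : (G.induce F).Connected) (hX : X ⊆ F) (hne : X.Nonempty) (hne' : (F \ X).Nonempty) :
    ∃ a ∈ X, ∃ b ∈ F \ X, G.Adj a b := by
  obtain ⟨a, ha⟩ := hne
  obtain ⟨b, hb⟩ := hne'
  by_contra hcon
  push Not at hcon
  have h := (induce_connected_iff.1 hF).2 a (hX ha) b hb.1
  refine hb.2 ?_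
  clear hb
  induction h with
  | refl => exact ha
  | tail _ h ih => exact by_contra fun hc => hcon _ ih _ ⟨h.2.2, hc⟩ h.1

/-- A cut vertex splitting a connected set into small pieces. -/
theorem exists_cut_small {V : Type} [Finite V] {G : SimpleGraph V} {F : Set V} {big : Set V → Prop}
    (hF : (G.induce F).Connected) (hbig : big F)
    (h2 : ∀ A B, (G.induce A).Connected → (G.induce B).Connected → Disjoint A B → A ∪ B = F →
      big A → ¬ big B)
    (h3 : ∀ A B C, ¬ big A → ¬ big B → ¬ big C → F ⊆ A ∪ B ∪ C → False) :
    ∃ w ∈ F, ∀ C, G.IsComp (F \ {w}) C → ¬ big C := by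
  by_contra hcon
  push Not at hcon
  have descent : ∀ X, X ⊆ F → (G.induce X).Connected → big X →
      (X = F ∨ (G.induce (F \ X)).Connected) →
      ∃ X', X' ⊂ X ∧ (G.induce X').Connected ∧ big X' ∧ (G.induce (F \ X')).Connected := by
    intro X hXF hX hXb hXc
    have hcut : ∀ w ∈ F, ∀ C, G.IsComp (F \ {w}) C → (G.induce (F \ C)).Connected :=
      fun w hw C hC => hC.sdiff_connected hF hw
    rcases hXc with rfl | hY
    · obtain ⟨w, hw⟩ := (induce_connected_iff.1 hX).1
      obtain ⟨C, hC, hCb⟩ := hcon w hw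
      exact ⟨C, (Set.ssubset_iff_of_subset (hC.1.trans Set.sdiff_subset)).2
        ⟨w, hw, fun h => (hC.1 h).2 rfl⟩, hC.2.1, hCb, hcut w hw C hC⟩
    by_contra hmin
    push Not at hmin
    have hYs : ¬ big (F \ X) :=
      h2 X _ hX hY Set.disjoint_sdiff_right (Set.union_sdiff_cancel hXF) hXb
    have hsm : ∀ w ∈ X, (∃ y ∈ F \ X, G.Adj w y) → ∀ C, G.IsComp (X \ {w}) C → ¬ big C := by
      rintro w hw ⟨y, hy, hwy⟩ C hC hCb
      have hwC : w ∉ C := fun h => (hC.1 h).2 rfl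
      have hCX : C ⊆ X := hC.1.trans Set.sdiff_subset
      refine hmin C ((Set.ssubset_iff_of_subset hCX).2 ⟨w, hw, hwC⟩) hC.2.1 hCb ?_
      have heq : X \ C ∪ F \ X = F \ C := by
        ext v
        have := @hXF v
        have := @hCX v
        simp only [Set.mem_sdiff, Set.mem_union]
        tauto
      exact heq ▸ induce_union_connected_of_adj (hC.sdiff_connected hX hw) hY ⟨hw, hwC⟩ hy hwy
    obtain ⟨w, hw, y, hy, hwy⟩ := exists_adj_of_induce_connected hF hXF
      (induce_connected_iff.1 hX).1 (induce_connected_iff.1 hY).1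
    have huniq : ∀ w' ∈ X, (∃ y ∈ F \ X, G.Adj w' y) → w' = w := by
      intro w' hw' hy'
      by_contra hne
      obtain ⟨C, hC, hwC⟩ := exists_isComp G (s := X \ {w}) (v := w') ⟨hw', hne⟩
      obtain ⟨B, hB, hwB⟩ := exists_isComp G (s := X \ {w'}) (v := w) ⟨hw, Ne.symm hne⟩
      refine h3 B C (F \ X) (hsm w' hw' hy' B hB) (hsm w hw ⟨y, hy, hwy⟩ C hC) hYs fun v hv => ?_
      by_cases hvX : v ∈ X
      · by_cases hvC : v ∈ C
        · exact .inl (.inr hvC)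
        · refine .inl (.inl (hB.subset_of_connected (hC.sdiff_connected hX hw)
            (fun z hz => ⟨hz.1, ?_⟩) ⟨hw, fun h => (hC.1 h).2 rfl⟩ hwB ⟨hvX, hvC⟩))
          rintro rfl
          exact hz.2 hwC
      · exact .inr ⟨hv, hvX⟩
    obtain ⟨B, hB, hBb⟩ := hcon w (hXF hw)
    by_cases hBY : ∃ z ∈ B, z ∈ F \ X
    · obtain ⟨z, hzB, hzY⟩ := hBY
      have hYB : F \ X ⊆ B := hB.subset_of_connected hY
        (fun v hv => ⟨hv.1, fun h => hv.2 (h ▸ hw)⟩) hzY hzB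
      have hBY : B ⊆ F \ X := by
        by_contra hnot
        obtain ⟨v, hvB, hvY⟩ := Set.not_subset.1 hnot
        obtain ⟨a, ha, b, hb, hab⟩ := exists_adj_of_induce_connected hB.2.1 hYB ⟨z, hzY⟩
          ⟨v, hvB, hvY⟩
        have hbX : b ∈ X := by_contra fun h => hb.2 ⟨(hB.1 hb.1).1, h⟩
        exact (hB.1 hb.1).2 (huniq b hbX ⟨a, ha, hab.symm⟩)
      exact hYs (hBY.antisymm hYB ▸ hBb)
    · push Not at hBY
      have hBX : B ⊆ X := fun v hv => by_contra fun h => hBY v hv ⟨(hB.1 hv).1, h⟩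
      exact hmin B ((Set.ssubset_iff_of_subset hBX).2 ⟨w, hw, fun h => (hB.1 h).2 rfl⟩) hB.2.1 hBb
        (hcut w (hXF hw) B hB)
  have hno : ∀ n, ∀ X, X.ncard = n → X ⊆ F → (G.induce X).Connected → big X →
      (X = F ∨ (G.induce (F \ X)).Connected) → False := by
    intro n
    induction n using Nat.strong_induction_on with
    | _ n ih =>
      intro X hn hXF hX hXb hXc
      obtain ⟨X', hX', h1, h2, h3⟩ := descent X hXF hX hXb hXc
      exact ih _ (hn ▸ Set.ncard_lt_ncard hX') X' rfl (hX'.subset.trans hXF) h1 h2 (.inr h3)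
  exact hno _ F rfl subset_rfl hF hbig (.inl rfl)

section Neighbourhood

/-- The vertices different from and not adjacent to `x`. -/
def far {V : Type} (G : SimpleGraph V) (x : V) : Set V := {v | v ≠ x ∧ ¬ G.Adj x v}

/-- The neighbours of `x` with a neighbour in `D`. -/
def nbhd {V : Type} (G : SimpleGraph V) (x : V) (D : Set V) : Set (G.neighborSet x) :=
  {v | ∃ d ∈ D, G.Adj v d}

theorem minor_of_two_stars {V : Type} {G : SimpleGraph V} {x : V} {p q : G.neighborSet x}
    (hpq : p ≠ q) {D E : Set V} (hD : D ⊆ G.far x) (hE : E ⊆ G.far x) (hDE : Disjoint D E)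
    (hDc : (G.induce D).Connected) (hEc : (G.induce E).Connected) (hp : p ∈ G.nbhd x D)
    (hq : q ∈ G.nbhd x E) (h : (⊤ : SimpleGraph (Fin 7)).MinorOf
      (G.induce (G.neighborSet x) ⊔ starAt p (G.nbhd x D) ⊔ starAt q (G.nbhd x E))) :
    (⊤ : SimpleGraph (Fin 8)).MinorOf G := by
  classical
  have hin : ∀ i, (if i = p then D else if i = q then E else ∅) ⊆ G.far x := by
    intro i
    split_ifs
    · exact hD
    · exact hE
    · exact Set.empty_subset _
  refine top_succ_minorOf (h.cone.trans (cone_minorOf_rooted x Subtype.val Subtype.val_injective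
    (fun i => i.2) (fun i => if i = p then D else if i = q then E else ∅)
    (fun i hi => (hin i hi).1 rfl) (fun i => ?_) (fun i j hi => (hin j hi).2 i.2)
    (fun i j hij => ?_) (fun i j hij => ?_)))
  · by_cases h1 : i = p
    · subst h1
      rw [if_pos rfl]
      exact .inr ⟨hDc, hp⟩
    · by_cases h2 : i = q
      · subst h2
        rw [if_neg h1, if_pos rfl]
        exact .inr ⟨hEc, hq⟩
      · exact .inl (by simp [h1, h2])
  · split_ifs with h1 h2 h3 h4 h5 h6
    · exact absurd (h1.trans h2.symm) hij
    · exact hDE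
    · exact Set.disjoint_empty _
    · exact hDE.symm
    · exact absurd (h4.trans h6.symm) hij
    all_goals simp
  · rcases hij with (hij | ⟨-, ⟨rfl, d, hd, hjd⟩ | ⟨rfl, d, hd, hjd⟩⟩) |
      ⟨-, ⟨rfl, d, hd, hjd⟩ | ⟨rfl, d, hd, hjd⟩⟩
    · exact .inl hij
    · exact .inr (.inl ⟨d, by simpa using hd, hjd.symm⟩)
    · exact .inr (.inr ⟨d, by simpa using hd, hjd.symm⟩)
    · exact .inr (.inl ⟨d, by simpa [hpq.symm] using hd, hjd.symm⟩)
    · exact .inr (.inr ⟨d, by simpa [hpq.symm] using hd, hjd.symm⟩)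

theorem minor_of_star {V : Type} {G : SimpleGraph V} {x : V} {p : G.neighborSet x}
    {D : Set V} (hD : D ⊆ G.far x) (hDc : (G.induce D).Connected) {A : Set (G.neighborSet x)}
    (hA : ∀ a ∈ A, a ≠ p → G.Adj p a ∨ (p ∈ G.nbhd x D ∧ a ∈ G.nbhd x D))
    (h : (⊤ : SimpleGraph (Fin 7)).MinorOf (G.induce (G.neighborSet x) ⊔ starAt p A)) :
    (⊤ : SimpleGraph (Fin 8)).MinorOf G := by
  classical
  have hin : ∀ i, (if i = p ∧ p ∈ G.nbhd x D then D else ∅) ⊆ G.far x := by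
    intro i
    split_ifs
    · exact hD
    · exact Set.empty_subset _
  refine top_succ_minorOf (h.cone.trans (cone_minorOf_rooted x Subtype.val Subtype.val_injective
    (fun i => i.2) (fun i => if i = p ∧ p ∈ G.nbhd x D then D else ∅)
    (fun i hi => (hin i hi).1 rfl) (fun i => ?_) (fun i j hi => (hin j hi).2 i.2)
    (fun i j hij => ?_) (fun i j hij => ?_)))
  · by_cases h1 : i = p ∧ p ∈ G.nbhd x D
    · obtain ⟨rfl, h1⟩ := h1
      rw [if_pos ⟨rfl, h1⟩]
      exact .inr ⟨hDc, h1⟩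
    · exact .inl (by simp [h1])
  · split_ifs with h1 h2
    · exact absurd (h1.1.trans h2.1.symm) hij
    all_goals simp
  · rcases hij with hij | ⟨hne, ⟨rfl, hj⟩ | ⟨rfl, hi⟩⟩
    · exact .inl hij
    · rcases hA j hj hne.symm with h | ⟨hp, d, hd, hjd⟩
      · exact .inl h
      · exact .inr (.inl ⟨d, by simpa [hp] using hd, hjd.symm⟩)
    · rcases hA i hi hne with h | ⟨hp, d, hd, hjd⟩
      · exact .inl h.symm
      · exact .inr (.inr ⟨d, by simpa [hp] using hd, hjd.symm⟩)

theorem ncard_subtype_common_eq {V : Type} {G : SimpleGraph V} (x : V) (a b : G.neighborSet x) :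
    {c : G.neighborSet x | (G.induce (G.neighborSet x)).Adj a c ∧
      (G.induce (G.neighborSet x)).Adj b c}.ncard =
    {c : V | G.Adj x c ∧ G.Adj a c ∧ G.Adj b c}.ncard := by
  rw [← Set.ncard_image_of_injective _ Subtype.val_injective]
  congr 1
  ext c
  constructor
  · rintro ⟨c, ⟨h1, h2⟩, rfl⟩
    exact ⟨c.2, h1, h2⟩
  · rintro ⟨h0, h1, h2⟩
    exact ⟨⟨c, h0⟩, ⟨h1, h2⟩, rfl⟩

variable {V : Type} [Fintype V] {G : SimpleGraph V}

theorem degIn_univ_eq (x : V) : G.degIn Finset.univ x = (G.neighborSet x).ncard := by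
  classical
  rw [degIn, Set.ncard_eq_toFinset_card']
  congr 1
  ext; simp

theorem Critical.tri_ncard (hG : G.Critical) {u v : V} (h : G.Adj u v) :
    6 ≤ {w | G.Adj u w ∧ G.Adj v w}.ncard := by
  classical
  have := hG.tri u v h
  rw [Set.ncard_eq_toFinset_card']
  convert this using 2
  ext; simp

theorem Critical.card_nonadj (hG : G.Critical) {x : V} (v : G.neighborSet x)
    (S : Finset (G.neighborSet x))
    (hS : ∀ w ∈ S, w ≠ v ∧ ¬ (G.induce (G.neighborSet x)).Adj v w) :
    S.card + 7 ≤ (G.neighborSet x).ncard := by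
  classical
  have h1 := hG.tri_ncard v.2
  have h2 : ((Subtype.val '' (S : Set (G.neighborSet x)) ∪ {v.1}) ∪
      {w | G.Adj x w ∧ G.Adj v w}).ncard ≤ (G.neighborSet x).ncard := by
    refine Set.ncard_le_ncard ?_
    rintro w ((⟨w, -, rfl⟩ | rfl) | h)
    exacts [w.2, v.2, h.1]
  rw [Set.ncard_union_eq, Set.ncard_union_eq, Set.ncard_image_of_injective _ Subtype.val_injective,
    Set.ncard_coe_finset, Set.ncard_singleton] at h2
  · omega
  · rw [Set.disjoint_singleton_right]
    rintro ⟨w, hw, hwv⟩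
    exact (hS w hw).1 (Subtype.ext hwv)
  · rw [Set.disjoint_left]
    rintro w (⟨w, hw, rfl⟩ | rfl) h
    · exact (hS w hw).2 h.2
    · exact h.2.ne rfl

/-- Exceptional neighbourhoods of vertices do not occur. -/
theorem Critical.not_exceptional (hG : G.Critical) {x : V} {K : Set V}
    (hK : G.IsComp (G.far x) K) (hKN : G.nbhd x K = Set.univ)
    (hN : Exceptional (G.induce (G.neighborSet x))) : False := by
  set N := G.induce (G.neighborSet x) with hNdef
  -- a connected set attached to a clique and one further vertex
  have hsep : ∀ (w : V) (D : Set V), (G.induce D).Connected → D ⊆ G.far x →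
      N.IsClique (G.nbhd x D) → w ∉ D →
      (∀ d ∈ D, ∀ v, v ∉ D → G.Adj d v → G.Adj x v ∨ v = w) → False := by
    intro w D hD hDx hcl hw hout
    refine hG.sep x w D (Subtype.val '' G.nbhd x D) hD hDx ?_ ?_ hw fun d hd v hv hdv => ?_
    · rintro _ ⟨a, ha, rfl⟩ _ ⟨b, hb, rfl⟩ hab
      exact hcl ha hb fun h => hab (congrArg _ h)
    · rw [Set.ncard_image_of_injective _ Subtype.val_injective]
      exact hN.clique _ hcl
    · exact (hout d hd v hv hdv).imp (fun h => ⟨⟨v, h⟩, ⟨d, hd, hdv.symm⟩, rfl⟩) id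
  -- two disjoint connected sets covering all edges
  have hlink : ∀ D E : Set V, (G.induce D).Connected → (G.induce E).Connected → D ⊆ G.far x →
      E ⊆ G.far x → Disjoint D E → (∀ a b, N.Adj a b → (a ∈ G.nbhd x D ∧ b ∈ G.nbhd x D) ∨
      (a ∈ G.nbhd x E ∧ b ∈ G.nbhd x E)) → ¬ N.IsClique (G.nbhd x D) →
      ¬ N.IsClique (G.nbhd x E) → False := by
    intro D E hD hE hDx hEx hDE hab hDb hEb
    obtain ⟨p, hp, q, hq, hpq, hm⟩ := hN.link _ _ hab hDb hEb
    exact hG.noMinor (minor_of_two_stars hpq hDx hEx hDE hD hE hp hq hm)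
  obtain ⟨a₀, b₀, hab₀, -⟩ := hN.cover (fun _ => ∅) fun _ => by simp
  have huniv : ¬ N.IsClique Set.univ := fun h => by
    obtain ⟨w, hw, hwa⟩ := hN.nonadj a₀
    exact hwa (h (Set.mem_univ _) (Set.mem_univ _) hw.symm)
  -- there is only one component
  have hKfar : K = G.far x := by
    refine hK.1.antisymm fun v hv => ?_
    by_contra hvK
    obtain ⟨L, hL, hvL⟩ := exists_isComp G hv
    have hdis : Disjoint K L := Set.disjoint_left.2 fun z hz hz' =>
      hvK (hK.subset_of_connected hL.2.1 hL.1 hz' hz hvL)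
    have hLcl : N.IsClique (G.nbhd x L) := by
      by_contra hLb
      exact hlink K L hK.2.1 hL.2.1 hK.1 hL.1 hdis (fun a b _ => .inl (by simp [hKN]))
        (hKN ▸ huniv) hLb
    refine hsep x L hL.2.1 hL.1 hLcl (fun h => (hL.1 h).1 rfl) fun d hd v hv hdv => ?_
    by_contra hcon
    push Not at hcon
    exact hv (hL.2.2 d hd v ⟨hcon.2, hcon.1⟩ hdv)
  have hcov : ∀ a b, N.Adj a b → ∃ d ∈ K, G.Adj a d ∧ G.Adj b d := by
    intro a b hab
    by_contra hcon
    push Not at hcon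
    have h1 := hG.tri_ncard hab
    have h2 := hN.common_le a b hab
    rw [hNdef, ncard_subtype_common_eq] at h2
    have h3 : {w | G.Adj a w ∧ G.Adj b w} ⊆ insert x {c | G.Adj x c ∧ G.Adj a c ∧ G.Adj b c} := by
      intro w hw
      by_cases hwx : w = x
      · exact .inl hwx
      · refine .inr ⟨by_contra fun h => ?_, hw⟩
        exact hcon w (hKfar ▸ ⟨hwx, h⟩) hw.1 hw.2
    have h4 := (Set.ncard_le_ncard h3).trans (Set.ncard_insert_le _ _)
    change 6 ≤ {w | G.Adj a w ∧ G.Adj b w}.ncard at h1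
    omega
  obtain ⟨w, hw, hwC⟩ := exists_cut_small (big := fun D => ¬ N.IsClique (G.nbhd x D)) hK.2.1
    (hKN ▸ huniv) (fun A B hA hB hAB hu hAb hBb => by
      refine hlink A B hA hB (fun v hv => hK.1 (hu ▸ .inl hv)) (fun v hv => hK.1 (hu ▸ .inr hv))
        hAB (fun a b hab => ?_) hAb hBb
      obtain ⟨d, hd, had, hbd⟩ := hcov a b hab
      rw [← hu] at hd
      exact hd.imp (fun h => ⟨⟨d, h, had⟩, d, h, hbd⟩) fun h => ⟨⟨d, h, had⟩, d, h, hbd⟩)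
    (fun A B C hA hB hC hu => by
      simp only [not_not] at hA hB hC
      obtain ⟨a, b, hab, hi⟩ := hN.cover ![G.nbhd x A, G.nbhd x B, G.nbhd x C] fun i => by
        fin_cases i <;> assumption
      obtain ⟨d, hd, had, hbd⟩ := hcov a b hab
      rcases hu hd with (h | h) | h
      exacts [hi 0 ⟨⟨d, h, had⟩, d, h, hbd⟩, hi 1 ⟨⟨d, h, had⟩, d, h, hbd⟩,
        hi 2 ⟨⟨d, h, had⟩, d, h, hbd⟩])
  simp only [not_not] at hwC
  have hKw : K = {w} := by
    refine Set.Subset.antisymm (fun v hv => ?_) (by simpa using hw)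
    by_contra hvw
    obtain ⟨C, hC, hvC⟩ := exists_isComp G (s := K \ {w}) ⟨hv, hvw⟩
    refine hsep w C hC.2.1 (fun z hz => hK.1 (hC.1 hz).1) (hwC C hC) (fun h => (hC.1 h).2 rfl)
      fun d hd z hz hdz => ?_
    by_contra hcon
    push Not at hcon
    refine hz (hC.2.2 d hd z ⟨?_, hcon.2⟩ hdz)
    rw [hKfar]
    refine ⟨?_, hcon.1⟩
    rintro rfl
    exact (hK.1 (hC.1 hd).1).2 hdz.symm
  rcases hN.common with h3 | ⟨h8, hcol, hdeg⟩
  · have h1 := hG.tri_ncard hab₀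
    have h2 := h3 a₀ b₀ hab₀
    rw [hNdef, ncard_subtype_common_eq] at h2
    have h3 : {c | G.Adj a₀ c ∧ G.Adj b₀ c} ⊆
        insert x (insert w {c | G.Adj x c ∧ G.Adj a₀ c ∧ G.Adj b₀ c}) := by
      intro c hc
      by_cases hcx : c = x
      · exact .inl hcx
      by_cases hcw : c = w
      · exact .inr (.inl hcw)
      refine .inr (.inr ⟨by_contra fun h => hcw ?_, hc⟩)
      have : c ∈ K := hKfar ▸ ⟨hcx, h⟩
      rwa [hKw] at this
    have h4 := (Set.ncard_le_ncard h3).trans (Set.ncard_insert_le _ _)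
    have h5 := Set.ncard_insert_le w {c | G.Adj x c ∧ G.Adj a₀ c ∧ G.Adj b₀ c}
    change 6 ≤ {w | G.Adj a₀ w ∧ G.Adj b₀ w}.ncard at h1
    omega
  · have hwx : w ≠ x ∧ ¬ G.Adj x w := hK.1 hw
    have hcase : ∀ v, G.Adj x v ∨ v = x ∨ v = w := by
      intro v
      by_contra hcon
      push Not at hcon
      have : v ∈ K := hKfar ▸ ⟨hcon.2.1, hcon.1⟩
      rw [hKw] at this
      exact hcon.2.2 this
    have hNc : (G.neighborSet x).ncard = 8 := by rwa [← Nat.card_coe_set_eq]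
    refine hG.exc ⟨?_, fun v => ?_, ?_⟩
    · have : (Set.univ : Set V) = insert x (insert w (G.neighborSet x)) := by
        ext v
        have := hcase v
        simp only [Set.mem_univ, Set.mem_insert_iff, mem_neighborSet, true_iff]
        tauto
      rw [← Nat.card_eq_fintype_card, ← Set.ncard_univ, this, Set.ncard_insert_of_notMem,
        Set.ncard_insert_of_notMem, hNc]
      · exact hwx.2
      · simpa using hwx.1.symm
    · rw [degIn_univ_eq]
      rcases hcase v with hv | rfl | rfl
      · have h1 := hdeg ⟨v, hv⟩
        rw [← Set.ncard_image_of_injective _ Subtype.val_injective] at h1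
        refine (Set.ncard_le_ncard (t := insert x (insert w (Subtype.val ''
          {u : G.neighborSet x | N.Adj ⟨v, hv⟩ u}))) fun u hu => ?_).trans ?_
        · rcases hcase u with h | h | h
          · exact .inr (.inr ⟨⟨u, h⟩, hu, rfl⟩)
          · exact .inl h
          · exact .inr (.inl h)
        · refine (Set.ncard_insert_le _ _).trans ?_
          have := Set.ncard_insert_le w (Subtype.val '' {u : G.neighborSet x | N.Adj ⟨v, hv⟩ u})
          omega
      · exact hNc.le
      · refine hNc ▸ Set.ncard_le_ncard fun u hu => ?_
        rcases hcase u with h | rfl | rfl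
        · exact h
        · exact absurd hu.symm hwx.2
        · exact absurd rfl hu.ne
    · classical
      obtain ⟨c⟩ := hcol
      refine ⟨Coloring.mk (fun v => if h : G.Adj x v then (c ⟨v, h⟩).castSucc else Fin.last 4) ?_⟩
      intro a b hab
      have hne : ∀ i : Fin 4, i.castSucc ≠ Fin.last 4 := fun i => (Fin.castSucc_lt_last i).ne
      by_cases ha : G.Adj x a <;> by_cases hb : G.Adj x b
      · simp only [dif_pos ha, dif_pos hb]
        exact fun h => c.valid (show N.Adj ⟨a, ha⟩ ⟨b, hb⟩ from hab) (Fin.castSucc_injective _ h)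
      · simp only [dif_pos ha, dif_neg hb]
        exact hne _
      · simp only [dif_neg ha, dif_pos hb]
        exact (hne _).symm
      · rcases (hcase a).resolve_left ha with rfl | rfl <;>
          rcases (hcase b).resolve_left hb with rfl | rfl
        · exact absurd rfl hab.ne
        · exact absurd hab hb
        · exact absurd hab.symm ha
        · exact absurd rfl hab.ne

theorem Critical.not_isComp (hG : G.Critical) {x : V} (hx : G.degIn Finset.univ x ≤ 11) {K : Set V}
    (hK : G.IsComp (G.far x) K)
    (hM : ∀ u v, G.Adj x u → G.Adj x v → v ≠ u → ¬ G.Adj u v → ∃ d ∈ K, G.Adj u d) : False := by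
  classical
  have hW : Fintype.card (G.neighborSet x) = (G.neighborSet x).ncard := by
    rw [← Nat.card_eq_fintype_card, Nat.card_coe_set_eq]
  have h7 := hG.deg x
  rw [degIn_univ_eq] at h7 hx
  rcases link_cases (N := G.induce (G.neighborSet x)) (by omega) (by omega)
    (fun v S hS => hW ▸ hG.card_nonadj v S hS) with ⟨p, hp⟩ | hE
  · refine hG.noMinor (minor_of_star hK.1 hK.2.1 (fun a _ hap => ?_) hp)
    by_cases h : G.Adj p a
    · exact .inl h
    · exact .inr ⟨hM _ _ p.2 a.2 (fun h => hap (Subtype.ext h)) h,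
        hM _ _ a.2 p.2 (fun h => hap (Subtype.ext h.symm)) fun h' => h h'.symm⟩
  · refine hG.not_exceptional hK (Set.eq_univ_of_forall fun v => ?_) hE
    obtain ⟨w, hw, hvw⟩ := hE.nonadj v
    exact hM _ _ v.2 w.2 (fun h => hw (Subtype.ext h)) hvw

end Neighbourhood

section Extremal

open scoped Classical

variable {V : Type} [Fintype V] {G : SimpleGraph V}

theorem Critical.exists_degIn_le (hG : G.Critical) :
    ∃ x, G.degIn Finset.univ x ≤ 11 ∧ (G.far x).Nonempty := by
  have hne : Nonempty V := by
    by_contra h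
    have := hG.edges
    rw [not_nonempty_iff] at h
    simp at this
  obtain ⟨x, hx⟩ := Finite.exists_min (G.degIn Finset.univ)
  have hx11 : G.degIn Finset.univ x ≤ 11 := by
    by_contra h
    have := G.le_dcount (A := Finset.univ) (B := Finset.univ) (m := 12) fun a _ => by
      have := hx a; omega
    have := hG.edges
    rw [Finset.card_univ] at *
    omega
  refine ⟨x, hx11, ?_⟩
  by_contra hfar
  rw [Set.not_nonempty_iff_eq_empty] at hfar
  have hxadj : ∀ v, v ≠ x → G.Adj x v := fun v hv => by
    by_contra h
    exact (Set.ext_iff.1 hfar v).1 ⟨hv, h⟩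
  have hxn : Fintype.card V ≤ G.degIn Finset.univ x + 1 := by
    rw [degIn_univ_eq, ← Nat.card_eq_fintype_card, ← Set.ncard_univ]
    refine (Set.ncard_le_ncard (t := insert x (G.neighborSet x)) fun v _ => ?_).trans
      (Set.ncard_insert_le _ _)
    by_cases hv : v = x
    · exact .inl hv
    · exact .inr (hxadj v hv)
  have hadj : ∀ u v, u ≠ v → G.Adj u v := fun u v huv => by
    by_contra h
    have h1 := hx u
    rw [degIn_univ_eq u] at h1
    have h2 : (insert u (insert v (G.neighborSet u))).ncard ≤ Fintype.card V := by
      rw [← Nat.card_eq_fintype_card, ← Set.ncard_univ]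
      exact Set.ncard_le_ncard (Set.subset_univ _)
    rw [Set.ncard_insert_of_notMem (by simp [huv]), Set.ncard_insert_of_notMem (by simpa)] at h2
    omega
  have h8 : Fintype.card (Fin 8) ≤ Fintype.card V := by
    have := hG.deg x
    have := G.degIn_lt_card x
    simp only [Fintype.card_fin]
    omega
  obtain ⟨φ⟩ := Function.Embedding.nonempty_of_card_le h8
  exact hG.noMinor (MinorOf.of_injective_hom φ φ.injective fun a b hab =>
    hadj _ _ (φ.injective.ne hab))

/-- Among all pairs of a vertex of small degree and a component of its far set, the smallest
component contains no vertex of small degree. -/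
theorem Critical.degIn_of_minimal (hG : G.Critical) {x : V} {K : Set V}
    (hK : G.IsComp (G.far x) K)
    (hmin : ∀ y C, G.degIn Finset.univ y ≤ 11 → G.IsComp (G.far y) C → K.ncard ≤ C.ncard)
    {v : V} (hv : v ∈ K) : 12 ≤ G.degIn Finset.univ v := by
  by_contra hlow
  obtain ⟨y, hyK, hy⟩ := K.toFinite.exists_minimalFor (G.degIn Finset.univ) K ⟨v, hv⟩
  have hydeg : ∀ u ∈ K, G.degIn Finset.univ y ≤ G.degIn Finset.univ u := fun u hu =>
    (le_total _ _).elim id fun h => hy hu h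
  have hy11 : G.degIn Finset.univ y ≤ 11 := by
    have := hydeg v hv; omega
  have hyx := hK.1 hyK
  obtain ⟨K', hK', hxK'⟩ := exists_isComp G (s := G.far y) (v := x)
    ⟨hyx.1.symm, fun h => hyx.2 h.symm⟩
  refine hG.not_isComp hy11 hK' fun u v hyu hyv hvu huv => ?_
  by_cases hxu : G.Adj x u
  · exact ⟨x, hxK', hxu.symm⟩
  have hux : u ≠ x := by
    rintro rfl
    exact hyx.2 hyu.symm
  have huK : u ∈ K := hK.2.2 y hyK u ⟨hux, hxu⟩ hyu
  obtain ⟨z, huz, hz⟩ : ∃ z, G.Adj u z ∧ z ∈ G.far y := by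
    by_contra hcon
    push Not at hcon
    have h1 := hydeg u huK
    rw [degIn_univ_eq, degIn_univ_eq] at h1
    have h2 : (insert u (insert v (G.neighborSet u \ {y}))).ncard ≤ (G.neighborSet y).ncard := by
      refine Set.ncard_le_ncard ?_
      rintro z (rfl | rfl | ⟨hz, hzy⟩)
      · exact hyu
      · exact hyv
      · by_contra hyz
        exact hcon z hz ⟨hzy, hyz⟩
    rw [Set.ncard_insert_of_notMem (by simp [hvu.symm]), Set.ncard_insert_of_notMem (by simp [huv])]
      at h2
    have := Set.ncard_sdiff_singleton_add_one (s := G.neighborSet u) hyu.symm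
    omega
  by_contra hcon
  push Not at hcon
  obtain ⟨C, hC, hzC⟩ := exists_isComp G hz
  have hxC : x ∉ C := fun hxC => hcon z (hK'.subset_of_connected hC.2.1 hC.1 hxC hxK' hzC) huz
  have hCx : C ⊆ G.far x := fun c hc => ⟨fun h => hxC (h ▸ hc), fun h =>
    hxC (hC.2.2 c hc x (hK'.1 hxK') h.symm)⟩
  have hCK : C ⊆ K := hK.subset_of_connected hC.2.1 hCx hzC
    (hK.2.2 u huK z (hCx hzC) huz)
  have := Set.ncard_lt_ncard (hCK.ssubset_of_mem_notMem hyK fun h => (hC.1 h).1 rfl)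
  have := hmin y C hy11 hC
  omega

end Extremal

section Extremal

open scoped Classical

theorem exists_universal_pair {V : Type} {G : SimpleGraph V} {Q : Finset V} (hQ : 2 ≤ Q.card)
    (h : ∀ a ∈ Q, ∀ b ∈ Q, ∀ c ∈ Q, b ≠ a → c ≠ a → ¬ G.Adj a b → ¬ G.Adj a c → b = c) :
    ∃ a ∈ Q, ∃ b ∈ Q, a ≠ b ∧ ∀ c ∈ Q, c ≠ a → c ≠ b → G.Adj a c ∧ G.Adj b c := by
  by_cases hex : ∃ a ∈ Q, ∃ b ∈ Q, a ≠ b ∧ ¬ G.Adj a b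
  · obtain ⟨a, ha, b, hb, hab, hn⟩ := hex
    refine ⟨a, ha, b, hb, hab, fun c hc hca hcb => ⟨?_, ?_⟩⟩
    · by_contra hac
      exact hcb (h a ha c hc b hb hca hab.symm hac hn)
    · by_contra hbc
      exact hca (h b hb c hc a ha hcb hab hbc fun h => hn h.symm)
  · push Not at hex
    obtain ⟨a, ha, b, hb, hab⟩ := Finset.one_lt_card.1 hQ
    exact ⟨a, ha, b, hb, hab, fun c hc hca hcb => ⟨hex a ha c hc hca.symm, hex b hb c hc hcb.symm⟩⟩

/-- Six vertices of a graph whose complement is a matching, listed so that nonadjacent vertices are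
next to each other. -/
theorem exists_matching_labelling {V : Type} {G : SimpleGraph V} {Q : Finset V} (hQ : 6 ≤ Q.card)
    (h : ∀ a ∈ Q, ∀ b ∈ Q, ∀ c ∈ Q, b ≠ a → c ≠ a → ¬ G.Adj a b → ¬ G.Adj a c → b = c) :
    ∃ f : Fin 6 → V, Function.Injective f ∧ (∀ i, f i ∈ Q) ∧
      ∀ i j : Fin 6, i < j → (i : ℕ) / 2 ≠ (j : ℕ) / 2 → G.Adj (f i) (f j) := by
  have herase : ∀ P : Finset V, ∀ a b : V, P.card ≤ ((P.erase a).erase b).card + 2 := fun P a b => by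
    have := Finset.pred_card_le_card_erase (s := P) (a := a)
    have := Finset.pred_card_le_card_erase (s := P.erase a) (a := b)
    omega
  obtain ⟨a, ha, b, hb, hab, h1⟩ := exists_universal_pair (by omega) h
  obtain ⟨P, hP⟩ : ∃ P, P = (Q.erase a).erase b := ⟨_, rfl⟩
  have hPc := herase Q a b
  rw [← hP] at hPc
  replace hP : ∀ z ∈ P, z ∈ Q ∧ G.Adj a z ∧ G.Adj b z := fun z hz => by
    simp only [hP, Finset.mem_erase] at hz
    exact ⟨hz.2.2, h1 z hz.2.2 hz.2.1 hz.1⟩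
  obtain ⟨c, hc, d, hd, hcd, h2⟩ := exists_universal_pair (Q := P) (by omega)
    fun x hx y hy z hz => h x (hP x hx).1 y (hP y hy).1 z (hP z hz).1
  obtain ⟨R, hR⟩ : ∃ R, R = (P.erase c).erase d := ⟨_, rfl⟩
  have hRc := herase P c d
  rw [← hR] at hRc
  replace hR : ∀ z ∈ R, z ∈ P ∧ G.Adj c z ∧ G.Adj d z := fun z hz => by
    simp only [hR, Finset.mem_erase] at hz
    exact ⟨hz.2.2, h2 z hz.2.2 hz.2.1 hz.1⟩
  obtain ⟨e, he, f, hf, hef⟩ := Finset.one_lt_card.1 (show 1 < R.card by omega)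
  obtain ⟨he, hce, hde⟩ := hR e he
  obtain ⟨hf, hcf, hdf⟩ := hR f hf
  obtain ⟨hc, hac, hbc⟩ := hP c hc
  obtain ⟨hd, had, hbd⟩ := hP d hd
  obtain ⟨he, hae, hbe⟩ := hP e he
  obtain ⟨hf, haf, hbf⟩ := hP f hf
  have hadj : ∀ i j : Fin 6, i < j → (i : ℕ) / 2 ≠ (j : ℕ) / 2 →
      G.Adj (![a, b, c, d, e, f] i) (![a, b, c, d, e, f] j) := by
    intro i j hij hne
    fin_cases i <;> fin_cases j <;> first
      | exact absurd hij (by decide)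
      | exact absurd rfl hne
      | assumption
  refine ⟨![a, b, c, d, e, f], Function.Injective.of_lt_imp_ne fun i j hij => ?_, fun i => ?_, hadj⟩
  · by_cases hne : (i : ℕ) / 2 = (j : ℕ) / 2
    · fin_cases i <;> fin_cases j <;> first
        | exact absurd hij (by decide)
        | exact absurd hne (by decide)
        | assumption
    · exact (hadj i j hij hne).ne
  · fin_cases i <;> assumption

variable {V : Type} [Fintype V] {G : SimpleGraph V}

/-- If only one neighbour `u` of a vertex of degree eleven has no neighbour in `K`, the graph
induced by the common neighbours cannot be the complement of a matching. -/
theorem Critical.false_of_labelling (hG : G.Critical) {x u : V} {K : Set V}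
    (hx : G.degIn Finset.univ x = 11) (hK : G.IsComp (G.far x) K) (hxu : G.Adj x u)
    (hS : ∀ v, G.Adj x v → v ≠ u → ∃ d ∈ K, G.Adj v d) (f : Fin 6 → V)
    (hf : Function.Injective f) (hfx : ∀ i, G.Adj x (f i)) (hfu : ∀ i, G.Adj u (f i))
    (hadj : ∀ i j : Fin 6, i < j → (i : ℕ) / 2 ≠ (j : ℕ) / 2 → G.Adj (f i) (f j)) : False := by
  rw [degIn_univ_eq] at hx
  set s : Finset (Fin 11) := insert 0 (Finset.univ.map ⟨Fin.natAdd (m := 6) 5, Fin.natAdd_injective 6 5⟩) with hs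
  let g : Fin 11 → G.neighborSet x := fun i => if h : 5 ≤ (i : ℕ) then
    ⟨f ⟨i - 5, by omega⟩, hfx _⟩ else ⟨u, hxu⟩
  have g0 : g 0 = ⟨u, hxu⟩ := rfl
  have gs : ∀ i : Fin 6, g (Fin.natAdd 5 i) = ⟨f i, hfx i⟩ := fun i => by simp [g]
  have hg : Set.InjOn g s := by
    have h0 : ∀ i : Fin 6, g 0 ≠ g (Fin.natAdd 5 i) := fun i h => by
      rw [g0, gs] at h
      exact (hfu i).ne (congrArg Subtype.val h)
    intro i hi j hj hij
    simp only [hs, Finset.coe_insert, Finset.coe_map, Set.mem_insert_iff, Set.mem_image,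
      Finset.coe_univ, Set.mem_univ, true_and] at hi hj
    rcases hi with rfl | ⟨i, rfl⟩ <;> rcases hj with rfl | ⟨j, rfl⟩
    · rfl
    · exact absurd hij (h0 j)
    · exact absurd hij.symm (h0 i)
    · have : g (Fin.natAdd 5 i) = g (Fin.natAdd 5 j) := hij
      rw [gs, gs] at this
      rw [hf (congrArg Subtype.val this)]
  have hcard : Fintype.card (Fin 11) = (Finset.univ : Finset (G.neighborSet x)).card := by
    rw [Fintype.card_fin, Finset.card_univ, ← Nat.card_eq_fintype_card, Nat.card_coe_set_eq, hx]
  obtain ⟨e, he⟩ := Finset.exists_equiv_extend_of_card_eq hcard (Finset.subset_univ _) hg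
  let φ : Fin 11 ↪ G.neighborSet x := ⟨fun i => (e i).1, Subtype.val_injective.comp e.injective⟩
  have φ0 : φ 0 = ⟨u, hxu⟩ := (he 0 (by simp [hs])).trans g0
  have φs : ∀ i : Fin 6, φ (Fin.natAdd 5 i) = ⟨f i, hfx i⟩ := fun i =>
    (he _ (by simp [hs])).trans (gs i)
  have hge : ∀ i : Fin 11, 5 ≤ i → ∃ j : Fin 6, i = Fin.natAdd 5 j ∧ (j : ℕ) = i - 5 := by
    intro i hi
    have hi' : 5 ≤ (i : ℕ) := hi
    exact ⟨⟨i - 5, by omega⟩, Fin.ext (by simp; omega), rfl⟩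
  obtain ⟨p, hp0, hp⟩ := rooted_cases ((G.induce (G.neighborSet x)).comap φ)
    (fun v S hS => by
      have := hG.card_nonadj (φ v) (S.map φ) fun w hw => by
        obtain ⟨w, hwS, rfl⟩ := Finset.mem_map.1 hw
        exact ⟨φ.injective.ne (hS w hwS).1, (hS w hwS).2⟩
      rw [Finset.card_map] at this
      omega)
    (fun i hi => by
      obtain ⟨j, rfl, -⟩ := hge i hi
      rw [comap_adj, φ0, φs]
      exact hfu j)
    (fun i j hi hij hne => by
      obtain ⟨i', rfl, hi'⟩ := hge i hi
      obtain ⟨j', rfl, hj'⟩ := hge j (hi.trans hij.le)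
      rw [← hi', ← hj'] at hne
      rw [comap_adj, φs, φs]
      exact hadj i' j' ((Fin.natAdd_lt_natAdd_iff 5).1 hij) hne)
  have hu : ∀ i, i ≠ 0 → (φ i : V) ≠ u := fun i hi h => hi (φ.injective (by
    rw [φ0]; exact Subtype.ext h))
  refine hG.noMinor (minor_of_star hK.1 hK.2.1 (p := φ p) (A := {a | a.1 ≠ u})
    (fun a ha _ => .inr ⟨hS _ (φ p).2 (hu p hp0), hS _ a.2 ha⟩)
    (hp.trans (MinorOf.of_injective_hom φ φ.injective ?_)))
  rintro i j (hij | ⟨hne, ⟨rfl, hj⟩ | ⟨rfl, hi⟩⟩)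
  · exact .inl hij
  · exact .inr ⟨φ.injective.ne hne, .inl ⟨rfl, hu j hj⟩⟩
  · exact .inr ⟨φ.injective.ne hne, .inr ⟨rfl, hu i hi⟩⟩

end Extremal

section Extremal

open scoped Classical

variable {V : Type} [Fintype V] {G : SimpleGraph V}

/-- A component `K` all of whose vertices have large degree is attached to all neighbours of `x`. -/
theorem Critical.nbhd_of_large (hG : G.Critical) {x : V} {K : Set V}
    (hx : G.degIn Finset.univ x ≤ 11) (hK : G.IsComp (G.far x) K)
    (hdeg : ∀ v ∈ K, 12 ≤ G.degIn Finset.univ v) {u : V} (hxu : G.Adj x u) :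
    ∃ d ∈ K, G.Adj u d := by
  by_contra hu
  push Not at hu
  obtain ⟨d₀, hd₀⟩ := (induce_connected_iff.1 hK.2.1).1
  set F : Finset V := K.toFinset with hF
  set S : Finset V := {v | G.Adj x v ∧ ∃ d ∈ K, G.Adj v d} with hSdef
  have memF : ∀ v, v ∈ F ↔ v ∈ K := fun v => by simp [hF]
  have memS : ∀ v, v ∈ S ↔ G.Adj x v ∧ ∃ d ∈ K, G.Adj v d := fun v => by simp [hSdef]
  have hFS : Disjoint F S := Finset.disjoint_left.2 fun v hv hv' =>
    (hK.1 ((memF v).1 hv)).2 ((memS v).1 hv').1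
  have hxF : x ∉ F := fun h => (hK.1 ((memF x).1 h)).1 rfl
  have hxS : x ∉ S := fun h => ((memS x).1 h).1.ne rfl
  have hux : u ∉ F ∪ S := fun h => (Finset.mem_union.1 h).elim
    (fun h => (hK.1 ((memF u).1 h)).2 hxu) fun h => by
      obtain ⟨-, d, hd, hud⟩ := (memS u).1 h
      exact hu d hd hud
  have hclosed : ∀ d ∈ K, ∀ v, G.Adj d v → v ∈ F ∪ S := by
    intro d hd v hdv
    by_cases hxv : G.Adj x v
    · exact Finset.mem_union_right _ ((memS v).2 ⟨hxv, d, hd, hdv.symm⟩)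
    · refine Finset.mem_union_left _ ((memF v).2 (hK.2.2 d hd v ⟨?_, hxv⟩ hdv))
      rintro rfl
      exact (hK.1 hd).2 hdv.symm
  have hSN : S ⊆ (G.neighborSet x).toFinset.erase u := fun v hv => by
    simp only [Finset.mem_erase, Set.mem_toFinset]
    exact ⟨fun h => hux (h ▸ Finset.mem_union_right _ hv), ((memS v).1 hv).1⟩
  have hNcard : (G.neighborSet x).toFinset.card = G.degIn Finset.univ x := by
    rw [degIn_univ_eq, Set.ncard_eq_toFinset_card']
  have hScard : S.card + 1 ≤ G.degIn Finset.univ x := by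
    have h := Finset.card_le_card hSN
    have := Finset.card_erase_add_one (s := (G.neighborSet x).toFinset) (a := u) (by simpa using hxu)
    omega
  have hlowF : 12 * F.card ≤ G.dcount F F + G.dcount F S := by
    rw [← G.dcount_union_right hFS]
    refine G.le_dcount fun a ha => (hdeg a ((memF a).1 ha)).trans (Finset.card_le_card fun v hv => ?_)
    rw [Finset.mem_filter] at hv ⊢
    exact ⟨hclosed a ((memF a).1 ha) v hv.2, hv.2⟩
  have hlowS : 7 * S.card ≤ G.dcount F S + G.dcount S S := by
    rw [G.dcount_comm F S, ← G.dcount_union_right hFS]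
    refine G.le_dcount fun v hv => ?_
    obtain ⟨-, d, hd, hvd⟩ := (memS v).1 hv
    have h6 := hG.tri v d hvd
    have hsub : insert d ({w | G.Adj v w ∧ G.Adj d w} : Finset V) ⊆
        ({w ∈ F ∪ S | G.Adj v w} : Finset V) := by
      intro w hw
      rw [Finset.mem_filter]
      rcases Finset.mem_insert.1 hw with rfl | hw
      · exact ⟨Finset.mem_union_left _ ((memF w).2 hd), hvd⟩
      · rw [Finset.mem_filter] at hw
        exact ⟨hclosed d hd w hw.2.2, hw.2.1⟩
    have := Finset.card_le_card hsub
    rw [Finset.card_insert_of_notMem (by simp)] at this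
    exact (by omega : 7 ≤ _).trans this
  have hxFS : Disjoint (F ∪ S) {x} := by simp [hxF, hxS]
  have hA : F ∪ S ∪ {x} ≠ Finset.univ := fun h => by
    have := h ▸ Finset.mem_univ u
    rcases Finset.mem_union.1 this with h | h
    · exact hux h
    · exact hxu.ne (Finset.mem_singleton.1 h).symm
  have hAcard : (F ∪ S ∪ {x}).card = F.card + S.card + 1 := by
    rw [Finset.card_union_of_disjoint hxFS, Finset.card_union_of_disjoint hFS,
      Finset.card_singleton]
  have hA5 : 5 ≤ (F ∪ S ∪ {x}).card := by
    have h1 := hdeg d₀ hd₀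
    have h2 : G.degIn Finset.univ d₀ ≤ (F ∪ S).card := Finset.card_le_card fun v hv =>
      hclosed d₀ hd₀ v (Finset.mem_filter.1 hv).2
    rw [Finset.card_union_of_disjoint hFS] at h2
    omega
  have hAcount : G.dcount (F ∪ S ∪ {x}) (F ∪ S ∪ {x}) =
      G.dcount F F + 2 * G.dcount F S + G.dcount S S + 2 * S.card := by
    have h1 : G.degIn (F ∪ S) x = S.card := by
      refine congrArg Finset.card (Finset.ext fun v => ?_)
      rw [Finset.mem_filter, Finset.mem_union]
      constructor
      · rintro ⟨hv | hv, hxv⟩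
        · exact absurd hxv (hK.1 ((memF v).1 hv)).2
        · exact hv
      · exact fun hv => ⟨.inr hv, ((memS v).1 hv).1⟩
    have h2 : G.degIn {x} x = 0 := by simp [degIn]
    rw [G.dcount_union_self hxFS, G.dcount_union_self hFS, G.dcount_comm _ {x}, G.dcount_singleton,
      G.dcount_singleton, h1, h2]
    omega
  have hbound := hG.bound _ hA hA5 G (G.induce_minorOf _)
  rw [hAcount, hAcard] at hbound
  have hS10 : S.card = 10 := by omega
  have hd11 : G.degIn Finset.univ x = 11 := by omega
  have hSeq : S = (G.neighborSet x).toFinset.erase u := by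
    refine Finset.eq_of_subset_of_card_le hSN ?_
    have := Finset.card_erase_add_one (s := (G.neighborSet x).toFinset) (a := u) (by simpa using hxu)
    omega
  have hS : ∀ v, G.Adj x v → v ≠ u → ∃ d ∈ K, G.Adj v d := fun v hv hvu =>
    ((memS v).1 (hSeq ▸ by simp [hvu, hv])).2
  -- contracting `u` into one of its neighbours gains few edges
  have hmate : ∀ a, G.Adj x a → G.Adj u a → ∀ P : Finset V,
      (∀ b ∈ P, G.Adj x b ∧ G.Adj u b ∧ b ≠ a ∧ ¬ G.Adj a b) → P.card ≤ 1 := by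
    intro a hxa hua P hP
    have hSmem : ∀ b, G.Adj x b → G.Adj u b → b ∈ F ∪ S ∪ {x} := fun b hxb hub =>
      Finset.mem_union_left _ (Finset.mem_union_right _ ((memS b).2 ⟨hxb, hS b hxb hub.ne'⟩))
    have h1 := hG.bound _ hA hA5 (G ⊔ starAt a {v | ∃ d ∈ ({u} : Set V), G.Adj d v})
      (minorOf_contract (Set.disjoint_singleton_right.2 fun h => by
        rcases Finset.mem_union.1 (Finset.mem_coe.1 h) with h | h
        · exact hux h
        · exact hxu.ne (Finset.mem_singleton.1 h).symm)
        (induce_singleton_connected G u) rfl hua.symm)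
    have h2 := G.dcount_add_star (A := F ∪ S ∪ {x}) (P := P) (w := a)
      (T := {v | ∃ d ∈ ({u} : Set V), G.Adj d v}) (hSmem a hxa hua)
      (fun b hb => hSmem b (hP b hb).1 (hP b hb).2.1) (fun h => (hP a h).2.2.1 rfl)
      (fun b hb => ⟨u, rfl, (hP b hb).2.1⟩) fun b hb => (hP b hb).2.2.2
    rw [hAcount] at h2
    rw [hAcard] at h1
    omega
  obtain ⟨f, hf, hfQ, hadj⟩ := exists_matching_labelling (G := G) (hG.tri x u hxu)
    (fun a ha b hb c hc hba hca hab hac => by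
      by_contra hbc
      simp only [Finset.mem_filter, Finset.mem_univ, true_and] at ha hb hc
      have := hmate a ha.1 ha.2 {b, c} fun z hz => by
        rcases Finset.mem_insert.1 hz with rfl | hz
        · exact ⟨hb.1, hb.2, hba, hab⟩
        · rw [Finset.mem_singleton.1 hz]
          exact ⟨hc.1, hc.2, hca, hac⟩
      rw [Finset.card_pair hbc] at this
      omega)
  have hfQ' : ∀ i, G.Adj x (f i) ∧ G.Adj u (f i) := fun i => by simpa using hfQ i
  exact hG.false_of_labelling hd11 hK hxu hS f hf (fun i => (hfQ' i).1) (fun i => (hfQ' i).2) hadj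

theorem not_critical : ¬ G.Critical := by
  intro hG
  obtain ⟨x₀, hx₀, v₀, hv₀⟩ := hG.exists_degIn_le
  obtain ⟨K₀, hK₀, -⟩ := exists_isComp G hv₀
  have hex : ∃ n, ∃ x K, G.degIn Finset.univ x ≤ 11 ∧ G.IsComp (G.far x) K ∧ K.ncard = n :=
    ⟨_, x₀, K₀, hx₀, hK₀, rfl⟩
  obtain ⟨x, K, hx, hK, hn⟩ := Nat.find_spec hex
  have hdeg := fun v => hG.degIn_of_minimal hK (v := v) fun y C hy hC =>
    hn ▸ Nat.find_min' hex ⟨y, C, hy, hC, rfl⟩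
  exact hG.not_isComp hx hK fun u v hu _ _ _ => hG.nbhd_of_large hx hK hdeg hu

end Extremal

section Colouring

open scoped Classical

/-- `G` has a proper colouring with `m` colours on the vertex set `s`. -/
def ColorableOn {V : Type} (G : SimpleGraph V) (s : Set V) (m : ℕ) : Prop :=
  ∃ c : V → ℕ, (∀ v ∈ s, c v < m) ∧ ∀ a ∈ s, ∀ b ∈ s, G.Adj a b → c a ≠ c b

theorem colorableOn_iff {V : Type} {G : SimpleGraph V} {s : Set V} {m : ℕ} :
    G.ColorableOn s m ↔ (G.induce s).Colorable m := by
  constructor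
  · rintro ⟨c, hc, hadj⟩
    exact ⟨Coloring.mk (fun v => ⟨c v, hc v v.2⟩) fun {a b} hab h =>
      hadj a a.2 b b.2 hab (congrArg Fin.val h)⟩
  · rintro ⟨c⟩
    refine ⟨fun v => if h : v ∈ s then c ⟨v, h⟩ else 0, fun v hv => ?_, fun a ha b hb hab h => ?_⟩
    · simp [hv]
    · simp only [ha, hb, dif_pos] at h
      exact c.valid (show (G.induce s).Adj ⟨a, ha⟩ ⟨b, hb⟩ from hab) (Fin.ext h)

theorem colorableOn_univ {V : Type} {G : SimpleGraph V} {m : ℕ} :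
    G.ColorableOn Set.univ m ↔ G.Colorable m := by
  constructor
  · rintro ⟨c, hc, hadj⟩
    exact ⟨Coloring.mk (fun v => ⟨c v, hc v trivial⟩) fun {a b} hab h =>
      hadj a trivial b trivial hab (congrArg Fin.val h)⟩
  · rintro ⟨c⟩
    exact ⟨fun v => c v, fun v _ => (c v).2, fun a _ b _ hab h => c.valid hab (Fin.ext h)⟩

theorem ColorableOn.mono {V : Type} {G : SimpleGraph V} {s t : Set V} {m : ℕ}
    (h : G.ColorableOn t m) (hst : s ⊆ t) : G.ColorableOn s m := by
  obtain ⟨c, hc, hadj⟩ := h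
  exact ⟨c, fun v hv => hc v (hst hv), fun a ha b hb => hadj a (hst ha) b (hst hb)⟩

theorem ColorableOn.insert {V : Type} {G : SimpleGraph V} {s : Set V} {m : ℕ}
    (h : G.ColorableOn s m) (v : V) : G.ColorableOn (insert v s) (m + 1) := by
  obtain ⟨c, hc, hadj⟩ := h
  refine ⟨fun w => if w = v then m else c w, fun w hw => ?_, fun a ha b hb hab => ?_⟩
  · dsimp only
    split_ifs with h
    · omega
    · exact (hc w (hw.resolve_left h)).trans (by omega)
  · dsimp only
    split_ifs with h1 h2 h2
    · exact absurd (h1.trans h2.symm) hab.ne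
    · exact (hc b (hb.resolve_left h2)).ne'
    · exact (hc a (ha.resolve_left h1)).ne
    · exact hadj a (ha.resolve_left h1) b (hb.resolve_left h2) hab

theorem ColorableOn.cone {V : Type} {G : SimpleGraph V} {s : Set V} {m : ℕ}
    (h : G.ColorableOn s m) : G.cone.ColorableOn (some '' s) m := by
  obtain ⟨c, hc, hadj⟩ := h
  refine ⟨fun v => v.elim 0 c, ?_, ?_⟩
  · rintro _ ⟨v, hv, rfl⟩
    exact hc v hv
  · rintro _ ⟨a, ha, rfl⟩ _ ⟨b, hb, rfl⟩ hab
    exact hadj a ha b hb hab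

/-- `G` has chromatic number `k + 2` and is double-critical. -/
structure DoubleCritical {V : Type} (G : SimpleGraph V) (k : ℕ) : Prop where
  not_colorable : ¬ G.ColorableOn Set.univ (k + 1)
  vertex : ∀ v, G.ColorableOn {v}ᶜ (k + 1)
  edge : ∀ u v, G.Adj u v → G.ColorableOn {u, v}ᶜ k

theorem DoubleCritical.cone {V : Type} {G : SimpleGraph V} {k : ℕ} (hG : G.DoubleCritical k) :
    G.cone.DoubleCritical (k + 1) := by
  refine ⟨?_, ?_, ?_⟩
  · rintro ⟨c, hc, hadj⟩
    refine hG.not_colorable ⟨fun v => if c (some v) = k + 1 then c none else c (some v),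
      fun v _ => ?_, fun a _ b _ hab => ?_⟩
    · have h1 := hc (some v) trivial
      have h2 := hc none trivial
      have h3 := hadj none trivial (some v) trivial (cone_adj_none_some G v)
      dsimp only
      split_ifs <;> omega
    · have h1 := hadj none trivial (some a) trivial (cone_adj_none_some G a)
      have h2 := hadj none trivial (some b) trivial (cone_adj_none_some G b)
      have h3 := hadj (some a) trivial (some b) trivial hab
      dsimp only
      split_ifs <;> omega
  · rintro (_ | v)
    · obtain ⟨v⟩ : Nonempty V := by
        by_contra h
        exact hG.not_colorable ⟨fun _ => 0, fun v => (h ⟨v⟩).elim, fun a => (h ⟨a⟩).elim⟩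
      refine ((hG.vertex v).cone.insert (some v)).mono ?_
      rintro (_ | w) hw
      · exact absurd rfl hw
      · by_cases hwv : w = v
        · exact .inl (by rw [hwv])
        · exact .inr ⟨w, hwv, rfl⟩
    · refine ((hG.vertex v).cone.insert none).mono ?_
      rintro (_ | w) hw
      · exact .inl rfl
      · exact .inr ⟨w, fun h => hw (congrArg some h), rfl⟩
  · rintro (_ | u) (_ | v) huv
    · exact huv.elim
    · refine (hG.vertex v).cone.mono ?_
      rintro (_ | w) hw
      · exact absurd (.inl rfl) hw
      · exact ⟨w, fun h => hw (.inr (congrArg some h)), rfl⟩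
    · refine (hG.vertex u).cone.mono ?_
      rintro (_ | w) hw
      · exact absurd (.inr rfl) hw
      · exact ⟨w, fun h => hw (.inl (congrArg some h)), rfl⟩
    · refine ((hG.edge u v huv).cone.insert none).mono ?_
      rintro (_ | w) hw
      · exact .inl rfl
      · exact .inr ⟨w, fun h => hw (h.imp (congrArg some) (congrArg some)), rfl⟩

theorem top_minorOf_of_cone {V : Type} {G : SimpleGraph V} {m : ℕ}
    (h : (⊤ : SimpleGraph (Fin (m + 1))).MinorOf G.cone) : (⊤ : SimpleGraph (Fin m)).MinorOf G := by
  obtain ⟨f, hne, hc, hd, ha⟩ := h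
  obtain ⟨i, hi⟩ : ∃ i, ∀ j, j ≠ i → none ∉ f j := by
    by_cases h : ∃ i, none ∈ f i
    · obtain ⟨i, hi⟩ := h
      exact ⟨i, fun j hj hn => Set.disjoint_left.1 (hd j i hj) hn hi⟩
    · exact ⟨0, fun j _ hj => h ⟨j, hj⟩⟩
  have hsome : ∀ j, ∀ v ∈ f (i.succAbove j), ∃ w, v = some w := by
    rintro j (_ | w) hv
    · exact absurd hv (hi _ (Fin.succAbove_ne i j))
    · exact ⟨w, rfl⟩
  refine ⟨fun j => some ⁻¹' f (i.succAbove j), fun j => ?_, fun j => ?_, fun j j' hjj => ?_,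
    fun j j' hjj => ?_⟩
  · obtain ⟨v, hv⟩ := hne (i.succAbove j)
    obtain ⟨w, rfl⟩ := hsome j v hv
    exact ⟨w, hv⟩
  · choose g hg using fun v : f (i.succAbove j) => hsome j v v.2
    let φ : G.cone.induce (f (i.succAbove j)) →g G.induce (some ⁻¹' f (i.succAbove j)) :=
      { toFun := fun v => ⟨g v, show some (g v) ∈ _ from hg v ▸ v.2⟩
        map_rel' := fun {a b} hab => by
          have hab : G.cone.Adj a b := hab
          rw [hg a, hg b] at hab
          exact hab }
    exact (hc (i.succAbove j)).map φ fun v =>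
      ⟨⟨some v, v.2⟩, Subtype.ext (Option.some_injective _ (hg ⟨some v, v.2⟩).symm)⟩
  · exact (hd _ _ (Fin.succAbove_right_injective.ne hjj)).preimage _
  · obtain ⟨a, ha, b, hb, hab⟩ := ha _ _ (Fin.succAbove_right_injective.ne hjj)
    obtain ⟨a, rfl⟩ := hsome _ a ha
    obtain ⟨b, rfl⟩ := hsome _ b hb
    exact ⟨a, ha, b, hb, hab⟩

theorem ColorableOn.exists_recoloring {V : Type} {G : SimpleGraph V} {k : ℕ} {s : Set V}
    (h : G.ColorableOn s k) (w : V) :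
    ∃ c : V → Fin (k + 1), (∀ a ∈ s, ∀ b ∈ s, G.Adj a b → c a ≠ c b) ∧
      ∀ v ∈ s, v ≠ w → c v ≠ c w := by
  obtain ⟨c, hc, hadj⟩ := h
  have hlt : ∀ v, min (c v) k < k + 1 := fun v => by omega
  refine ⟨fun v => if v = w then Fin.last k else ⟨min (c v) k, hlt v⟩, fun a ha b hb hab => ?_,
    fun v hv hvw => ?_⟩
  · have h1 := hc a ha
    have h2 := hc b hb
    have h3 := hadj a ha b hb hab
    have h4 := hab.ne
    dsimp only
    split_ifs with h5 h6 h6 <;> rw [Ne, Fin.ext_iff] <;> simp only [Fin.val_last]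
    · exact absurd (h5.trans h6.symm) h4
    all_goals omega
  · have h1 := hc v hv
    dsimp only
    rw [if_neg hvw, if_pos rfl, Ne, Fin.ext_iff]
    simp only [Fin.val_last]
    omega

variable {V : Type} [Fintype V] {G : SimpleGraph V} {k : ℕ}

theorem DoubleCritical.le_card_common (hG : G.DoubleCritical k) {u v : V} (huv : G.Adj u v) :
    k ≤ Finset.card {w | G.Adj u w ∧ G.Adj v w} := by
  obtain ⟨c, hc, hadj⟩ := hG.edge u v huv
  have hsub : Finset.range k ⊆ Finset.image c {w | G.Adj u w ∧ G.Adj v w} := by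
    intro i hi
    rw [Finset.mem_range] at hi
    by_contra hcon
    have hno : ∀ w, c w = i → G.Adj u w → ¬ G.Adj v w := fun w hw hu hv =>
      hcon (Finset.mem_image.2 ⟨w, by simp [hu, hv], hw⟩)
    have hmem : ∀ w, w ≠ u → w ≠ v → w ∈ ({u, v} : Set V)ᶜ := fun w h1 h2 => by simp [h1, h2]
    have key : ∀ a b, a ≠ u → a ≠ v → b ≠ u → b ≠ v → G.Adj a b → c a ≠ c b :=
      fun a b h1 h2 h3 h4 => hadj a (hmem a h1 h2) b (hmem b h3 h4)
    refine hG.not_colorable ⟨fun w => if w = u then i else if w = v then k else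
      if c w = i ∧ G.Adj u w then k else c w, fun w _ => ?_, fun a _ b _ hab => ?_⟩
    · have := fun h1 h2 => hc w (hmem w h1 h2)
      dsimp only
      split_ifs with h1 h2 h3 <;> try omega
      exact (this h1 h2).trans (by omega)
    · have hca := fun h1 h2 => hc a (hmem a h1 h2)
      have hcb := fun h1 h2 => hc b (hmem b h1 h2)
      have h1 := key a b
      have h2 := hno a
      have h3 := hno b
      have h4 := hab.symm
      have h5 := hab.ne
      dsimp only
      split_ifs <;> grind
  simpa using (Finset.card_le_card hsub).trans Finset.card_image_le

theorem DoubleCritical.le_degIn (hG : G.DoubleCritical k) (v : V) :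
    k + 1 ≤ G.degIn Finset.univ v := by
  by_contra hlow
  obtain ⟨c, hc, hadj⟩ := hG.vertex v
  obtain ⟨i, hi, hic⟩ := Finset.exists_mem_notMem_of_card_lt_card
    (s := Finset.image c {w | G.Adj v w}) (t := Finset.range (k + 1)) (by
      rw [Finset.card_range]
      exact Finset.card_image_le.trans_lt (not_le.1 hlow))
  have hno : ∀ w, G.Adj v w → c w ≠ i := fun w hw h =>
    hic (Finset.mem_image.2 ⟨w, by simpa using hw, h⟩)
  refine hG.not_colorable ⟨fun w => if w = v then i else c w, fun w _ => ?_, fun a _ b _ hab => ?_⟩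
  · dsimp only
    split_ifs with h
    · exact Finset.mem_range.1 hi
    · exact hc w h
  · dsimp only
    split_ifs with h1 h2 h2
    · exact absurd (h1.trans h2.symm) hab.ne
    · exact (hno b (h1 ▸ hab)).symm
    · exact hno a (h2 ▸ hab.symm)
    · exact hadj a h1 b h2 hab

theorem DoubleCritical.sep (hG : G.DoubleCritical 6) {x w : V} {D Q : Set V} (hne : D.Nonempty)
    (hx : ∀ d ∈ D, d ≠ x ∧ ¬ G.Adj x d) (hQ : G.IsClique Q) (hQ4 : Q.ncard ≤ 4)
    (hN : ∀ d ∈ D, ∀ v, v ∉ D → G.Adj d v → v ∈ Q ∨ v = w) : False := by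
  set S : Set V := {v | v ∉ D ∧ ∃ d ∈ D, G.Adj d v} with hS
  have hSQ : S ⊆ insert w Q := fun v ⟨hv, d, hd, hdv⟩ => (hN d hd v hv hdv).symm
  have hS5 : S.ncard ≤ 5 := (Set.ncard_le_ncard hSQ).trans
    ((Set.ncard_insert_le _ _).trans (by omega))
  have hout : ∀ v, ∃ y, G.Adj v y ∧ y ∉ S := by
    intro v
    by_contra! hcon
    have h1 := hG.le_degIn v
    rw [degIn_univ_eq] at h1
    have := Set.ncard_le_ncard (s := G.neighborSet v) (t := S) hcon
    omega
  obtain ⟨a, ha⟩ := hne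
  obtain ⟨b, hab, hbS⟩ := hout a
  have hb : b ∈ D := by_contra fun hb => hbS ⟨hb, a, ha, hab⟩
  obtain ⟨y, hxy, hyS⟩ := hout x
  have hyD : y ∉ D := fun h => (hx y h).2 hxy
  obtain ⟨c, hc, hcw⟩ := ((hG.edge a b hab).mono (s := Dᶜ) (by
    rintro v hv (rfl | rfl)
    exacts [hv ha, hv hb])).exists_recoloring w
  obtain ⟨c', hc', hcw'⟩ := ((hG.edge x y hxy).mono (s := D ∪ S) (by
    rintro v (hv | hv) (rfl | rfl)
    · exact (hx v hv).1 rfl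
    · exact hyD hv
    · obtain ⟨-, d, hd, hdv⟩ := hv
      exact (hx d hd).2 hdv.symm
    · exact hyS hv)).exists_recoloring w
  -- both colourings are injective on the attachments of `D`
  have hinj : ∀ (s : Set V) (f : V → Fin 7), S ⊆ s → (∀ a ∈ s, ∀ b ∈ s, G.Adj a b → f a ≠ f b) →
      (∀ v ∈ s, v ≠ w → f v ≠ f w) → Set.InjOn f (insert w S) := by
    intro s f hSs hf hfw u hu v hv huv
    by_contra hne
    by_cases huw : u = w
    · subst huw
      exact hfw v (hSs (hv.resolve_left (Ne.symm hne))) (Ne.symm hne) huv.symm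
    by_cases hvw : v = w
    · subst hvw
      exact hfw u (hSs (hu.resolve_left hne)) hne huv
    replace hu := hu.resolve_left huw
    replace hv := hv.resolve_left hvw
    exact hf u (hSs hu) v (hSs hv)
      (hQ ((hSQ hu).resolve_left huw) ((hSQ hv).resolve_left hvw) hne) huv
  have hi := hinj Dᶜ c (fun v hv => hv.1) hc hcw
  have hi' := hinj (D ∪ S) c' Set.subset_union_right hc' hcw'
  have : Nonempty V := ⟨w⟩
  obtain ⟨π, hπ⟩ : ∃ π : Fin 7 ≃ Fin 7, ∀ v ∈ insert w S, π (c' v) = c v := by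
    obtain ⟨g, hg⟩ := Finset.exists_equiv_extend_of_card_eq (α := Fin 7) (t := Finset.univ)
      (by simp) (s := ((insert w S).toFinset.image c'))
      (f := fun i => c (Function.invFunOn c' (insert w S) i)) (Finset.subset_univ _) (by
        rintro i hi₁ j hj₁ hij
        simp only [Finset.coe_image, Set.coe_toFinset] at hi₁ hj₁
        obtain ⟨u, hu, rfl⟩ := hi₁
        obtain ⟨v, hv, rfl⟩ := hj₁
        have hij : c _ = c _ := hij
        rw [hi'.leftInvOn_invFunOn hu, hi'.leftInvOn_invFunOn hv] at hij
        rw [hi hu hv hij])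
    refine ⟨g.trans (Equiv.subtypeUnivEquiv (by simp)), fun v hv => ?_⟩
    have := hg (c' v) (Finset.mem_image_of_mem _ (Set.mem_toFinset.2 hv))
    rw [hi'.leftInvOn_invFunOn hv] at this
    exact this
  refine hG.not_colorable (colorableOn_univ.2 ⟨Coloring.mk
    (fun v => if v ∈ D then π (c' v) else c v) fun {u v} huv => ?_⟩)
  have hcross : ∀ d ∈ D, ∀ v ∉ D, G.Adj d v → π (c' d) ≠ c v := fun d hd v hv hdv h => by
    have hvS : v ∈ S := ⟨hv, d, hd, hdv⟩
    rw [← hπ v (.inr hvS)] at h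
    exact hc' d (.inl hd) v (.inr hvS) hdv (π.injective h)
  split_ifs with hu hv hv
  · exact π.injective.ne (hc' u (.inl hu) v (.inl hv) huv)
  · exact hcross u hu v hv huv
  · exact (hcross v hv u hu huv.symm).symm
  · exact hc u hu v hv huv

theorem DoubleCritical.top_minorOf (hG : G.DoubleCritical 6) :
    (⊤ : SimpleGraph (Fin 8)).MinorOf G := by
  by_contra hm
  have hE : ∀ n, 5 ≤ n → EdgeBound n := edgeBound_of_not_critical fun V _ G => not_critical
  have hcard : 5 ≤ Fintype.card V := by
    obtain ⟨v⟩ : Nonempty V := by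
      by_contra h
      exact hG.not_colorable ⟨fun _ => 0, fun v => (h ⟨v⟩).elim, fun a => (h ⟨a⟩).elim⟩
    have := hG.le_degIn v
    have := G.degIn_lt_card v
    omega
  refine not_critical (G := G) ⟨hm, bound_of_edgeBound hm fun m h _ => hE m h, ?_,
    fun u v => hG.le_card_common, hG.le_degIn,
    fun x w D Q hD hx hQ hQ4 _ => hG.sep (induce_connected_iff.1 hD).1 hx hQ hQ4, ?_⟩
  · have := hE _ hcard V G rfl hm
    omega
  · rintro ⟨-, -, h⟩
    exact hG.not_colorable (colorableOn_univ.2 (h.mono (by omega)))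

theorem DoubleCritical.top_minorOf_of_le {k j : ℕ} (hk : k + j = 6) :
    ∀ {V : Type} [Fintype V] {G : SimpleGraph V}, G.DoubleCritical k →
      (⊤ : SimpleGraph (Fin (k + 2))).MinorOf G := by
  induction j generalizing k with
  | zero =>
    intro V _ G hG
    obtain rfl : k = 6 := hk
    exact hG.top_minorOf
  | succ j ih =>
    intro V _ G hG
    exact top_minorOf_of_cone (ih (k := k + 1) (by omega) hG.cone)

end Colouring

end SimpleGraph

/-- For every `1 ≤ k ≤ 8`, every connected finite simple graph with chromatic
number `k` that is double-critical (deleting the two endpoints of any edge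
decreases the chromatic number by two) contains `K_k` as a minor. -/
theorem statement8 {V : Type} [Fintype V] (G : SimpleGraph V)
    (k : ℕ) (hk1 : 1 ≤ k) (hk8 : k ≤ 8)
    (hconn : G.Connected)
    (hchi : G.chromaticNumber = (k : ℕ∞))
    (hdc : ∀ u v : V, G.Adj u v →
      (G.induce ({u, v}ᶜ : Set V)).chromaticNumber = G.chromaticNumber - 2) :
    (⊤ : SimpleGraph (Fin k)).MinorOf G := by
  obtain ⟨x⟩ := hconn.nonempty
  obtain rfl | ⟨k, rfl⟩ : k = 1 ∨ ∃ m, k = m + 2 := by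
    rcases k with _ | _ | k
    · omega
    · exact .inl rfl
    · exact .inr ⟨k, rfl⟩
  · exact MinorOf.of_injective_hom (fun _ => x) (Function.injective_of_subsingleton _)
      fun a b hab => (hab.ne (Subsingleton.elim a b)).elim
  have hnot : ¬ G.ColorableOn Set.univ (k + 1) := by
    rw [colorableOn_univ, ← chromaticNumber_le_iff_colorable, hchi, not_le]
    exact_mod_cast Nat.lt_succ_self (k + 1)
  have hedge : ∀ u v, G.Adj u v → G.ColorableOn {u, v}ᶜ k := fun u v huv => by
    rw [colorableOn_iff, ← chromaticNumber_le_iff_colorable, hdc u v huv, hchi]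
    exact_mod_cast le_of_eq (Nat.add_sub_cancel k 2)
  refine DoubleCritical.top_minorOf_of_le (j := 6 - k) (by omega) ⟨hnot, fun v => ?_, hedge⟩
  obtain ⟨u, hvu⟩ : ∃ u, G.Adj v u := by
    have : Nontrivial V := by
      by_contra h
      rw [not_nontrivial_iff_subsingleton] at h
      exact hnot ⟨fun _ => 0, fun _ _ => Nat.succ_pos _, fun a _ b _ hab =>
        (hab.ne (Subsingleton.elim a b)).elim⟩
    exact hconn.preconnected.exists_adj_of_nontrivial v
  refine ((hedge v u hvu).insert u).mono fun w hw => ?_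
  by_cases hwu : w = u
  · exact .inl hwu
  · exact .inr (by simp_all)
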